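/- Let v be continuous on the closed half-space {(x,y) ∈ ℝ^{N+1} : y ≥ 0}, C² on ℝ^{N+1}_+, with finite weighted Dirichlet energy ∫_{ℝ^{N+1}_+} y^{1−2α}|∇v|² dx dy < ∞, satisfying div(y^{1−2α}∇v) = 0 pointwise in ℝ^{N+1}_+ and, for every x ∈ ℝ^N, lim_{y→0⁺} y^{1−2α} ∂v/∂y(x,y) = −|v(x,0)|^{2*_α−2} v(x,0). Then there exists a constant C > 0 such that |v(X)| ≤ C (1 + |X|²)^{−(N−2α)/2} for all X in the closed half-space. -/

import Mathlib

open MeasureTheory Metric Set Filter Topology RealInnerProductSpace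

noncomputable section

/-- Euclidean space ℝ^n. -/
abbrev Euc (n : ℕ) : Type := EuclideanSpace ℝ (Fin n)

/-- Pair `x ∈ ℝ^N` with `y ∈ ℝ` to get the point `X = (x, y)` of `ℝ^{N+1}`. -/
def pt {N : ℕ} (x : Euc N) (y : ℝ) : Euc (N + 1) :=
  (EuclideanSpace.equiv (Fin (N + 1)) ℝ).symm (Fin.snoc (EuclideanSpace.equiv (Fin N) ℝ x) y)

/-- The last coordinate (the "y" variable) of a point of `ℝ^{N+1}`. -/
def yc {N : ℕ} (X : Euc (N + 1)) : ℝ := X (Fin.last N)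

/-- The first `N` coordinates (the "x" variable) of a point of `ℝ^{N+1}`. -/
def xc {N : ℕ} (X : Euc (N + 1)) : Euc N :=
  (EuclideanSpace.equiv (Fin N) ℝ).symm (fun i => X i.castSucc)

/-- The cylinder `C_D = D × (0, ∞) ⊆ ℝ^{N+1}`. -/
def cyl {N : ℕ} (D : Set (Euc N)) : Set (Euc (N + 1)) :=
  {X | xc X ∈ D ∧ 0 < yc X}

/-- The open upper half-space `ℝ^{N+1}_+`. -/
def upperHalf (N : ℕ) : Set (Euc (N + 1)) := {X | 0 < yc X}

/-- Divergence of a vector field on `ℝ^{N+1}`. -/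
def dvg {N : ℕ} (F : Euc (N + 1) → Euc (N + 1)) (X : Euc (N + 1)) : ℝ :=
  ∑ i, fderiv ℝ F X (EuclideanSpace.single i 1) i

/-- The weighted gradient field `y^{1-2α} ∇v`. -/
def wgrad {N : ℕ} (α : ℝ) (v : Euc (N + 1) → ℝ) (X : Euc (N + 1)) : Euc (N + 1) :=
  (yc X ^ (1 - 2 * α)) • gradient v X

/-- The critical exponent `2*_α = 2N/(N - 2α)`. -/
def critExp (N : ℕ) (α : ℝ) : ℝ := 2 * N / (N - 2 * α)

/-- The weighted Dirichlet energy density `y^{1-2α} |∇v|²`. -/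
def eDen {N : ℕ} (α : ℝ) (v : Euc (N + 1) → ℝ) (X : Euc (N + 1)) : ℝ :=
  yc X ^ (1 - 2 * α) * ‖gradient v X‖ ^ 2

/-- `lim_{y→0⁺} y^{1-2α} ∂v/∂y (x, y) = L`. -/
def NeumannLim {N : ℕ} (α : ℝ) (v : Euc (N + 1) → ℝ) (x : Euc N) (L : ℝ) : Prop :=
  Tendsto (fun y : ℝ =>
      y ^ (1 - 2 * α) * fderiv ℝ v (pt x y) (EuclideanSpace.single (Fin.last N) 1))
    (nhdsWithin 0 (Set.Ioi 0)) (nhds L)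

/-- A classical solution of the extension problem on `C_Ω` with exponent `p` and
parameter `lam`. -/
structure ExtSol (N : ℕ) (α lam p : ℝ) (Ω : Set (Euc N)) (v : Euc (N + 1) → ℝ) : Prop where
  cont : ContinuousOn v (closure (cyl Ω))
  smooth : ContDiffOn ℝ 2 v (cyl Ω)
  energy : IntegrableOn (eDen α v) (cyl Ω)
  pde : ∀ X ∈ cyl Ω, dvg (wgrad α v) X = 0
  lateral : ∀ x ∈ frontier Ω, ∀ y : ℝ, 0 < y → v (pt x y) = 0
  neumann : ∀ x ∈ Ω,
    NeumannLim α v x (-(|v (pt x 0)| ^ (p - 2) * v (pt x 0) + lam * v (pt x 0)))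

/-- A classical solution of the linear extension problem on `C_D` with Neumann datum `f`. -/
structure LinSol (N : ℕ) (α : ℝ) (D : Set (Euc N)) (f : Euc N → ℝ) (w : Euc (N + 1) → ℝ) :
    Prop where
  cont : ContinuousOn w (closure (cyl D))
  smooth : ContDiffOn ℝ 2 w (cyl D)
  energy : IntegrableOn (eDen α w) (cyl D)
  pde : ∀ X ∈ cyl D, dvg (wgrad α w) X = 0
  lateral : ∀ x ∈ frontier D, ∀ y : ℝ, 0 < y → w (pt x y) = 0
  neumann : ∀ x ∈ D, NeumannLim α w x (-(f x))

/-- A finite-energy solution of the bubble problem on the half-space with coefficient `b`. -/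
structure BubbleSol (N : ℕ) (α b : ℝ) (W : Euc (N + 1) → ℝ) : Prop where
  cont : ContinuousOn W {X | 0 ≤ yc X}
  smooth : ContDiffOn ℝ 2 W (upperHalf N)
  energy : IntegrableOn (eDen α W) (upperHalf N)
  pde : ∀ X ∈ upperHalf N, dvg (wgrad α W) X = 0
  neumann : ∀ x : Euc N,
    NeumannLim α W x (-(b * (|W (pt x 0)| ^ (critExp N α - 2) * W (pt x 0))))

/-- The rescaling `ρ_{x,σ}(W)(X) = σ^{(N-2α)/2} W(σ(X - (x,0)))`. -/
def resc {N : ℕ} (α : ℝ) (x : Euc N) (σ : ℝ) (W : Euc (N + 1) → ℝ) (X : Euc (N + 1)) : ℝ :=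
  σ ^ (((N : ℝ) - 2 * α) / 2) * W (σ • (X - pt x 0))

/-- A profile decomposition of the sequence `v` with `k` bubbles. -/
structure ProfileDecomp (N : ℕ) (α lam : ℝ) (Ω : Set (Euc N)) (v : ℕ → Euc (N + 1) → ℝ)
    (v₀ : Euc (N + 1) → ℝ) (k : ℕ) (b : Fin k → ℝ) (W : Fin k → Euc (N + 1) → ℝ)
    (xb : ℕ → Fin k → Euc N) (σ : ℕ → Fin k → ℝ) : Prop where
  sol0 : ExtSol N α lam (critExp N α) Ω v₀
  beta_mem : ∀ j, b j ∈ Set.Ioc (0 : ℝ) 1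
  bubble : ∀ j, BubbleSol N α (b j) (W j)
  nontriv : ∀ j, ∃ X, 0 ≤ yc X ∧ W j X ≠ 0
  center_mem : ∀ n j, xb n j ∈ Ω
  scale_pos : ∀ n j, 0 < σ n j
  scale_dist : ∀ j, Tendsto (fun n => σ n j * Metric.infDist (xb n j) (frontier Ω)) atTop atTop
  separation : ∀ i j, i ≠ j →
    Tendsto (fun n => σ n j / σ n i + σ n i / σ n j
      + σ n i * σ n j * dist (xb n i) (xb n j) ^ 2) atTop atTop
  remainder : Tendsto (fun n => ∫ X in upperHalf N,
      eDen α (fun Z => v n Z - v₀ Z - ∑ j, resc α (xb n j) (σ n j) (W j) Z) X) atTop (nhds 0)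

/-- The mixed `(q₁, q₂, σ)` norm of `u` on `D`. -/
def mixedNorm (N : ℕ) (α : ℝ) (D : Set (Euc N)) (q₁ q₂ σ : ℝ) (u : Euc N → ℝ) : ℝ :=
  sInf {β : ℝ | 0 < β ∧ ∃ u₁ u₂ : Euc N → ℝ,
    (∀ x ∈ D, 0 ≤ u₁ x) ∧ (∀ x ∈ D, 0 ≤ u₂ x) ∧ (∀ x ∈ D, |u x| ≤ u₁ x + u₂ x) ∧
    eLpNorm u₁ (ENNReal.ofReal q₁) (volume.restrict D) ≤ ENNReal.ofReal β ∧
    eLpNorm u₂ (ENNReal.ofReal q₂) (volume.restrict D) ≤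
      ENNReal.ofReal (β * σ ^ ((N : ℝ) / critExp N α - (N : ℝ) / q₂))}

lemma yc_pt {N : ℕ} (x : Euc N) (y : ℝ) : yc (pt x y) = y := by
  simp [yc, pt]

lemma xc_pt {N : ℕ} (x : Euc N) (y : ℝ) : xc (pt x y) = x := by
  ext i
  simp [xc, pt]

lemma pt_xc_yc {N : ℕ} (X : Euc (N + 1)) : pt (xc X) (yc X) = X := by
  ext i
  refine Fin.lastCases ?_ (fun j => ?_) i <;> simp [xc, pt, yc]

lemma yc_sub {N : ℕ} (X Y : Euc (N + 1)) : yc (X - Y) = yc X - yc Y := by simp [yc]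

lemma xc_sub {N : ℕ} (X Y : Euc (N + 1)) : xc (X - Y) = xc X - xc Y := by ext i; simp [xc]

lemma euc_ext {N : ℕ} {X Y : Euc (N + 1)} (h₁ : xc X = xc Y) (h₂ : yc X = yc Y) : X = Y := by
  rw [← pt_xc_yc X, ← pt_xc_yc Y, h₁, h₂]

lemma pt_sub {N : ℕ} (x x' : Euc N) (y y' : ℝ) : pt (x - x') (y - y') = pt x y - pt x' y' :=
  euc_ext (by simp [xc_sub, xc_pt]) (by simp [yc_sub, yc_pt])

lemma norm_sq_eq {N : ℕ} (X : Euc (N + 1)) : ‖X‖ ^ 2 = ‖xc X‖ ^ 2 + yc X ^ 2 := by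
  simp [EuclideanSpace.norm_sq_eq, Fin.sum_univ_castSucc, xc, yc]

lemma norm_pt_sq {N : ℕ} (x : Euc N) (y : ℝ) : ‖pt x y‖ ^ 2 = ‖x‖ ^ 2 + y ^ 2 := by
  rw [norm_sq_eq, xc_pt, yc_pt]

lemma norm_xc_le {N : ℕ} (X : Euc (N + 1)) : ‖xc X‖ ≤ ‖X‖ :=
  le_of_sq_le_sq (by nlinarith [norm_sq_eq X, sq_nonneg (yc X)]) (norm_nonneg _)
where
  le_of_sq_le_sq {a b : ℝ} (h : a ^ 2 ≤ b ^ 2) (hb : 0 ≤ b) : a ≤ b := abs_le_of_sq_le_sq' h hb |>.2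

lemma abs_yc_le {N : ℕ} (X : Euc (N + 1)) : |yc X| ≤ ‖X‖ :=
  abs_le_of_sq_le_sq (by nlinarith [norm_sq_eq X, sq_nonneg ‖xc X‖]) (norm_nonneg _)

lemma continuous_yc {N : ℕ} : Continuous (yc : Euc (N + 1) → ℝ) := by
  unfold yc; fun_prop

lemma continuous_xc {N : ℕ} : Continuous (xc : Euc (N + 1) → Euc N) := by
  unfold xc; fun_prop

lemma continuous_pt {N : ℕ} : Continuous (fun p : Euc N × ℝ => pt p.1 p.2) := by
  unfold pt
  refine (ContinuousLinearEquiv.continuous _).comp (continuous_pi fun i => ?_)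
  refine Fin.lastCases ?_ (fun j => ?_) i
  · simpa using continuous_snd
  · simp only [Fin.snoc_castSucc]
    fun_prop

lemma isOpen_upperHalf {N : ℕ} : IsOpen (upperHalf N) :=
  isOpen_lt continuous_const continuous_yc

lemma isClosed_closedHalf {N : ℕ} : IsClosed {X : Euc (N + 1) | 0 ≤ yc X} :=
  isClosed_le continuous_const continuous_yc

lemma pt_add_single {N : ℕ} (x : Euc N) (y t : ℝ) :
    pt x (y + t) = pt x y + t • EuclideanSpace.single (Fin.last N) (1 : ℝ) := by
  refine euc_ext ?_ ?_
  · ext i; simp [xc, pt]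
  · simp [yc, pt]

lemma hasDerivAt_pt {N : ℕ} (x : Euc N) (y : ℝ) :
    HasDerivAt (fun y => pt x y) (EuclideanSpace.single (Fin.last N) (1 : ℝ)) y := by
  have h : (fun y => pt x y) = fun y => pt x 0 + y • EuclideanSpace.single (Fin.last N) (1 : ℝ) := by
    funext y; rw [← pt_add_single, zero_add]
  rw [h]
  simpa using ((hasDerivAt_id y).smul_const _).const_add (pt x 0)

/-- The `i`-th coordinate as a continuous linear functional. -/
def coordL {n : ℕ} (i : Fin n) : Euc n →L[ℝ] ℝ := EuclideanSpace.proj i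

lemma coordL_apply {n : ℕ} (i : Fin n) (X : Euc n) : coordL i X = X i := rfl

lemma coordL_single {n : ℕ} (i j : Fin n) :
    coordL i (EuclideanSpace.single j (1 : ℝ)) = if i = j then 1 else 0 := by
  simp [coordL_apply]

/-- Second pure partial derivative in the `i`-th coordinate direction. -/
def pureSecond {N : ℕ} (f : Euc (N + 1) → ℝ) (i : Fin (N + 1)) (X : Euc (N + 1)) : ℝ :=
  fderiv ℝ (fun Z => fderiv ℝ f Z (EuclideanSpace.single i 1)) X (EuclideanSpace.single i 1)

/-- The nondivergence form `Δf + (1 - 2α) y⁻¹ ∂_y f` of the extension operator. -/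
def extOp {N : ℕ} (α : ℝ) (f : Euc (N + 1) → ℝ) (X : Euc (N + 1)) : ℝ :=
  ∑ i, pureSecond f i X
    + (1 - 2 * α) / yc X * fderiv ℝ f X (EuclideanSpace.single (Fin.last N) 1)

lemma gradient_apply_coord {N : ℕ} (f : Euc (N + 1) → ℝ) (X : Euc (N + 1)) (i : Fin (N + 1)) :
    gradient f X i = fderiv ℝ f X (EuclideanSpace.single i 1) := by
  have : inner ℝ (gradient f X) (EuclideanSpace.single i (1 : ℝ))
      = fderiv ℝ f X (EuclideanSpace.single i 1) := by
    simp [gradient]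
  rw [← this, EuclideanSpace.inner_single_right]
  simp

lemma wgrad_apply {N : ℕ} (α : ℝ) (f : Euc (N + 1) → ℝ) (X : Euc (N + 1)) (i : Fin (N + 1)) :
    wgrad α f X i = yc X ^ (1 - 2 * α) * fderiv ℝ f X (EuclideanSpace.single i 1) := by
  simp [wgrad, gradient_apply_coord]

lemma hasFDerivAt_yc {N : ℕ} (X : Euc (N + 1)) :
    HasFDerivAt (yc : Euc (N + 1) → ℝ) (coordL (Fin.last N)) X :=
  (coordL (Fin.last N)).hasFDerivAt

lemma differentiableAt_partial {N : ℕ} {f : Euc (N + 1) → ℝ} {X : Euc (N + 1)}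
    (hf : ContDiffAt ℝ 2 f X) (e : Euc (N + 1)) :
    DifferentiableAt ℝ (fun Z => fderiv ℝ f Z e) X := by
  have h := (hf.fderiv_right (m := 1) (by norm_num)).differentiableAt (by norm_num)
  exact h.clm_apply (differentiableAt_const e)

lemma contDiffAt_wgrad {N : ℕ} {α : ℝ} {f : Euc (N + 1) → ℝ} {X : Euc (N + 1)}
    (hf : ContDiffAt ℝ 2 f X) (hX : 0 < yc X) : ContDiffAt ℝ 1 (wgrad α f) X := by
  have h1 := hf.fderiv_right (m := 1) (by norm_num)
  have hy : ContDiffAt ℝ 1 (yc : Euc (N + 1) → ℝ) X :=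
    (coordL (Fin.last N)).contDiff.contDiffAt
  rw [contDiffAt_euclidean]
  intro i
  simp only [wgrad_apply]
  exact (hy.rpow_const_of_ne hX.ne').mul (h1.clm_apply contDiffAt_const)

lemma dvg_wgrad {N : ℕ} {α : ℝ} {f : Euc (N + 1) → ℝ} {X : Euc (N + 1)}
    (hf : ContDiffAt ℝ 2 f X) (hX : 0 < yc X) :
    dvg (wgrad α f) X = yc X ^ (1 - 2 * α) * extOp α f X := by
  have hd : DifferentiableAt ℝ (wgrad α f) X :=
    (contDiffAt_wgrad hf hX).differentiableAt (by norm_num)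
  have key : ∀ i, fderiv ℝ (wgrad α f) X (EuclideanSpace.single i 1) i
      = yc X ^ (1 - 2 * α) * pureSecond f i X
        + (if i = Fin.last N then (1 - 2 * α) * yc X ^ (1 - 2 * α - 1)
            * fderiv ℝ f X (EuclideanSpace.single i 1) else 0) := by
    intro i
    have h1 : HasFDerivAt (fun Z => wgrad α f Z i)
        ((coordL i).comp
          (fderiv ℝ (wgrad α f) X)) X :=
      (coordL (n := N + 1) i).hasFDerivAt.comp X
        hd.hasFDerivAt
    have h2 := ((hasFDerivAt_yc X).rpow_const (p := 1 - 2 * α) (Or.inl hX.ne')).mul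
        (differentiableAt_partial hf (EuclideanSpace.single i 1)).hasFDerivAt
    rw [funext fun Z => wgrad_apply α f Z i] at h1
    have := congrArg (fun T : Euc (N + 1) →L[ℝ] ℝ => T (EuclideanSpace.single i 1)) (h1.unique h2)
    simp only [ContinuousLinearMap.comp_apply, coordL_apply] at this
    rw [this]
    by_cases hi : i = Fin.last N
    · subst hi
      simp [pureSecond, coordL_single]
      ring
    · have hi' : ¬ Fin.last N = i := fun h => hi h.symm
      simp [pureSecond, hi, hi', coordL_single]
  unfold dvg extOp
  simp only [key, Finset.sum_add_distrib, Finset.sum_ite_eq', Finset.mem_univ, if_true,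
    ← Finset.mul_sum]
  rw [Real.rpow_sub_one hX.ne']
  ring

/-- `f` is `C²` at `X` with pure first and second partial derivatives `d` and `h`. -/
structure PureJet {N : ℕ} (f : Euc (N + 1) → ℝ) (X : Euc (N + 1)) (d h : Fin (N + 1) → ℝ) :
    Prop where
  contDiffAt : ContDiffAt ℝ 2 f X
  first : ∀ i, fderiv ℝ f X (EuclideanSpace.single i 1) = d i
  second : ∀ i, pureSecond f i X = h i

lemma ContDiffAt.pureJet {N : ℕ} {f : Euc (N + 1) → ℝ} {X : Euc (N + 1)}
    (hf : ContDiffAt ℝ 2 f X) :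
    PureJet f X (fun i => fderiv ℝ f X (EuclideanSpace.single i 1)) (fun i => pureSecond f i X) :=
  ⟨hf, fun _ => rfl, fun _ => rfl⟩

lemma ContDiffAt.eventually_differentiableAt {N : ℕ} {f : Euc (N + 1) → ℝ} {X : Euc (N + 1)}
    (hf : ContDiffAt ℝ 2 f X) : ∀ᶠ Z in 𝓝 X, DifferentiableAt ℝ f Z :=
  (hf.eventually (by simp)).mono fun _ h => h.differentiableAt (by norm_num)

lemma PureJet.extOp_eq {N : ℕ} {α : ℝ} {f : Euc (N + 1) → ℝ} {X : Euc (N + 1)}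
    {d h : Fin (N + 1) → ℝ} (H : PureJet f X d h) :
    extOp α f X = ∑ i, h i + (1 - 2 * α) / yc X * d (Fin.last N) := by
  simp [extOp, H.first, H.second]

/-- Computes a pure jet from first-order partials valid near the point. -/
lemma PureJet.of_eventually {N : ℕ} {f : Euc (N + 1) → ℝ} {X : Euc (N + 1)}
    (hf : ContDiffAt ℝ 2 f X) (D : Fin (N + 1) → Euc (N + 1) → ℝ) {h : Fin (N + 1) → ℝ}
    (hD : ∀ i, ∀ᶠ Z in 𝓝 X, fderiv ℝ f Z (EuclideanSpace.single i 1) = D i Z)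
    (hh : ∀ i, fderiv ℝ (D i) X (EuclideanSpace.single i 1) = h i) :
    PureJet f X (fun i => D i X) h where
  contDiffAt := hf
  first i := (hD i).self_of_nhds
  second i := by
    unfold pureSecond
    rw [Filter.EventuallyEq.fderiv_eq (hD i), hh]

lemma PureJet.add {N : ℕ} {f g : Euc (N + 1) → ℝ} {X : Euc (N + 1)}
    {d h d' h' : Fin (N + 1) → ℝ} (H : PureJet f X d h) (H' : PureJet g X d' h') :
    PureJet (fun Z => f Z + g Z) X (fun i => d i + d' i) (fun i => h i + h' i) := by
  have := PureJet.of_eventually (H.contDiffAt.add H'.contDiffAt)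
    (fun i Z => fderiv ℝ f Z (EuclideanSpace.single i 1) + fderiv ℝ g Z (EuclideanSpace.single i 1))
    (h := fun i => h i + h' i) ?_ ?_
  · simpa only [H.first, H'.first] using this
  · intro i
    filter_upwards [H.contDiffAt.eventually_differentiableAt,
      H'.contDiffAt.eventually_differentiableAt] with Z h1 h2
    rw [fderiv_fun_add h1 h2]; rfl
  · intro i
    rw [fderiv_fun_add (differentiableAt_partial H.contDiffAt _)
      (differentiableAt_partial H'.contDiffAt _)]
    exact congrArg₂ (· + ·) (H.second i) (H'.second i)

lemma PureJet.mul {N : ℕ} {f g : Euc (N + 1) → ℝ} {X : Euc (N + 1)}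
    {d h d' h' : Fin (N + 1) → ℝ} (H : PureJet f X d h) (H' : PureJet g X d' h') :
    PureJet (fun Z => f Z * g Z) X (fun i => f X * d' i + g X * d i)
      (fun i => f X * h' i + 2 * (d i * d' i) + g X * h i) := by
  have hf := H.contDiffAt.differentiableAt (by norm_num)
  have hg := H'.contDiffAt.differentiableAt (by norm_num)
  have := PureJet.of_eventually (H.contDiffAt.mul H'.contDiffAt)
    (fun i Z => f Z * fderiv ℝ g Z (EuclideanSpace.single i 1)
      + g Z * fderiv ℝ f Z (EuclideanSpace.single i 1))
    (h := fun i => f X * h' i + 2 * (d i * d' i) + g X * h i) ?_ ?_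
  · simpa only [H.first, H'.first] using this
  · intro i
    filter_upwards [H.contDiffAt.eventually_differentiableAt,
      H'.contDiffAt.eventually_differentiableAt] with Z h1 h2
    rw [fderiv_fun_mul h1 h2]; simp
  · intro i
    have hpf := differentiableAt_partial H.contDiffAt (EuclideanSpace.single i 1)
    have hpg := differentiableAt_partial H'.contDiffAt (EuclideanSpace.single i 1)
    rw [fderiv_fun_add (hf.fun_mul hpg) (hg.fun_mul hpf), fderiv_fun_mul hf hpg,
      fderiv_fun_mul hg hpf]
    have h1 := H.second i
    have h2 := H'.second i
    unfold pureSecond at h1 h2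
    simp only [add_apply, smul_apply, smul_eq_mul, h1, h2,
      H.first, H'.first]
    ring

lemma PureJet.comp {N : ℕ} {f : Euc (N + 1) → ℝ} {X : Euc (N + 1)} {d h : Fin (N + 1) → ℝ}
    (H : PureJet f X d h) {G G' : ℝ → ℝ} {G'' : ℝ} (hG : ContDiffAt ℝ 2 G (f X))
    (hG' : ∀ᶠ t in 𝓝 (f X), HasDerivAt G (G' t) t) (hG'' : HasDerivAt G' G'' (f X)) :
    PureJet (fun Z => G (f Z)) X (fun i => G' (f X) * d i)
      (fun i => G'' * d i ^ 2 + G' (f X) * h i) := by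
  have hf := H.contDiffAt.differentiableAt (by norm_num)
  have := PureJet.of_eventually (f := fun Z => G (f Z)) (hG.comp X H.contDiffAt)
    (fun i Z => G' (f Z) * fderiv ℝ f Z (EuclideanSpace.single i 1))
    (h := fun i => G'' * d i ^ 2 + G' (f X) * h i) ?_ ?_
  · simpa only [H.first] using this
  · intro i
    filter_upwards [H.contDiffAt.eventually_differentiableAt,
      hf.continuousAt.eventually hG'] with Z h1 h2
    have := (h2.comp_hasFDerivAt Z h1.hasFDerivAt).fderiv
    simp only [Function.comp_def] at this
    rw [this]; simp
  · intro i
    have hpf := differentiableAt_partial H.contDiffAt (EuclideanSpace.single i 1)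
    have h0 := hG''.comp_hasFDerivAt X hf.hasFDerivAt
    have h3 := (h0.mul hpf.hasFDerivAt).fderiv
    have h1 := H.second i
    unfold pureSecond at h1
    have e : fderiv ℝ (fun Z => G' (f Z) * fderiv ℝ f Z (EuclideanSpace.single i 1)) X = _ := h3
    rw [e]
    simp only [add_apply, smul_apply, smul_eq_mul, h1,
      H.first, Function.comp_apply]
    ring

lemma PureJet.const {N : ℕ} (c : ℝ) (X : Euc (N + 1)) :
    PureJet (fun _ => c) X (fun _ => 0) (fun _ => 0) where
  contDiffAt := contDiffAt_const
  first i := by simp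
  second i := by simp [pureSecond]

lemma PureJet.const_mul {N : ℕ} {f : Euc (N + 1) → ℝ} {X : Euc (N + 1)}
    {d h : Fin (N + 1) → ℝ} (H : PureJet f X d h) (c : ℝ) :
    PureJet (fun Z => c * f Z) X (fun i => c * d i) (fun i => c * h i) := by
  simpa using (PureJet.const c X).mul H

lemma extOp_add {N : ℕ} {α : ℝ} {f g : Euc (N + 1) → ℝ} {X : Euc (N + 1)}
    (hf : ContDiffAt ℝ 2 f X) (hg : ContDiffAt ℝ 2 g X) :
    extOp α (fun Z => f Z + g Z) X = extOp α f X + extOp α g X := by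
  rw [(hf.pureJet.add hg.pureJet).extOp_eq]
  simp only [extOp, Finset.sum_add_distrib]
  ring

lemma extOp_const_mul {N : ℕ} {α : ℝ} {f : Euc (N + 1) → ℝ} {X : Euc (N + 1)}
    (hf : ContDiffAt ℝ 2 f X) (c : ℝ) :
    extOp α (fun Z => c * f Z) X = c * extOp α f X := by
  rw [(hf.pureJet.const_mul c).extOp_eq]
  simp only [extOp, ← Finset.mul_sum]
  ring

lemma extOp_const {N : ℕ} (α c : ℝ) (X : Euc (N + 1)) : extOp α (fun _ => c) X = 0 := by
  rw [(PureJet.const c X).extOp_eq]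
  simp

lemma deriv_nonneg_of_isLocalMin {f f' : ℝ → ℝ} {D : ℝ} (hf : ∀ᶠ t in 𝓝 0, HasDerivAt f (f' t) t)
    (hf' : HasDerivAt f' D 0) (hmin : IsLocalMin f 0) : 0 ≤ D := by
  by_contra! hD
  have h0 : f' 0 = 0 := hmin.hasDerivAt_eq_zero hf.self_of_nhds
  have hneg : ∀ᶠ t in 𝓝[>] 0, f' t < 0 := by
    have := hf'.tendsto_slope_zero_right
    filter_upwards [this.eventually_lt_const hD, self_mem_nhdsWithin] with t ht (htp : 0 < t)
    simp only [zero_add, h0, sub_zero, smul_eq_mul] at ht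
    by_contra! hc
    exact absurd ht (not_lt.2 (mul_nonneg (inv_nonneg.2 htp.le) hc))
  obtain ⟨ε, hε, hball⟩ := Metric.eventually_nhds_iff.1 (hf.and hmin)
  obtain ⟨η, hη, hneg⟩ := (mem_nhdsGT_iff_exists_Ioo_subset).1 hneg
  have hη' : (0 : ℝ) < η := hη
  set s := min ε η / 2
  have hs : 0 < s := by positivity
  have hsε : s < ε := by have := min_le_left ε η; simp only [s]; linarith
  have hsη : s < η := by have := min_le_right ε η; simp only [s]; linarith
  have hdist : ∀ t ∈ Icc 0 s, dist t 0 < ε := by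
    intro t ht
    rw [Real.dist_eq, sub_zero, abs_of_nonneg ht.1]; exact lt_of_le_of_lt ht.2 hsε
  have := strictAntiOn_of_hasDerivWithinAt_neg (f := f) (f' := f') (convex_Icc 0 s)
    (fun t ht => (hball (hdist t ht)).1.continuousAt.continuousWithinAt)
    (fun t ht => (hball (hdist t (interior_subset ht))).1.hasDerivWithinAt)
    (fun t ht => by
      rw [interior_Icc] at ht
      exact hneg ⟨ht.1, ht.2.trans hsη⟩)
  have h1 := this (left_mem_Icc.2 hs.le) (right_mem_Icc.2 hs.le) hs
  have h2 := (hball (hdist s (right_mem_Icc.2 hs.le))).2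
  linarith

lemma extOp_nonneg_of_isLocalMin {N : ℕ} {α : ℝ} {f : Euc (N + 1) → ℝ} {X : Euc (N + 1)}
    (hf : ContDiffAt ℝ 2 f X) (hmin : IsLocalMin f X) : 0 ≤ extOp α f X := by
  have h0 : fderiv ℝ f X = 0 := hmin.fderiv_eq_zero
  unfold extOp
  rw [h0]
  simp only [zero_apply, mul_zero, add_zero]
  refine Finset.sum_nonneg fun i _ => ?_
  set e : Euc (N + 1) := EuclideanSpace.single i 1
  have hline : ∀ t : ℝ, HasDerivAt (fun t : ℝ => X + t • e) e t := fun t => by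
    simpa using ((hasDerivAt_id t).smul_const e).const_add X
  have hcont : Tendsto (fun t : ℝ => X + t • e) (𝓝 0) (𝓝 X) := by
    simpa using (hline 0).continuousAt.tendsto
  refine deriv_nonneg_of_isLocalMin (f := fun t => f (X + t • e))
    (f' := fun t => fderiv ℝ f (X + t • e) e) ?_ ?_ ?_
  · filter_upwards [hcont.eventually hf.eventually_differentiableAt] with t ht
    exact ht.hasFDerivAt.comp_hasDerivAt t (hline t)
  · have hd := differentiableAt_partial hf e
    have : HasFDerivAt (fun Z => fderiv ℝ f Z e) (fderiv ℝ (fun Z => fderiv ℝ f Z e) X)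
        (X + (0 : ℝ) • e) := by simpa using hd.hasFDerivAt
    exact this.comp_hasDerivAt 0 (hline 0)
  · have := hcont.eventually hmin
    simpa [IsLocalMin, IsMinFilter] using this

lemma NeumannLim.nonneg_of_min {N : ℕ} {α : ℝ} {f : Euc (N + 1) → ℝ} {x : Euc N} {L : ℝ}
    (hL : NeumannLim α f x L)
    (hcont : ContinuousWithinAt f {X | 0 ≤ yc X} (pt x 0))
    (hd : ∀ X, 0 < yc X → DifferentiableAt ℝ f X)
    (hmin : ∀ᶠ y in 𝓝[>] (0 : ℝ), f (pt x 0) ≤ f (pt x y)) : 0 ≤ L := by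
  by_contra! hneg
  obtain ⟨η, hη, H⟩ := (mem_nhdsGT_iff_exists_Ioo_subset).1
    ((hL.eventually_lt_const hneg).and hmin)
  have hη' : (0 : ℝ) < η := hη
  have hcpt : Continuous (fun y : ℝ => pt x y) := continuous_pt.comp (continuous_const.prodMk continuous_id)
  have := strictAntiOn_of_hasDerivWithinAt_neg (f := fun y => f (pt x y))
    (f' := fun y => fderiv ℝ f (pt x y) (EuclideanSpace.single (Fin.last N) 1))
    (convex_Icc 0 (η / 2))
    (fun y hy => by
      rcases hy.1.eq_or_lt with rfl | h
      · exact ContinuousWithinAt.comp (g := f) (f := fun y => pt x y) hcont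
          hcpt.continuousWithinAt fun y hy => by simpa [yc_pt] using hy.1
      · exact ((hd (pt x y) (by simpa [yc_pt] using h)).continuousAt.comp
          (f := fun y => pt x y) hcpt.continuousAt).continuousWithinAt)
    (fun y hy => by
      rw [interior_Icc] at hy
      exact ((hd (pt x y) (by simpa [yc_pt] using hy.1)).hasFDerivAt.comp_hasDerivAt y
        (hasDerivAt_pt x y)).hasDerivWithinAt)
    (fun y hy => by
      rw [interior_Icc] at hy
      have h1 := (H ⟨hy.1, by linarith [hy.2]⟩).1
      by_contra! hc
      exact absurd h1 (not_lt.2 (mul_nonneg (Real.rpow_nonneg hy.1.le _) hc)))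
  have h1 := this (left_mem_Icc.2 (by positivity)) (right_mem_Icc.2 (by positivity))
    (by positivity : (0 : ℝ) < η / 2)
  have h2 := (H (⟨by positivity, by linarith⟩ : η / 2 ∈ Ioo 0 η)).2
  simp only at h1
  linarith

lemma pureJet_yc {N : ℕ} (X : Euc (N + 1)) :
    PureJet (yc : Euc (N + 1) → ℝ) X (fun i => if i = Fin.last N then 1 else 0) (fun _ => 0) := by
  have hd : ∀ Z : Euc (N + 1), ∀ i, fderiv ℝ yc Z (EuclideanSpace.single i 1)
      = if i = Fin.last N then (1 : ℝ) else 0 := fun Z i => by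
    rw [(hasFDerivAt_yc Z).fderiv, coordL_single]
    simp [eq_comm]
  refine PureJet.of_eventually (coordL (Fin.last N)).contDiff.contDiffAt
    (fun i _ => if i = Fin.last N then 1 else 0) (fun i => .of_forall fun Z => hd Z i) fun i => ?_
  simp

lemma pureJet_normSq {N : ℕ} (P X : Euc (N + 1)) :
    PureJet (fun Z => ‖Z - P‖ ^ 2) X (fun i => 2 * (X - P) i) (fun _ => 2) := by
  have hc : ContDiff ℝ 2 (fun Z : Euc (N + 1) => ‖Z - P‖ ^ 2) :=
    (contDiff_id.sub contDiff_const).norm_sq ℝ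
  refine PureJet.of_eventually hc.contDiffAt (fun i Z => 2 * (Z - P) i)
    (fun i => .of_forall fun Z => ?_) fun i => ?_
  · have h := (((hasFDerivAt_id Z).sub_const P).norm_sq)
    simp only [id] at h
    rw [h.fderiv]
    simp [EuclideanSpace.inner_single_right]
  · have h := (((coordL i).hasFDerivAt (x := X)).sub_const (P i)).const_mul 2
    have h2 : (fun Z : Euc (N + 1) => 2 * (Z - P) i) = fun Z => 2 * (coordL i Z - P i) := by
      funext Z; simp [coordL_apply]
    rw [h2, h.fderiv]
    simp [coordL_single]

lemma hasDerivAt_rpow_of_pos {t : ℝ} (ht : 0 < t) (c : ℝ) :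
    HasDerivAt (fun t : ℝ => t ^ c) (c * t ^ (c - 1)) t :=
  Real.hasDerivAt_rpow_const (Or.inl ht.ne')

lemma PureJet.rpow {N : ℕ} {f : Euc (N + 1) → ℝ} {X : Euc (N + 1)} {d h : Fin (N + 1) → ℝ}
    (H : PureJet f X d h) (hf : 0 < f X) (c : ℝ) :
    PureJet (fun Z => f Z ^ c) X (fun i => c * f X ^ (c - 1) * d i)
      (fun i => c * ((c - 1) * f X ^ (c - 1 - 1)) * d i ^ 2 + c * f X ^ (c - 1) * h i) :=
  H.comp (G := fun t => t ^ c) (G' := fun t => c * t ^ (c - 1))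
    (contDiffAt_id.rpow_const_of_ne hf.ne')
    ((lt_mem_nhds hf).mono fun _ ht => hasDerivAt_rpow_of_pos ht c)
    ((hasDerivAt_rpow_of_pos hf (c - 1)).const_mul c)

lemma sum_sq_coord {N : ℕ} (X : Euc (N + 1)) : ∑ i, X i ^ 2 = ‖X‖ ^ 2 := by
  simp [EuclideanSpace.norm_sq_eq]

lemma extOp_mul {N : ℕ} {α : ℝ} {f g : Euc (N + 1) → ℝ} {X : Euc (N + 1)}
    {d h d' h' : Fin (N + 1) → ℝ} (H : PureJet f X d h) (H' : PureJet g X d' h') :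
    extOp α (fun Z => f Z * g Z) X
      = f X * extOp α g X + g X * extOp α f X + 2 * ∑ i, d i * d' i := by
  rw [(H.mul H').extOp_eq, H.extOp_eq, H'.extOp_eq]
  simp only [Finset.sum_add_distrib, ← Finset.mul_sum]
  ring

lemma extOp_normSq {N : ℕ} {α : ℝ} {P X : Euc (N + 1)} (hP : yc P = 0) (hX : 0 < yc X) :
    extOp α (fun Z => ‖Z - P‖ ^ 2) X = 2 * (N + 1) + 2 * (1 - 2 * α) := by
  rw [(pureJet_normSq P X).extOp_eq]
  have : (X - P) (Fin.last N) = yc X := by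
    have := yc_sub X P
    rw [hP, sub_zero] at this
    exact this
  rw [this]
  simp
  field_simp

lemma extOp_ycSq {N : ℕ} {α : ℝ} {X : Euc (N + 1)} (hX : 0 < yc X) :
    extOp α (fun Z => yc Z * yc Z) X = 2 + 2 * (1 - 2 * α) := by
  rw [((pureJet_yc X).mul (pureJet_yc X)).extOp_eq]
  simp
  field_simp
  ring

lemma extOp_ycRpow {N : ℕ} {α : ℝ} {X : Euc (N + 1)} (hX : 0 < yc X) :
    extOp α (fun Z => yc Z ^ (2 * α)) X = 0 := by
  rw [((pureJet_yc X).rpow hX (2 * α)).extOp_eq]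
  have h1 : yc X ^ (2 * α - 1) = yc X ^ (2 * α - 1 - 1) * yc X := by
    rw [← Real.rpow_add_one hX.ne']; ring_nf
  simp [h1]
  field_simp
  ring

lemma extOp_normSqRpow {N : ℕ} {α : ℝ} {X : Euc (N + 1)} (hX : 0 < yc X) (s : ℝ) :
    extOp α (fun Z => (‖Z‖ ^ 2) ^ (-s)) X
      = 4 * s * (s - ((N : ℝ) - 2 * α) / 2) * (‖X‖ ^ 2) ^ (-s - 1) := by
  have hq : 0 < ‖X‖ ^ 2 := by nlinarith [norm_sq_eq X, sq_nonneg ‖xc X‖]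
  have hj := pureJet_normSq 0 X
  simp only [sub_zero] at hj
  rw [(hj.rpow hq (-s)).extOp_eq]
  have h1 : (‖X‖ ^ 2) ^ (-s - 1) = (‖X‖ ^ 2) ^ (-s - 1 - 1) * ‖X‖ ^ 2 := by
    rw [← Real.rpow_add_one hq.ne']; ring_nf
  have h2 : X (Fin.last N) = yc X := rfl
  simp only [Finset.sum_add_distrib, ← Finset.mul_sum, mul_pow, sum_sq_coord, h1, h2]
  simp
  field_simp
  ring

lemma extOp_ycRpow_mul_normSqRpow {N : ℕ} {α : ℝ} {X : Euc (N + 1)} (hX : 0 < yc X) (s : ℝ) :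
    extOp α (fun Z => yc Z ^ (2 * α) * (‖Z‖ ^ 2) ^ (-s)) X
      = 4 * s * (s - ((N : ℝ) - 2 * α) / 2 - 2 * α) * (yc X ^ (2 * α) * (‖X‖ ^ 2) ^ (-s - 1)) := by
  have hq : 0 < ‖X‖ ^ 2 := by nlinarith [norm_sq_eq X, sq_nonneg ‖xc X‖]
  have hj := pureJet_normSq 0 X
  simp only [sub_zero] at hj
  rw [extOp_mul ((pureJet_yc X).rpow hX (2 * α)) (hj.rpow hq (-s)), extOp_normSqRpow hX,
    extOp_ycRpow hX]
  have h1 : yc X ^ (2 * α) = yc X ^ (2 * α - 1) * yc X := by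
    rw [← Real.rpow_add_one hX.ne']; ring_nf
  have h2 : X (Fin.last N) = yc X := rfl
  simp only [mul_ite, mul_one, mul_zero, ite_mul, zero_mul, Finset.sum_ite_eq', Finset.mem_univ,
    if_true, h1, h2]
  ring

lemma NeumannLim.add {N : ℕ} {α : ℝ} {f g : Euc (N + 1) → ℝ} {x : Euc N} {L M : ℝ}
    (hf : NeumannLim α f x L) (hg : NeumannLim α g x M)
    (hfd : ∀ X, 0 < yc X → DifferentiableAt ℝ f X) (hgd : ∀ X, 0 < yc X → DifferentiableAt ℝ g X) :
    NeumannLim α (fun Z => f Z + g Z) x (L + M) := by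
  refine Tendsto.congr' ?_ (Tendsto.add hf hg)
  filter_upwards [self_mem_nhdsWithin] with y (hy : 0 < y)
  rw [fderiv_fun_add (hfd _ (by rwa [yc_pt])) (hgd _ (by rwa [yc_pt])), add_apply]
  ring

lemma NeumannLim.const_mul {N : ℕ} {α : ℝ} {f : Euc (N + 1) → ℝ} {x : Euc N} {L : ℝ}
    (hf : NeumannLim α f x L) (hfd : ∀ X, 0 < yc X → DifferentiableAt ℝ f X) (c : ℝ) :
    NeumannLim α (fun Z => c * f Z) x (c * L) := by
  refine Tendsto.congr' ?_ (Tendsto.const_mul c hf)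
  filter_upwards [self_mem_nhdsWithin] with y (hy : 0 < y)
  rw [fderiv_const_mul (hfd _ (by rwa [yc_pt])), smul_apply, smul_eq_mul]
  ring

lemma NeumannLim.const {N : ℕ} (α c : ℝ) (x : Euc N) : NeumannLim α (fun _ => c) x 0 := by
  simp [NeumannLim]

lemma tendsto_rpow_zero_right {c : ℝ} (hc : 0 < c) :
    Tendsto (fun y : ℝ => y ^ c) (𝓝[>] 0) (𝓝 0) := by
  have h : ContinuousAt (fun y : ℝ => y ^ c) 0 := Real.continuousAt_rpow_const 0 c (Or.inr hc.le)
  have h2 := h.tendsto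
  rw [Real.zero_rpow hc.ne'] at h2
  exact h2.mono_left nhdsWithin_le_nhds

lemma neumannLim_normSq {N : ℕ} {α : ℝ} (hα : α < 1) {P : Euc (N + 1)} (hP : yc P = 0)
    (x : Euc N) : NeumannLim α (fun Z => ‖Z - P‖ ^ 2) x 0 := by
  have h := (tendsto_rpow_zero_right (c := 2 - 2 * α) (by linarith)).const_mul 2
  rw [mul_zero] at h
  refine h.congr' ?_
  filter_upwards [self_mem_nhdsWithin] with y (hy : 0 < y)
  rw [(pureJet_normSq P (pt x y)).first]
  have h3 : (pt x y - P) (Fin.last N) = y := by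
    have := yc_sub (pt x y) P
    rwa [hP, sub_zero, yc_pt] at this
  rw [h3, show 2 - 2 * α = (1 - 2 * α) + 1 by ring, Real.rpow_add_one hy.ne']
  ring

lemma neumannLim_ycSq {N : ℕ} {α : ℝ} (hα : α < 1) (x : Euc N) :
    NeumannLim α (fun Z : Euc (N + 1) => yc Z * yc Z) x 0 := by
  have h := (tendsto_rpow_zero_right (c := 2 - 2 * α) (by linarith)).const_mul 2
  rw [mul_zero] at h
  refine h.congr' ?_
  filter_upwards [self_mem_nhdsWithin] with y (hy : 0 < y)
  rw [((pureJet_yc (pt x y)).mul (pureJet_yc (pt x y))).first]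
  simp only [yc_pt, if_true]
  rw [show 2 - 2 * α = (1 - 2 * α) + 1 by ring, Real.rpow_add_one hy.ne']
  ring

lemma neumannLim_ycRpow {N : ℕ} {α : ℝ} (x : Euc N) :
    NeumannLim α (fun Z : Euc (N + 1) => yc Z ^ (2 * α)) x (2 * α) := by
  refine Tendsto.congr' ?_ tendsto_const_nhds
  filter_upwards [self_mem_nhdsWithin] with y (hy : 0 < y)
  rw [((pureJet_yc (pt x y)).rpow (by rwa [yc_pt]) (2 * α)).first]
  simp only [yc_pt, if_true]
  have : y ^ (1 - 2 * α) * y ^ (2 * α - 1) = 1 := by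
    rw [← Real.rpow_add hy]; simp
  linear_combination (-2 * α) * this

lemma tendsto_normSqRpow_pt {N : ℕ} {x : Euc N} (hx : x ≠ 0) (s : ℝ) :
    Tendsto (fun y : ℝ => (‖pt x y‖ ^ 2) ^ s) (𝓝[>] 0) (𝓝 ((‖x‖ ^ 2) ^ s)) := by
  have hx' : 0 < ‖x‖ ^ 2 := by positivity
  have h : ContinuousAt (fun y : ℝ => (‖x‖ ^ 2 + y ^ 2) ^ s) 0 :=
    ContinuousAt.rpow_const (by fun_prop) (Or.inl (by simpa using hx))
  have h2 := h.tendsto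
  simp only [ne_eq, OfNat.ofNat_ne_zero, not_false_eq_true, zero_pow, add_zero] at h2
  simp only [norm_pt_sq]
  exact h2.mono_left nhdsWithin_le_nhds

lemma normSq_pos_of_yc_pos {N : ℕ} {X : Euc (N + 1)} (hX : 0 < yc X) : 0 < ‖X‖ ^ 2 := by
  nlinarith [norm_sq_eq X, sq_nonneg ‖xc X‖]

lemma pureJet_normSqRpow {N : ℕ} {X : Euc (N + 1)} (hX : 0 < yc X) (s : ℝ) :
    PureJet (fun Z => (‖Z‖ ^ 2) ^ s) X (fun i => s * (‖X‖ ^ 2) ^ (s - 1) * (2 * X i))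
      (fun i => s * ((s - 1) * (‖X‖ ^ 2) ^ (s - 1 - 1)) * (2 * X i) ^ 2
        + s * (‖X‖ ^ 2) ^ (s - 1) * 2) := by
  have hj := pureJet_normSq 0 X
  simp only [sub_zero] at hj
  exact hj.rpow (normSq_pos_of_yc_pos hX) s

lemma neumannLim_normSqRpow {N : ℕ} {α : ℝ} (hα : α < 1) {x : Euc N} (hx : x ≠ 0) (s : ℝ) :
    NeumannLim α (fun Z => (‖Z‖ ^ 2) ^ s) x 0 := by
  have h := ((tendsto_rpow_zero_right (c := 2 - 2 * α) (by linarith)).mul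
    (tendsto_normSqRpow_pt hx (s - 1))).const_mul (2 * s)
  simp only [zero_mul, mul_zero] at h
  refine h.congr' ?_
  filter_upwards [self_mem_nhdsWithin] with y (hy : 0 < y)
  rw [(pureJet_normSqRpow (by rwa [yc_pt]) s).first]
  have h2 : (pt x y) (Fin.last N) = y := yc_pt x y
  rw [h2, show 2 - 2 * α = (1 - 2 * α) + 1 by ring, Real.rpow_add_one hy.ne']
  ring

lemma neumannLim_ycRpow_mul_normSqRpow {N : ℕ} {α : ℝ} (hα : α ∈ Set.Ioo (0 : ℝ) 1) {x : Euc N}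
    (hx : x ≠ 0) (s : ℝ) :
    NeumannLim α (fun Z => yc Z ^ (2 * α) * (‖Z‖ ^ 2) ^ s) x (2 * α * (‖x‖ ^ 2) ^ s) := by
  have h1 := (tendsto_normSqRpow_pt hx s).mul (neumannLim_ycRpow (α := α) x)
  have h2 := (tendsto_rpow_zero_right (c := 2 * α) (by linarith [hα.1])).mul
    (neumannLim_normSqRpow hα.2 hx s)
  have h3 := h1.add h2
  rw [show (‖x‖ ^ 2) ^ s * (2 * α) + 0 * 0 = 2 * α * (‖x‖ ^ 2) ^ s by ring] at h3
  refine h3.congr' ?_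
  filter_upwards [self_mem_nhdsWithin] with y (hy : 0 < y)
  have hy' : 0 < yc (pt x y) := by rwa [yc_pt]
  have j1 := (pureJet_yc (pt x y)).rpow hy' (2 * α)
  have j2 := pureJet_normSqRpow hy' s
  rw [(j1.mul j2).first, j1.first, j2.first]
  simp only [yc_pt]
  ring

lemma false_of_isMinOn {N : ℕ} {α : ℝ} {S : Set (Euc (N + 1))} {z : Euc (N + 1) → ℝ}
    {X : Euc (N + 1)} (hX : 0 ≤ yc X) (hmin : IsMinOn z S X)
    (hinner : 0 < yc X → S ∈ 𝓝 X ∧ ContDiffAt ℝ 2 z X ∧ extOp α z X < 0)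
    (hbot : yc X = 0 → (∀ᶠ y in 𝓝[>] (0 : ℝ), pt (xc X) y ∈ S) ∧
      ContinuousWithinAt z {X | 0 ≤ yc X} X ∧ (∀ Y, 0 < yc Y → DifferentiableAt ℝ z Y) ∧
      ∃ L < 0, NeumannLim α z (xc X) L) : False := by
  rcases hX.eq_or_lt with h | h
  · obtain ⟨hS, hc, hd, L, hL, hn⟩ := hbot h.symm
    have hXp : pt (xc X) 0 = X := by rw [h, pt_xc_yc]
    refine absurd (hn.nonneg_of_min (by rwa [hXp]) hd ?_) (not_le.2 hL)
    filter_upwards [hS] with y hy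
    rw [hXp]
    exact hmin hy
  · obtain ⟨hS, hc, hneg⟩ := hinner h
    exact absurd (extOp_nonneg_of_isLocalMin hc (hmin.isLocalMin hS)) (not_le.2 hneg)

/-- `v` is continuous on the closed half-space and solves `div(y^{1-2α} ∇v) = 0` inside. -/
structure HarmExt {N : ℕ} (α : ℝ) (v : Euc (N + 1) → ℝ) : Prop where
  cont : ContinuousOn v {X | 0 ≤ yc X}
  smooth : ∀ X, 0 < yc X → ContDiffAt ℝ 2 v X
  eq_zero : ∀ X, 0 < yc X → extOp α v X = 0

lemma HarmExt.const_mul {N : ℕ} {α : ℝ} {v : Euc (N + 1) → ℝ} (hv : HarmExt α v) (c : ℝ) :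
    HarmExt α (fun X => c * v X) where
  cont := continuousOn_const.mul hv.cont
  smooth X hX := contDiffAt_const.mul (hv.smooth X hX)
  eq_zero X hX := by rw [extOp_const_mul (hv.smooth X hX), hv.eq_zero X hX, mul_zero]

lemma HarmExt.differentiableAt {N : ℕ} {α : ℝ} {v : Euc (N + 1) → ℝ} (hv : HarmExt α v)
    (X : Euc (N + 1)) (hX : 0 < yc X) : DifferentiableAt ℝ v X :=
  (hv.smooth X hX).differentiableAt (by norm_num)

lemma contDiffAt_ycRpow {N : ℕ} {X : Euc (N + 1)} (hX : 0 < yc X) (c : ℝ) :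
    ContDiffAt ℝ 2 (fun Z : Euc (N + 1) => yc Z ^ c) X :=
  ((pureJet_yc X).rpow hX c).contDiffAt

lemma continuous_ycRpow {N : ℕ} {c : ℝ} (hc : 0 ≤ c) :
    Continuous (fun Z : Euc (N + 1) => yc Z ^ c) :=
  continuous_yc.rpow_const fun _ => Or.inr hc

lemma xc_sub_pt_zero {N : ℕ} (x : Euc N) (X : Euc (N + 1)) :
    ‖X - pt x 0‖ ^ 2 = ‖xc X - x‖ ^ 2 + yc X ^ 2 := by
  rw [norm_sq_eq, xc_sub, yc_sub, xc_pt, yc_pt, sub_zero]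

/-- Upper bound on the axis of a flat cylinder in terms of the values on the top, on the lateral
side, and of the flux through the bottom. -/
lemma HarmExt.le_of_cylinder {N : ℕ} {α : ℝ} (hα : α ∈ Set.Ioo (0 : ℝ) 1) (hN : 0 < N)
    {v : Euc (N + 1) → ℝ} (hv : HarmExt α v) {x₀ : Euc N} {b σ G K T : ℝ}
    (hb : 0 < b) (hσ : 0 < σ) (hK : 0 < K)
    (htop : ∀ x, ‖x - x₀‖ ≤ b → v (pt x σ) ≤ T)
    (hlat : ∀ x, ‖x - x₀‖ = b → ∀ y, 0 ≤ y → y ≤ σ →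
      v (pt x y) ≤ T + K * b ^ 2 + min G 0 * (σ ^ (2 * α) / (2 * α)))
    (hneu : ∀ x, ‖x - x₀‖ < b → ∃ L, -G < L ∧ NeumannLim α v x L)
    {y : ℝ} (hy : 0 ≤ y) (hyσ : y ≤ σ) :
    v (pt x₀ y) ≤ T + G * ((σ ^ (2 * α) - y ^ (2 * α)) / (2 * α))
      + K * (N / (1 - α)) * (σ ^ 2 - y ^ 2) := by
  obtain ⟨hα0, hα1⟩ := hα
  have hNR : (0 : ℝ) < N := by exact_mod_cast hN
  set A : ℝ := N / (1 - α) with hA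
  have hA0 : 0 < A := div_pos hNR (by linarith)
  have hA1 : A * (1 - α) = N := div_mul_cancel₀ _ (by linarith)
  set S : Set (Euc (N + 1)) := {X | ‖xc X - x₀‖ ≤ b ∧ 0 ≤ yc X ∧ yc X ≤ σ} with hS
  set c₀ : ℝ := T + G * (σ ^ (2 * α) / (2 * α)) + K * A * σ ^ 2 with hc₀
  set z : Euc (N + 1) → ℝ := fun Z => ((((c₀ + (-(G / (2 * α))) * yc Z ^ (2 * α))
    + K * ‖Z - pt x₀ 0‖ ^ 2) + (-(K * (1 + A))) * (yc Z * yc Z)) + (-1) * v Z) with hz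
  have hzval : ∀ X, z X = T + G * ((σ ^ (2 * α) - yc X ^ (2 * α)) / (2 * α))
      + K * A * (σ ^ 2 - yc X ^ 2) + K * ‖xc X - x₀‖ ^ 2 - v X := fun X => by
    simp only [hz, hc₀, xc_sub_pt_zero]; ring
  have hScl : IsCompact S := by
    refine Metric.isCompact_of_isClosed_isBounded ?_ ?_
    · exact (isClosed_le (continuous_xc.sub continuous_const).norm continuous_const).inter
        ((isClosed_le continuous_const continuous_yc).inter
          (isClosed_le continuous_yc continuous_const))
    · refine (Metric.isBounded_closedBall (x := pt x₀ 0) (r := b + σ)).subset fun X hX => ?_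
      rw [mem_closedBall, dist_eq_norm]
      refine abs_le_of_sq_le_sq' ?_ (by positivity) |>.2
      rw [xc_sub_pt_zero]
      nlinarith [hX.1, hX.2.1, hX.2.2, norm_nonneg (xc X - x₀)]
  have c1 : ∀ X : Euc (N + 1), 0 < yc X → ContDiffAt ℝ 2
      (fun Z : Euc (N + 1) => c₀ + (-(G / (2 * α))) * yc Z ^ (2 * α)) X := fun X hX =>
    contDiffAt_const.add (contDiffAt_const.mul (contDiffAt_ycRpow hX _))
  have c2 : ∀ X : Euc (N + 1), ContDiffAt ℝ 2
      (fun Z : Euc (N + 1) => K * ‖Z - pt x₀ 0‖ ^ 2) X := fun X =>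
    contDiffAt_const.mul (pureJet_normSq _ X).contDiffAt
  have c3 : ∀ X : Euc (N + 1), ContDiffAt ℝ 2
      (fun Z : Euc (N + 1) => (-(K * (1 + A))) * (yc Z * yc Z)) X := fun X =>
    contDiffAt_const.mul ((pureJet_yc X).mul (pureJet_yc X)).contDiffAt
  have c4 : ∀ X : Euc (N + 1), 0 < yc X → ContDiffAt ℝ 2 (fun Z => (-1) * v Z) X := fun X hX =>
    contDiffAt_const.mul (hv.smooth X hX)
  have hzc : ∀ X, 0 < yc X → ContDiffAt ℝ 2 z X := fun X hX =>
    (((c1 X hX).add (c2 X)).add (c3 X)).add (c4 X hX)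
  have hzop : ∀ X, 0 < yc X → extOp α z X < 0 := fun X hX => by
    rw [hz, extOp_add (((c1 X hX).add (c2 X)).add (c3 X)) (c4 X hX),
      extOp_add ((c1 X hX).add (c2 X)) (c3 X), extOp_add (c1 X hX) (c2 X),
      extOp_add contDiffAt_const (contDiffAt_const.mul (contDiffAt_ycRpow hX _)),
      extOp_const_mul (contDiffAt_ycRpow hX _), extOp_const_mul (pureJet_normSq _ X).contDiffAt,
      extOp_const_mul ((pureJet_yc X).mul (pureJet_yc X)).contDiffAt,
      extOp_const_mul (hv.smooth X hX), hv.eq_zero X hX, extOp_const, extOp_ycRpow hX,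
      extOp_normSq (yc_pt _ _) hX, extOp_ycSq hX]
    nlinarith [mul_pos hK hNR]
  have hzcont : ContinuousOn z {X | 0 ≤ yc X} := by
    refine ContinuousOn.add (Continuous.continuousOn ?_) (continuousOn_const.mul hv.cont)
    have := continuous_ycRpow (N := N) (c := 2 * α) (by positivity)
    have := continuous_yc (N := N)
    fun_prop
  have hSsub : S ⊆ {X | 0 ≤ yc X} := fun X hX => hX.2.1
  have hmem : pt x₀ y ∈ S := by simp [hS, xc_pt, yc_pt, hb.le, hy, hyσ]
  obtain ⟨X, hXS, hXmin⟩ := hScl.exists_isMinOn ⟨_, hmem⟩ (hzcont.mono hSsub)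
  suffices h : 0 ≤ z X by
    have h2 : z X ≤ z (pt x₀ y) := hXmin hmem
    rw [hzval (pt x₀ y), xc_pt, yc_pt, sub_self, norm_zero] at h2
    linarith
  by_contra! hneg
  have hpow : ∀ t, 0 ≤ t → t ≤ σ → 0 ≤ (σ ^ (2 * α) - t ^ (2 * α)) / (2 * α) ∧
      (σ ^ (2 * α) - t ^ (2 * α)) / (2 * α) ≤ σ ^ (2 * α) / (2 * α) := fun t h0 h1 => by
    have := Real.rpow_le_rpow h0 h1 (by positivity : 0 ≤ 2 * α)
    have := Real.rpow_nonneg h0 (2 * α)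
    constructor
    · apply div_nonneg <;> linarith
    · gcongr; linarith
  have hX1 : ‖xc X - x₀‖ < b := by
    refine hXS.1.lt_of_ne fun h => ?_
    have h1 := hlat (xc X) h (yc X) hXS.2.1 hXS.2.2
    rw [pt_xc_yc] at h1
    rw [hzval, h] at hneg
    obtain ⟨p1, p2⟩ := hpow _ hXS.2.1 hXS.2.2
    have h2 : min G 0 * (σ ^ (2 * α) / (2 * α))
        ≤ G * ((σ ^ (2 * α) - yc X ^ (2 * α)) / (2 * α)) := by
      rcases le_total G 0 with hG | hG
      · rw [min_eq_left hG]; exact mul_le_mul_of_nonpos_left p2 hG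
      · rw [min_eq_right hG, zero_mul]; positivity
    have h3 : 0 ≤ K * A * (σ ^ 2 - yc X ^ 2) :=
      mul_nonneg (by positivity) (by nlinarith [hXS.2.1, hXS.2.2])
    linarith
  have hX2 : yc X < σ := by
    refine hXS.2.2.lt_of_ne fun h => ?_
    have h1 := htop (xc X) hXS.1
    rw [← h, pt_xc_yc] at h1
    rw [hzval, h] at hneg
    have : 0 ≤ K * ‖xc X - x₀‖ ^ 2 := by positivity
    simp only [sub_self, zero_div, mul_zero, add_zero] at hneg
    linarith
  refine false_of_isMinOn (α := α) hXS.2.1 hXmin (fun hpos => ⟨?_, hzc X hpos, hzop X hpos⟩)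
    fun h0 => ⟨?_, hzcont X hXS.2.1, fun Y hY => (hzc Y hY).differentiableAt (by norm_num), ?_⟩
  · have o1 : ∀ᶠ Y in 𝓝 X, ‖xc Y - x₀‖ < b :=
      ((continuous_xc.sub continuous_const).norm.continuousAt).eventually_lt_const hX1
    have o2 : ∀ᶠ Y in 𝓝 X, 0 < yc Y := continuous_yc.continuousAt.eventually_const_lt hpos
    have o3 : ∀ᶠ Y in 𝓝 X, yc Y < σ := continuous_yc.continuousAt.eventually_lt_const hX2
    filter_upwards [o1, o2, o3] with Y h1 h2 h3
    exact ⟨h1.le, h2.le, h3.le⟩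
  · filter_upwards [Ioo_mem_nhdsGT hσ] with t ht
    simp only [hS, mem_ofPred_eq, xc_pt, yc_pt]
    exact ⟨hX1.le, ht.1.le, ht.2.le⟩
  · obtain ⟨L, hL, hn⟩ := hneu (xc X) hX1
    have dd : ∀ {f : Euc (N + 1) → ℝ} {X}, ContDiffAt ℝ 2 f X → DifferentiableAt ℝ f X :=
      fun h => h.differentiableAt (by norm_num)
    refine ⟨_, ?_, ((((NeumannLim.const α c₀ (xc X)).add
      ((neumannLim_ycRpow (xc X)).const_mul (fun Y hY => dd (contDiffAt_ycRpow hY _)) _)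
        (fun Y _ => differentiableAt_const _)
        (fun Y hY => dd (contDiffAt_const.mul (contDiffAt_ycRpow hY _)))).add
      ((neumannLim_normSq hα1 (yc_pt x₀ 0) (xc X)).const_mul
        (fun Y _ => dd (pureJet_normSq _ Y).contDiffAt) K)
        (fun Y hY => dd (c1 Y hY)) (fun Y _ => dd (c2 Y))).add
      ((neumannLim_ycSq hα1 (xc X)).const_mul
        (fun Y _ => dd ((pureJet_yc Y).mul (pureJet_yc Y)).contDiffAt) _)
        (fun Y hY => dd ((c1 Y hY).add (c2 Y))) (fun Y _ => dd (c3 Y))).add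
      (hn.const_mul (fun Y hY => dd (hv.smooth Y hY)) (-1))
        (fun Y hY => dd (((c1 Y hY).add (c2 Y)).add (c3 Y))) (fun Y hY => dd (c4 Y hY))⟩
    have : -(G / (2 * α)) * (2 * α) = -G := by field_simp
    linarith

/-- The radial averaging kernel `(1 - |Z|²)₊`. -/
def avgKer {N : ℕ} (Z : Euc (N + 1)) : ℝ := max (1 - ‖Z‖ ^ 2) 0

/-- The radial function with gradient `-Z (1 - |Z|²)₊`. -/
def avgPot {N : ℕ} (Z : Euc (N + 1)) : ℝ :=
  -(1 / 2) * ∫ s in (1 : ℝ)..‖Z‖ ^ 2, max (1 - s) 0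

lemma avgKer_nonneg {N : ℕ} (Z : Euc (N + 1)) : 0 ≤ avgKer Z := le_max_right _ _

lemma avgKer_le_one {N : ℕ} (Z : Euc (N + 1)) : avgKer Z ≤ 1 :=
  max_le (by nlinarith [sq_nonneg ‖Z‖]) zero_le_one

lemma continuous_avgKer {N : ℕ} : Continuous (avgKer : Euc (N + 1) → ℝ) := by
  unfold avgKer; fun_prop

lemma avgKer_eq_zero {N : ℕ} {Z : Euc (N + 1)} (hZ : Z ∉ closedBall (0 : Euc (N + 1)) 1) :
    avgKer Z = 0 := by
  rw [mem_closedBall_zero_iff, not_le] at hZ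
  exact max_eq_right (by nlinarith)

lemma avgPot_eq_zero {N : ℕ} {Z : Euc (N + 1)} (hZ : Z ∉ closedBall (0 : Euc (N + 1)) 1) :
    avgPot Z = 0 := by
  rw [mem_closedBall_zero_iff, not_le] at hZ
  unfold avgPot
  rw [intervalIntegral.integral_congr (g := fun _ => (0 : ℝ))]
  · simp
  · intro s hs
    rw [uIcc_of_le (by nlinarith)] at hs
    exact max_eq_right (by linarith [hs.1])

lemma hasFDerivAt_avgPot {N : ℕ} (Z : Euc (N + 1)) :
    HasFDerivAt avgPot (-(avgKer Z) • innerSL ℝ Z) Z := by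
  have hcont : Continuous (fun s : ℝ => max (1 - s) 0) := by fun_prop
  have h1 := (hcont.integral_hasStrictDerivAt 1 (‖Z‖ ^ 2)).hasDerivAt
  have h2 : HasFDerivAt (fun Z : Euc (N + 1) => ‖Z‖ ^ 2) (2 • innerSL ℝ Z) Z :=
    (hasStrictFDerivAt_norm_sq Z).hasFDerivAt
  have h3 := (h1.comp_hasFDerivAt Z h2).const_mul (-(1 / 2))
  have h4 : (-(1 / 2) : ℝ) • (max (1 - ‖Z‖ ^ 2) 0) • (2 • innerSL ℝ Z)
      = -(avgKer Z) • innerSL ℝ Z := by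
    ext w
    simp [avgKer]
    ring
  rw [h4] at h3
  exact h3

lemma integrable_of_continuousOn_unitBall {N : ℕ} {f : Euc (N + 1) → ℝ}
    (hf : ContinuousOn f (closedBall 0 1)) (h0 : ∀ Z ∉ closedBall (0 : Euc (N + 1)) 1, f Z = 0) :
    Integrable f :=
  (integrableOn_iff_integrable_of_support_subset (s := closedBall 0 1) fun Z hZ => by
    by_contra h; exact hZ (h0 Z h)).1 (hf.integrableOn_compact (isCompact_closedBall _ _))

lemma integral_avgKer_pos {N : ℕ} : 0 < ∫ Z in closedBall (0 : Euc (N + 1)) 1, avgKer Z := by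
  rw [setIntegral_eq_integral_of_forall_compl_eq_zero fun Z hZ => avgKer_eq_zero hZ]
  refine continuous_avgKer.integral_pos_of_hasCompactSupport_nonneg_nonzero ?_ avgKer_nonneg
    (x := 0) (by simp [avgKer])
  refine HasCompactSupport.intro (isCompact_closedBall 0 1) fun Z hZ => avgKer_eq_zero hZ

/-- The divergence identity for the averaging kernel. -/
lemma setIntegral_avgKer_inner {N : ℕ} {F : Euc (N + 1) → Euc (N + 1)}
    (hF : ∀ Z ∈ closedBall (0 : Euc (N + 1)) 1, ContDiffAt ℝ 1 F Z)
    (hdiv : ∀ Z ∈ closedBall (0 : Euc (N + 1)) 1, dvg F Z = 0) :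
    ∫ Z in closedBall (0 : Euc (N + 1)) 1, avgKer Z * ∑ i, Z i * F Z i = 0 := by
  rw [setIntegral_eq_integral_of_forall_compl_eq_zero fun Z hZ => by
    rw [avgKer_eq_zero hZ, zero_mul]]
  have hFi : ∀ i, ∀ Z ∈ closedBall (0 : Euc (N + 1)) 1, ContDiffAt ℝ 1 (fun Z => F Z i) Z :=
    fun i Z hZ => (contDiffAt_euclidean.1 (hF Z hZ)) i
  have hcF : ∀ i, ContinuousOn (fun Z => F Z i) (closedBall 0 1) := fun i Z hZ =>
    (hFi i Z hZ).continuousAt.continuousWithinAt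
  have hcF' : ∀ i, ContinuousOn (fun Z => fderiv ℝ (fun Z => F Z i) Z (EuclideanSpace.single i 1))
      (closedBall 0 1) := fun i Z hZ =>
    (((hFi i Z hZ).fderiv_right (m := 0) (by norm_num)).continuousAt.clm_apply
      continuousAt_const).continuousWithinAt
  have hpot : Continuous (avgPot : Euc (N + 1) → ℝ) :=
    continuous_iff_continuousAt.2 fun Z => (hasFDerivAt_avgPot Z).continuousAt
  have hpd : ∀ i, ∀ Z : Euc (N + 1), fderiv ℝ avgPot Z (EuclideanSpace.single i 1)
      = -(avgKer Z * Z i) := fun i Z => by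
    rw [(hasFDerivAt_avgPot Z).fderiv]
    simp [EuclideanSpace.inner_single_right]
  have hco : ∀ i, Continuous (fun Z : Euc (N + 1) => Z i) := fun i => (coordL i).continuous
  have i1 : ∀ i, Integrable (fun Z : Euc (N + 1) => avgKer Z * Z i * F Z i) := fun i =>
    integrable_of_continuousOn_unitBall
      ((continuous_avgKer.mul (hco i)).continuousOn.mul (hcF i))
      fun Z hZ => by rw [avgKer_eq_zero hZ]; ring
  have i2 : ∀ i, Integrable (fun Z : Euc (N + 1) => avgPot Z *
      fderiv ℝ (fun Z => F Z i) Z (EuclideanSpace.single i 1)) := fun i =>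
    integrable_of_continuousOn_unitBall (hpot.continuousOn.mul (hcF' i))
      fun Z hZ => by rw [avgPot_eq_zero hZ]; ring
  have i3 : ∀ i, Integrable (fun Z : Euc (N + 1) => avgPot Z * F Z i) := fun i =>
    integrable_of_continuousOn_unitBall (hpot.continuousOn.mul (hcF i))
      fun Z hZ => by rw [avgPot_eq_zero hZ]; ring
  have hts : tsupport (avgPot : Euc (N + 1) → ℝ) ⊆ closedBall 0 1 :=
    closure_minimal (fun Z hZ => by by_contra h; exact hZ (avgPot_eq_zero h)) isClosed_closedBall
  have key : ∀ i, ∫ Z : Euc (N + 1), avgKer Z * Z i * F Z i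
      = ∫ Z : Euc (N + 1), avgPot Z * fderiv ℝ (fun Z => F Z i) Z (EuclideanSpace.single i 1) :=
    fun i => by
    rw [integral_mul_fderiv_eq_neg_fderiv_mul_of_integrable (f := avgPot) (g := fun Z => F Z i)
      ?_ (i2 i) (i3 i) (fun Z _ => (hasFDerivAt_avgPot Z).differentiableAt)
      (fun Z hZ => (hFi i Z (hts hZ)).differentiableAt (by norm_num)), ← integral_neg]
    · congr 1; funext Z; rw [hpd]; ring
    · simp only [hpd]
      exact (i1 i).neg.congr (.of_forall fun Z => by simp only [Pi.neg_apply]; ring)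
  have e1 : (fun Z : Euc (N + 1) => avgKer Z * ∑ i, Z i * F Z i)
      = fun Z => ∑ i, avgKer Z * Z i * F Z i := by
    funext Z; rw [Finset.mul_sum]; exact Finset.sum_congr rfl fun i _ => by ring
  rw [e1, integral_finsetSum _ fun i _ => i1 i, Finset.sum_congr rfl fun i _ => key i,
    ← integral_finsetSum _ fun i _ => i2 i]
  refine integral_eq_zero_of_ae (.of_forall fun Z => ?_)
  simp only [Pi.zero_apply]
  by_cases hZ : Z ∈ closedBall (0 : Euc (N + 1)) 1
  · have hd := hdiv Z hZ
    have hFd := (hF Z hZ).differentiableAt (by norm_num)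
    rw [← Finset.mul_sum]
    have : ∀ i, fderiv ℝ (fun Z => F Z i) Z (EuclideanSpace.single i 1)
        = fderiv ℝ F Z (EuclideanSpace.single i 1) i := fun i => by
      have := ((coordL i).hasFDerivAt.comp Z hFd.hasFDerivAt).fderiv
      have h2 : fderiv ℝ (fun Z => F Z i) Z = (coordL i).comp (fderiv ℝ F Z) := this
      rw [h2]; rfl
    simp only [this]
    unfold dvg at hd
    rw [hd, mul_zero]
  · simp [avgPot_eq_zero hZ]

/-- Differentiation under the integral along an affine family of balls. -/
lemma hasDerivAt_setIntegral_avgKer {N : ℕ} {g : Euc (N + 1) → ℝ} {U : Set (Euc (N + 1))}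
    (hU : IsOpen U) (hg : ∀ X ∈ U, ContDiffAt ℝ 1 g X) (P Q : Euc (N + 1)) (a b t₀ : ℝ)
    (hmem : ∀ Z ∈ closedBall (0 : Euc (N + 1)) 1, P + t₀ • Q + (a + t₀ * b) • Z ∈ U) :
    HasDerivAt (fun t : ℝ => ∫ Z in closedBall (0 : Euc (N + 1)) 1,
        avgKer Z * g (P + t • Q + (a + t * b) • Z))
      (∫ Z in closedBall (0 : Euc (N + 1)) 1,
        avgKer Z * fderiv ℝ g (P + t₀ • Q + (a + t₀ * b) • Z) (Q + b • Z)) t₀ := by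
  set γ : ℝ × Euc (N + 1) → Euc (N + 1) := fun p => P + p.1 • Q + (a + p.1 * b) • p.2 with hγ
  have hγc : Continuous γ := by fun_prop
  have hcpt := isCompact_closedBall (0 : Euc (N + 1)) 1
  have hev : ∀ᶠ t in 𝓝 t₀, ∀ Z ∈ closedBall (0 : Euc (N + 1)) 1, γ (t, Z) ∈ U :=
    hcpt.eventually_forall_of_forall_eventually fun Z hZ =>
      hγc.continuousAt.eventually (hU.mem_nhds (hmem Z hZ))
  obtain ⟨ε, hε, hball⟩ := Metric.nhds_basis_closedBall.mem_iff.1 hev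
  have hcg : ∀ t ∈ closedBall t₀ ε, ContinuousOn (fun Z => avgKer Z * g (γ (t, Z)))
      (closedBall 0 1) := fun t ht => continuous_avgKer.continuousOn.mul fun Z hZ =>
    (ContinuousAt.comp (f := fun Z => γ (t, Z)) (hg _ (hball ht Z hZ)).continuousAt
      (hγc.comp (by fun_prop : Continuous fun Z => (t, Z))).continuousAt).continuousWithinAt
  have hcd : ContinuousOn (fun p : ℝ × Euc (N + 1) =>
      avgKer p.2 * fderiv ℝ g (γ p) (Q + b • p.2)) (closedBall t₀ ε ×ˢ closedBall 0 1) :=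
    fun p hp => by
    have h1 : ContinuousAt (fun X => fderiv ℝ g X) (γ p) :=
      ((hg _ (hball hp.1 _ hp.2)).fderiv_right (m := 0) (by norm_num)).continuousAt
    have h2 : ContinuousAt (fun p => fderiv ℝ g (γ p)) p := h1.comp (f := γ) hγc.continuousAt
    have h3 : ContinuousAt (fun p : ℝ × Euc (N + 1) => Q + b • p.2) p := by fun_prop
    exact ((continuous_avgKer.comp continuous_snd).continuousAt.mul
      (h2.clm_apply h3)).continuousWithinAt
  obtain ⟨C, hC⟩ := ((isCompact_closedBall t₀ ε).prod hcpt).exists_bound_of_continuousOn hcd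
  refine (hasDerivAt_integral_of_dominated_loc_of_deriv_le (bound := fun _ => C)
    (F := fun t Z => avgKer Z * g (γ (t, Z)))
    (F' := fun t Z => avgKer Z * fderiv ℝ g (γ (t, Z)) (Q + b • Z))
    (closedBall_mem_nhds t₀ hε) ?_ ?_ ?_ ?_ ?_ ?_).2
  · filter_upwards [closedBall_mem_nhds t₀ hε] with t ht
    exact ((hcg t ht).integrableOn_compact hcpt).aestronglyMeasurable
  · exact (hcg t₀ (mem_closedBall_self hε.le)).integrableOn_compact hcpt
  · have h : ContinuousOn (fun Z => avgKer Z * fderiv ℝ g (γ (t₀, Z)) (Q + b • Z))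
        (closedBall 0 1) :=
      ContinuousOn.comp (f := fun Z : Euc (N + 1) => (t₀, Z)) hcd
        (by fun_prop : Continuous fun Z : Euc (N + 1) => (t₀, Z)).continuousOn
        fun Z hZ => ⟨mem_closedBall_self hε.le, hZ⟩
    exact (h.integrableOn_compact hcpt).aestronglyMeasurable
  · refine (ae_restrict_mem measurableSet_closedBall).mono fun Z hZ t ht => ?_
    exact hC (t, Z) ⟨ht, hZ⟩
  · exact (continuousOn_const (c := C)).integrableOn_compact hcpt
  · refine (ae_restrict_mem measurableSet_closedBall).mono fun Z hZ t ht => ?_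
    have h1 : HasDerivAt (fun t => γ (t, Z)) (Q + b • Z) t := by
      have e1 : HasDerivAt (fun t : ℝ => P + t • Q) Q t := by
        simpa using ((hasDerivAt_id t).smul_const Q).const_add P
      have e2 : HasDerivAt (fun t : ℝ => (a + t * b) • Z) (b • Z) t := by
        simpa using (((hasDerivAt_id t).mul_const b).const_add a).smul_const Z
      exact e1.add e2
    exact (((hg _ (hball ht Z hZ)).differentiableAt (by norm_num)).hasFDerivAt.comp_hasDerivAt t
      h1).const_mul (avgKer Z)

lemma rpow_sub_one_le {α y t : ℝ} (hα : α ∈ Set.Ioo (0 : ℝ) 1) (hy : 0 < y) (ht : y / 2 ≤ t) :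
    t ^ (1 - 2 * α - 1) ≤ 4 * y ^ (1 - 2 * α - 1) := by
  have h1 : t ^ (1 - 2 * α - 1) ≤ (y / 2) ^ (1 - 2 * α - 1) :=
    Real.rpow_le_rpow_of_nonpos (by positivity) ht (by linarith [hα.1])
  have h2 : (y / 2) ^ (1 - 2 * α - 1) = (1 / 2) ^ (1 - 2 * α - 1) * y ^ (1 - 2 * α - 1) := by
    rw [← Real.mul_rpow (by norm_num) hy.le]; congr 1; ring
  have h3 : (1 / 2 : ℝ) ^ (1 - 2 * α - 1) ≤ (1 / 2) ^ (-2 : ℝ) :=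
    Real.rpow_le_rpow_of_exponent_ge (by norm_num) (by norm_num) (by linarith [hα.2])
  have h4 : (1 / 2 : ℝ) ^ (-2 : ℝ) = 4 := by
    rw [Real.rpow_neg (by norm_num)]; norm_num
  rw [h4] at h3
  rw [h2] at h1
  exact h1.trans (mul_le_mul_of_nonneg_right h3 (Real.rpow_nonneg hy.le _))

lemma abs_one_sub_two_mul_le {α : ℝ} (hα : α ∈ Set.Ioo (0 : ℝ) 1) : |1 - 2 * α| ≤ 1 :=
  abs_le.2 ⟨by linarith [hα.2], by linarith [hα.1]⟩

lemma abs_rpow_sub_rpow_le {α y t : ℝ} (hα : α ∈ Set.Ioo (0 : ℝ) 1) (hy : 0 < y)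
    (ht : y / 2 ≤ t) :
    |t ^ (1 - 2 * α) - y ^ (1 - 2 * α)| ≤ 4 * y ^ (1 - 2 * α - 1) * |t - y| := by
  refine (convex_Ici (y / 2)).norm_image_sub_le_of_norm_hasDerivWithin_le
    (f := fun t : ℝ => t ^ (1 - 2 * α)) (f' := fun t => (1 - 2 * α) * t ^ (1 - 2 * α - 1))
    (fun s hs => ?_) (fun s hs => ?_) (by simp; linarith) ht
  · exact (hasDerivAt_rpow_of_pos (by linarith [mem_Ici.1 hs]) _).hasDerivWithinAt
  · have hs0 : 0 ≤ s := by linarith [mem_Ici.1 hs]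
    rw [norm_mul, Real.norm_eq_abs, Real.norm_eq_abs, abs_of_nonneg (Real.rpow_nonneg hs0 _)]
    calc _ ≤ 1 * s ^ (1 - 2 * α - 1) :=
          mul_le_mul_of_nonneg_right (abs_one_sub_two_mul_le hα) (Real.rpow_nonneg hs0 _)
      _ ≤ _ := by rw [one_mul]; exact rpow_sub_one_le hα hy hs

lemma half_le_yc_of_mem {N : ℕ} {X W : Euc (N + 1)} {ρ : ℝ} (hρ : ρ ≤ yc X / 2)
    (hW : W ∈ closedBall X ρ) : yc X / 2 ≤ yc W := by
  rw [mem_closedBall, dist_eq_norm] at hW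
  have := abs_le.1 ((abs_yc_le (W - X)).trans hW)
  rw [yc_sub] at this
  linarith [this.1]

lemma dvg_comp_affine {N : ℕ} {F : Euc (N + 1) → Euc (N + 1)} {X Z : Euc (N + 1)} {t : ℝ}
    (hF : DifferentiableAt ℝ F (X + t • Z)) :
    dvg (fun Z => F (X + t • Z)) Z = t * dvg F (X + t • Z) := by
  have h1 : HasFDerivAt (fun Z : Euc (N + 1) => X + t • Z)
      (t • ContinuousLinearMap.id ℝ (Euc (N + 1))) Z :=
    ((hasFDerivAt_id Z).const_smul t).const_add X
  have h2 := (hF.hasFDerivAt.comp Z h1).fderiv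
  have h3 : fderiv ℝ (fun Z => F (X + t • Z)) Z
    = (fderiv ℝ F (X + t • Z)).comp (t • ContinuousLinearMap.id ℝ (Euc (N + 1))) := h2
  unfold dvg
  rw [h3, Finset.mul_sum]
  refine Finset.sum_congr rfl fun i _ => ?_
  simp

lemma fderiv_eq_sum {N : ℕ} (v : Euc (N + 1) → ℝ) (W Z : Euc (N + 1)) :
    fderiv ℝ v W Z = ∑ i, Z i * fderiv ℝ v W (EuclideanSpace.single i 1) := by
  conv_lhs => rw [show Z = ∑ i, Z i • EuclideanSpace.single i (1 : ℝ) by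
    ext j; simp [Finset.sum_apply, Pi.single_apply]]
  simp

/-- Approximate mean value property in terms of the local oscillation. -/
lemma HarmExt.abs_avg_sub_le {N : ℕ} {α : ℝ} (hα : α ∈ Set.Ioo (0 : ℝ) 1)
    {v : Euc (N + 1) → ℝ} (hv : HarmExt α v) {X : Euc (N + 1)} (hX : 0 < yc X) {ρ c M : ℝ}
    (hρ0 : 0 < ρ) (hρ : ρ ≤ yc X / 2) (hM : ∀ W ∈ closedBall X ρ, |v W - c| ≤ M) :
    |(∫ Z in closedBall (0 : Euc (N + 1)) 1, avgKer Z * v (X + ρ • Z))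
        - (∫ Z in closedBall (0 : Euc (N + 1)) 1, avgKer Z) * v X|
      ≤ 8 * (∫ Z in closedBall (0 : Euc (N + 1)) 1, avgKer Z) * M * (ρ / yc X) := by
  set B := closedBall (0 : Euc (N + 1)) 1 with hB
  have hBc : IsCompact B := isCompact_closedBall _ _
  set D := ∫ Z in B, avgKer Z with hD
  have hD0 : 0 < D := integral_avgKer_pos
  set y := yc X with hy
  have hM0 : 0 ≤ M := (abs_nonneg _).trans (hM X (mem_closedBall_self hρ0.le))
  set a := 1 - 2 * α with ha
  have hmem : ∀ t, 0 ≤ t → t ≤ ρ → ∀ Z ∈ B, X + t • Z ∈ closedBall X ρ := fun t h0 h1 Z hZ => by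
    rw [mem_closedBall, dist_eq_norm, add_sub_cancel_left, norm_smul, Real.norm_eq_abs,
      abs_of_nonneg h0]
    have : ‖Z‖ ≤ 1 := by simpa [hB] using hZ
    nlinarith [norm_nonneg Z]
  have hyc : ∀ t, 0 ≤ t → t ≤ ρ → ∀ Z ∈ B, y / 2 ≤ yc (X + t • Z) := fun t h0 h1 Z hZ =>
    half_le_yc_of_mem hρ (hmem t h0 h1 Z hZ)
  have hpos : ∀ t, 0 ≤ t → t ≤ ρ → ∀ Z ∈ B, 0 < yc (X + t • Z) := fun t h0 h1 Z hZ => by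
    linarith [hyc t h0 h1 Z hZ]
  set g : Euc (N + 1) → ℝ := fun W => yc W ^ a * (v W - c) with hg
  have hgc : ∀ W ∈ upperHalf N, ContDiffAt ℝ 1 g W := fun W hW =>
    ((contDiffAt_ycRpow hW a).of_le (by norm_num)).mul
      (((hv.smooth W hW).of_le (by norm_num)).sub contDiffAt_const)
  have hgd : ∀ W, 0 < yc W → ∀ Z, fderiv ℝ g W Z
      = yc W ^ a * fderiv ℝ v W Z + (v W - c) * (a * yc W ^ (a - 1) * yc Z) := fun W hW Z => by
    have h1 := (hasDerivAt_rpow_of_pos hW a).comp_hasFDerivAt W (hasFDerivAt_yc W)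
    have h2 := (hv.differentiableAt W hW).hasFDerivAt.sub_const c
    have h3 := (h1.mul h2).fderiv
    have h4 : fderiv ℝ g W = _ := h3
    rw [h4]
    simp [coordL_apply, yc]
  have hline : ∀ t : ℝ, Continuous (fun Z : Euc (N + 1) => X + t • Z) := fun t => by fun_prop
  have hderiv : ∀ t, 0 ≤ t → t ≤ ρ → HasDerivAt
      (fun t : ℝ => ∫ Z in B, avgKer Z * g (X + t • Z))
      (∫ Z in B, avgKer Z * fderiv ℝ g (X + t • Z) Z) t := fun t h0 h1 => by
    have := hasDerivAt_setIntegral_avgKer isOpen_upperHalf hgc X 0 0 1 t (fun Z hZ => by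
      simpa [upperHalf] using hpos t h0 h1 Z hZ)
    simpa using this
  have hbound : ∀ t, 0 ≤ t → t ≤ ρ →
      ‖∫ Z in B, avgKer Z * fderiv ℝ g (X + t • Z) Z‖ ≤ D * (4 * M * y ^ (a - 1)) := by
    intro t h0 h1
    have hwc : ∀ Z ∈ B, ContDiffAt ℝ 1 (fun Z => wgrad α v (X + t • Z)) Z := fun Z hZ =>
      ContDiffAt.comp (g := wgrad α v) (f := fun Z => X + t • Z) Z
        (contDiffAt_wgrad (hv.smooth _ (hpos t h0 h1 Z hZ)) (hpos t h0 h1 Z hZ))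
        (contDiffAt_const.add (contDiffAt_id.const_smul t))
    have hz := setIntegral_avgKer_inner hwc fun Z hZ => by
      have hp := hpos t h0 h1 Z hZ
      rw [dvg_comp_affine ((contDiffAt_wgrad (hv.smooth _ hp) hp).differentiableAt (by norm_num)),
        dvg_wgrad (hv.smooth _ hp) hp, hv.eq_zero _ hp]
      ring
    have hsplit : ∀ Z ∈ B, avgKer Z * fderiv ℝ g (X + t • Z) Z
        = avgKer Z * ∑ i, Z i * wgrad α v (X + t • Z) i
          + avgKer Z * ((v (X + t • Z) - c) * (a * yc (X + t • Z) ^ (a - 1) * yc Z)) :=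
      fun Z hZ => by
        rw [hgd _ (hpos t h0 h1 Z hZ), fderiv_eq_sum, Finset.mul_sum, mul_add]
        simp only [wgrad_apply]
        congr 2
        exact Finset.sum_congr rfl fun i _ => by ring
    have c1 : ContinuousOn (fun Z => avgKer Z * ∑ i, Z i * wgrad α v (X + t • Z) i) B := by
      refine continuous_avgKer.continuousOn.mul (continuousOn_finsetSum _ fun i _ => ?_)
      exact (coordL i).continuous.continuousOn.mul fun Z hZ =>
        ((contDiffAt_euclidean.1 (hwc Z hZ)) i).continuousAt.continuousWithinAt
    have c2 : ContinuousOn (fun Z => avgKer Z *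
        ((v (X + t • Z) - c) * (a * yc (X + t • Z) ^ (a - 1) * yc Z))) B := by
      refine continuous_avgKer.continuousOn.mul (ContinuousOn.mul (fun Z hZ => ?_)
        (ContinuousOn.mul (continuousOn_const.mul fun Z hZ => ?_) continuous_yc.continuousOn))
      · exact ((ContinuousAt.comp (f := fun Z => X + t • Z)
          (hv.differentiableAt _ (hpos t h0 h1 Z hZ)).continuousAt
          (hline t).continuousAt).sub continuousAt_const).continuousWithinAt
      · exact ((continuous_yc.comp (hline t)).continuousAt.rpow_const
          (Or.inl (hpos t h0 h1 Z hZ).ne')).continuousWithinAt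
    rw [setIntegral_congr_fun measurableSet_closedBall hsplit,
      integral_add (c1.integrableOn_compact hBc) (c2.integrableOn_compact hBc), hz, zero_add, hD,
      ← integral_mul_const]
    refine norm_integral_le_of_norm_le
      ((continuous_avgKer.mul continuous_const).continuousOn.integrableOn_compact hBc) ?_
    refine (ae_restrict_mem measurableSet_closedBall).mono fun Z hZ => ?_
    rw [norm_mul, Real.norm_of_nonneg (avgKer_nonneg Z)]
    refine mul_le_mul_of_nonneg_left ?_ (avgKer_nonneg Z)
    have e1 : |v (X + t • Z) - c| ≤ M := hM _ (hmem t h0 h1 Z hZ)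
    have e2 : |yc Z| ≤ 1 := (abs_yc_le Z).trans (by simpa [hB] using hZ)
    have e3 := rpow_sub_one_le hα hX (hyc t h0 h1 Z hZ)
    have e4 : 0 ≤ yc (X + t • Z) ^ (a - 1) := Real.rpow_nonneg (hpos t h0 h1 Z hZ).le _
    simp only [Real.norm_eq_abs, abs_mul, abs_of_nonneg e4]
    calc |v (X + t • Z) - c| * (|a| * yc (X + t • Z) ^ (a - 1) * |yc Z|)
        ≤ M * (1 * (4 * y ^ (a - 1)) * 1) := by
          have := abs_one_sub_two_mul_le hα
          gcongr
      _ = _ := by ring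
  have hmvt := norm_image_sub_le_of_norm_deriv_le_segment' (a := 0) (b := ρ)
    (f := fun t : ℝ => ∫ Z in B, avgKer Z * g (X + t • Z))
    (f' := fun t => ∫ Z in B, avgKer Z * fderiv ℝ g (X + t • Z) Z)
    (C := D * (4 * M * y ^ (a - 1)))
    (fun t ht => (hderiv t ht.1 ht.2).hasDerivWithinAt)
    (fun t ht => hbound t ht.1 ht.2.le) ρ (right_mem_Icc.2 hρ0.le)
  have hf0 : ∫ Z in B, avgKer Z * g (X + (0 : ℝ) • Z) = D * (y ^ a * (v X - c)) := by
    simp only [zero_smul, add_zero, hD]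
    rw [integral_mul_const]
  rw [hf0, sub_zero, Real.norm_eq_abs] at hmvt
  have cv : ContinuousOn (fun Z => v (X + ρ • Z)) B := fun Z hZ =>
    (ContinuousAt.comp (f := fun Z => X + ρ • Z)
      (hv.differentiableAt _ (hpos ρ hρ0.le le_rfl Z hZ)).continuousAt
      (hline ρ).continuousAt).continuousWithinAt
  have cy : ContinuousOn (fun Z => yc (X + ρ • Z) ^ a) B := fun Z hZ =>
    ((continuous_yc.comp (hline ρ)).continuousAt.rpow_const
      (Or.inl (hpos ρ hρ0.le le_rfl Z hZ).ne')).continuousWithinAt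
  have I1 : IntegrableOn (fun Z => avgKer Z * v (X + ρ • Z)) B :=
    (continuous_avgKer.continuousOn.mul cv).integrableOn_compact hBc
  have I2 : IntegrableOn (fun Z => avgKer Z * g (X + ρ • Z)) B :=
    (continuous_avgKer.continuousOn.mul
      (cy.mul (cv.sub continuousOn_const))).integrableOn_compact hBc
  have I3 : IntegrableOn (fun Z : Euc (N + 1) => avgKer Z * c) B :=
    (continuous_avgKer.mul continuous_const).continuousOn.integrableOn_compact hBc
  have I4 : IntegrableOn (fun Z => y ^ a * (avgKer Z * v (X + ρ • Z) - avgKer Z * c)) B :=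
    (I1.sub I3).const_mul _
  have hdiff : |(∫ Z in B, avgKer Z * g (X + ρ • Z))
      - y ^ a * ((∫ Z in B, avgKer Z * v (X + ρ • Z)) - D * c)|
        ≤ D * (4 * M * y ^ (a - 1) * ρ) := by
    rw [hD, ← integral_mul_const, ← integral_sub I1 I3, ← integral_const_mul, ← integral_sub I2 I4,
      ← integral_mul_const, ← Real.norm_eq_abs]
    refine norm_integral_le_of_norm_le
      ((continuous_avgKer.mul continuous_const).continuousOn.integrableOn_compact hBc) ?_
    refine (ae_restrict_mem measurableSet_closedBall).mono fun Z hZ => ?_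
    have e0 : avgKer Z * g (X + ρ • Z) - y ^ a * (avgKer Z * v (X + ρ • Z) - avgKer Z * c)
      = avgKer Z * ((yc (X + ρ • Z) ^ a - y ^ a) * (v (X + ρ • Z) - c)) := by
        simp only [hg]; ring
    rw [e0, norm_mul, Real.norm_of_nonneg (avgKer_nonneg Z), Real.norm_eq_abs, abs_mul]
    refine mul_le_mul_of_nonneg_left ?_ (avgKer_nonneg Z)
    have hm := hmem ρ hρ0.le le_rfl Z hZ
    have e1 : |v (X + ρ • Z) - c| ≤ M := hM _ hm
    have e2 := abs_rpow_sub_rpow_le hα hX (hyc ρ hρ0.le le_rfl Z hZ)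
    have e3 : |yc (X + ρ • Z) - y| ≤ ρ := by
      rw [hy, ← yc_sub]
      refine (abs_yc_le _).trans ?_
      rwa [mem_closedBall, dist_eq_norm] at hm
    calc _ ≤ (4 * y ^ (a - 1) * ρ) * M := by
          refine mul_le_mul (e2.trans ?_) e1 (abs_nonneg _) (by positivity)
          gcongr
      _ = _ := by ring
  have hya : 0 < y ^ a := Real.rpow_pos_of_pos hX a
  have hya1 : y ^ (a - 1) = y ^ a / y := Real.rpow_sub_one hX.ne' a
  set I := ∫ Z in B, avgKer Z * v (X + ρ • Z)
  have htot : y ^ a * |I - D * v X| ≤ y ^ a * (8 * D * M * (ρ / y)) := by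
    rw [← abs_of_pos hya, ← abs_mul, abs_of_pos hya]
    have : y ^ a * (I - D * v X) = ((∫ Z in B, avgKer Z * g (X + ρ • Z))
        - D * (y ^ a * (v X - c))) - ((∫ Z in B, avgKer Z * g (X + ρ • Z))
      - y ^ a * (I - D * c)) := by ring
    rw [this]
    refine (abs_sub _ _).trans ((add_le_add hmvt hdiff).trans (le_of_eq ?_))
    rw [hya1]; ring
  exact le_of_mul_le_mul_left htot hya

lemma half_le_rpow {t a : ℝ} (h1 : 1 / 2 ≤ t) (h2 : t ≤ 2) (ha : |a| ≤ 1) : 1 / 2 ≤ t ^ a := by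
  have ha' := abs_le.1 ha
  have ht0 : 0 < t := by linarith
  rcases le_total t 1 with h | h
  · calc 1 / 2 ≤ t := h1
      _ = t ^ (1 : ℝ) := (Real.rpow_one t).symm
      _ ≤ t ^ a := Real.rpow_le_rpow_of_exponent_ge ht0 h ha'.2
  · calc 1 / 2 ≤ t⁻¹ := by rw [one_div]; exact inv_anti₀ ht0 h2
      _ = t ^ (-1 : ℝ) := (Real.rpow_neg_one t).symm
      _ ≤ t ^ a := Real.rpow_le_rpow_of_exponent_le h ha'.1

lemma norm_gradient {N : ℕ} (v : Euc (N + 1) → ℝ) (X : Euc (N + 1)) :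
    ‖gradient v X‖ = ‖fderiv ℝ v X‖ := by
  simp [gradient]

lemma yc_pos_of_mem_closedBall {N : ℕ} {P W : Euc (N + 1)} (hP : 0 < yc P)
    (hW : W ∈ closedBall P (yc P / 2)) : 0 < yc W := by
  linarith [half_le_yc_of_mem le_rfl hW]

lemma HarmExt.continuousAt_fderiv {N : ℕ} {α : ℝ} {v : Euc (N + 1) → ℝ} (hv : HarmExt α v)
    {X : Euc (N + 1)} (hX : 0 < yc X) : ContinuousAt (fderiv ℝ v) X :=
  ((hv.smooth X hX).fderiv_right (m := 1) (by norm_num)).continuousAt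

lemma HarmExt.continuousOn_eDen {N : ℕ} {α : ℝ} {v : Euc (N + 1) → ℝ} (hv : HarmExt α v) :
    ContinuousOn (eDen α v) (upperHalf N) := fun X hX => by
  have hX : 0 < yc X := hX
  have : eDen α v = fun X => yc X ^ (1 - 2 * α) * ‖fderiv ℝ v X‖ ^ 2 := by
    ext X; rw [eDen, norm_gradient]
  rw [this]
  exact ((continuous_yc.continuousAt.rpow_const (Or.inl hX.ne')).mul
    ((hv.continuousAt_fderiv hX).norm.pow 2)).continuousWithinAt

lemma eDen_nonneg {N : ℕ} (α : ℝ) (v : Euc (N + 1) → ℝ) {X : Euc (N + 1)} (hX : 0 ≤ yc X) :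
    0 ≤ eDen α v X := mul_nonneg (Real.rpow_nonneg hX _) (sq_nonneg _)

lemma norm_fderiv_sq_le_eDen {N : ℕ} {α : ℝ} (hα : α ∈ Set.Ioo (0 : ℝ) 1) (v : Euc (N + 1) → ℝ)
    {P W : Euc (N + 1)} (hP : 0 < yc P) (hW : W ∈ closedBall P (yc P / 2)) :
    ‖fderiv ℝ v W‖ ^ 2 ≤ 2 * yc P ^ (-(1 - 2 * α)) * eDen α v W := by
  have h1 := half_le_yc_of_mem le_rfl hW
  have h2 : yc W ≤ 2 * yc P := by
    rw [mem_closedBall, dist_eq_norm] at hW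
    have := abs_le.1 ((abs_yc_le (W - P)).trans hW)
    rw [yc_sub] at this
    linarith [this.2]
  have h3 : 1 / 2 ≤ (yc W / yc P) ^ (1 - 2 * α) :=
    half_le_rpow (by rw [le_div_iff₀ hP]; linarith) (by rw [div_le_iff₀ hP]; linarith)
      (abs_one_sub_two_mul_le hα)
  rw [Real.div_rpow (by linarith) hP.le, div_eq_mul_inv (yc W ^ _), ← Real.rpow_neg hP.le] at h3
  rw [eDen, norm_gradient]
  nlinarith [mul_le_mul_of_nonneg_right h3 (sq_nonneg ‖fderiv ℝ v W‖)]

lemma setIntegral_unitBall_comp {N : ℕ} (f : Euc (N + 1) → ℝ) (X : Euc (N + 1)) {ρ : ℝ}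
    (hρ : 0 < ρ) :
    ∫ Z in closedBall (0 : Euc (N + 1)) 1, f (X + ρ • Z)
      = (ρ ^ (N + 1))⁻¹ * ∫ W in closedBall X ρ, f W := by
  have h1 := Measure.setIntegral_comp_smul_of_pos (μ := (volume : Measure (Euc (N + 1))))
    (fun W => f (X + W)) (closedBall (0 : Euc (N + 1)) 1) hρ
  have h2 := (measurePreserving_add_left (volume : Measure (Euc (N + 1))) X).setIntegral_preimage_emb
    (MeasurableEquiv.addLeft X).measurableEmbedding f (closedBall X ρ)
  have h3 : (fun W => X + W) ⁻¹' closedBall X ρ = closedBall (0 : Euc (N + 1)) ρ := by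
    ext W; simp
  rw [h3] at h2
  rw [h1, _root_.smul_closedBall _ _ zero_le_one, smul_zero, Real.norm_of_nonneg hρ.le, mul_one, h2]
  simp

/-- Comparison of averages over two balls by the Dirichlet energy. -/
lemma HarmExt.abs_avg_sub_avg_le {N : ℕ} {α : ℝ} (hα : α ∈ Set.Ioo (0 : ℝ) 1)
    {v : Euc (N + 1) → ℝ} (hv : HarmExt α v) {P X X' : Euc (N + 1)} (hP : 0 < yc P) {ρ E : ℝ}
    (hρ : 0 < ρ) (hX : ‖X - P‖ + ρ ≤ yc P / 2) (hX' : ‖X' - P‖ + ρ ≤ yc P / 2) (hE : 0 < E)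
    (hEle : ∫ W in closedBall P (yc P / 2), eDen α v W ≤ E) :
    |(∫ Z in closedBall (0 : Euc (N + 1)) 1, avgKer Z * v (X' + ρ • Z))
        - ∫ Z in closedBall (0 : Euc (N + 1)) 1, avgKer Z * v (X + ρ • Z)|
      ≤ ‖X' - X‖ * ((volume.real (closedBall (0 : Euc (N + 1)) 1) + 1)
          * √(2 * yc P ^ (-(1 - 2 * α)) * ((ρ ^ (N + 1))⁻¹ * E))) := by
  set B := closedBall (0 : Euc (N + 1)) 1 with hB
  have hBc : IsCompact B := isCompact_closedBall _ _
  set J := 2 * yc P ^ (-(1 - 2 * α)) * ((ρ ^ (N + 1))⁻¹ * E) with hJ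
  have hY : 0 < yc P ^ (-(1 - 2 * α)) := Real.rpow_pos_of_pos hP _
  have hJ0 : 0 < J := by positivity
  set κ := √J with hκ
  have hκ0 : 0 < κ := Real.sqrt_pos.2 hJ0
  have hκ2 : κ ^ 2 = J := Real.sq_sqrt hJ0.le
  have hline : ∀ t ∈ Icc (0 : ℝ) 1, closedBall (X + t • (X' - X)) ρ ⊆ closedBall P (yc P / 2) := by
    intro t ht
    refine closedBall_subset_closedBall' ?_
    rw [dist_eq_norm]
    have : X + t • (X' - X) - P = (1 - t) • (X - P) + t • (X' - P) := by module
    rw [this]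
    have h1 := norm_add_le ((1 - t) • (X - P)) (t • (X' - P))
    rw [norm_smul, norm_smul, Real.norm_of_nonneg (by linarith [ht.2]), Real.norm_of_nonneg ht.1]
      at h1
    nlinarith [ht.1, ht.2]
  have hmem : ∀ t ∈ Icc (0 : ℝ) 1, ∀ Z ∈ B, X + t • (X' - X) + ρ • Z ∈ closedBall P (yc P / 2) := by
    intro t ht Z hZ
    refine hline t ht ?_
    rw [mem_closedBall, dist_eq_norm, add_sub_cancel_left, norm_smul, Real.norm_of_nonneg hρ.le]
    have : ‖Z‖ ≤ 1 := by simpa [hB] using hZ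
    nlinarith
  have hderiv : ∀ t ∈ Icc (0 : ℝ) 1, HasDerivAt
      (fun t : ℝ => ∫ Z in B, avgKer Z * v (X + t • (X' - X) + ρ • Z))
      (∫ Z in B, avgKer Z * fderiv ℝ v (X + t • (X' - X) + ρ • Z) (X' - X)) t := fun t ht => by
    have := hasDerivAt_setIntegral_avgKer isOpen_upperHalf
      (fun W hW => (hv.smooth W hW).of_le (by norm_num)) X (X' - X) ρ 0 t (fun Z hZ => by
      simpa [upperHalf] using yc_pos_of_mem_closedBall hP (hmem t ht Z hZ))
    simpa using this
  have hbound : ∀ t ∈ Icc (0 : ℝ) 1,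
      ‖∫ Z in B, avgKer Z * fderiv ℝ v (X + t • (X' - X) + ρ • Z) (X' - X)‖
        ≤ ‖X' - X‖ * ((volume.real B + 1) * κ) := by
    intro t ht
    set Xt := X + t • (X' - X) with hXt
    have hcomp : ∀ Z ∈ B, ContinuousAt (fun Z => Xt + ρ • Z) Z := fun Z _ => by fun_prop
    have hc1 : ContinuousOn (fun Z => ‖fderiv ℝ v (Xt + ρ • Z)‖ ^ 2) B := fun Z hZ =>
      ((ContinuousAt.comp (g := fderiv ℝ v) (f := fun Z => Xt + ρ • Z)
        (hv.continuousAt_fderiv (yc_pos_of_mem_closedBall hP (hmem t ht Z hZ)))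
        (hcomp Z hZ)).norm.pow 2).continuousWithinAt
    have hc2 : ContinuousOn (fun Z => eDen α v (Xt + ρ • Z)) B := fun Z hZ =>
      (ContinuousAt.comp (g := eDen α v) (f := fun Z => Xt + ρ • Z)
        (hv.continuousOn_eDen.continuousAt
          (isOpen_upperHalf.mem_nhds (yc_pos_of_mem_closedBall hP (hmem t ht Z hZ))))
        (hcomp Z hZ)).continuousWithinAt
    have hsub : IntegrableOn (eDen α v) (closedBall P (yc P / 2)) :=
      (hv.continuousOn_eDen.mono fun W hW => yc_pos_of_mem_closedBall hP hW).integrableOn_compact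
        (isCompact_closedBall _ _)
    have hJle : ∫ Z in B, ‖fderiv ℝ v (Xt + ρ • Z)‖ ^ 2 ≤ J := by
      calc ∫ Z in B, ‖fderiv ℝ v (Xt + ρ • Z)‖ ^ 2
          ≤ ∫ Z in B, 2 * yc P ^ (-(1 - 2 * α)) * eDen α v (Xt + ρ • Z) :=
            setIntegral_mono_on (hc1.integrableOn_compact hBc)
              ((hc2.const_mul _).integrableOn_compact hBc) measurableSet_closedBall
              fun Z hZ => norm_fderiv_sq_le_eDen hα v hP (hmem t ht Z hZ)
        _ = 2 * yc P ^ (-(1 - 2 * α)) * ((ρ ^ (N + 1))⁻¹ * ∫ W in closedBall Xt ρ, eDen α v W) := by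
            rw [integral_const_mul, setIntegral_unitBall_comp (eDen α v) Xt hρ]
        _ ≤ J := by
            have : ∫ W in closedBall Xt ρ, eDen α v W ≤ E := by
              refine le_trans (setIntegral_mono_set hsub ?_ (hline t ht).eventuallyLE) hEle
              exact (ae_restrict_mem measurableSet_closedBall).mono fun W hW =>
                eDen_nonneg α v (yc_pos_of_mem_closedBall hP hW).le
            rw [hJ]; gcongr
    have hk : ∫ Z in B, (κ + κ⁻¹ * ‖fderiv ℝ v (Xt + ρ • Z)‖ ^ 2) ≤ (volume.real B + 1) * κ := by
      rw [integral_add (continuousOn_const.integrableOn_compact hBc)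
        ((hc1.const_mul _).integrableOn_compact hBc), integral_const_mul, setIntegral_const,
        smul_eq_mul]
      have : κ⁻¹ * ∫ Z in B, ‖fderiv ℝ v (Xt + ρ • Z)‖ ^ 2 ≤ κ := by
        rw [inv_mul_le_iff₀ hκ0, ← sq, hκ2]; exact hJle
      linarith
    calc _ ≤ ∫ Z in B, ‖X' - X‖ * (κ + κ⁻¹ * ‖fderiv ℝ v (Xt + ρ • Z)‖ ^ 2) := by
          refine norm_integral_le_of_norm_le (((continuousOn_const.add
            (hc1.const_mul _)).const_mul _).integrableOn_compact hBc) ?_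
          refine (ae_restrict_mem measurableSet_closedBall).mono fun Z hZ => ?_
          rw [norm_mul, Real.norm_of_nonneg (avgKer_nonneg Z)]
          set h := ‖fderiv ℝ v (Xt + ρ • Z)‖ with hh
          have h0 : 0 ≤ h := norm_nonneg _
          have e1 : ‖fderiv ℝ v (Xt + ρ • Z) (X' - X)‖ ≤ h * ‖X' - X‖ :=
            ContinuousLinearMap.le_opNorm _ _
          have e2 : h ≤ κ + κ⁻¹ * h ^ 2 := by
            have : κ + κ⁻¹ * h ^ 2 - h = κ⁻¹ * ((κ - h / 2) ^ 2 + 3 / 4 * h ^ 2) := by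
              field_simp; ring
            have : 0 ≤ κ + κ⁻¹ * h ^ 2 - h := by rw [this]; positivity
            linarith
          calc avgKer Z * ‖fderiv ℝ v (Xt + ρ • Z) (X' - X)‖
              ≤ 1 * (h * ‖X' - X‖) := mul_le_mul (avgKer_le_one Z) e1 (norm_nonneg _) zero_le_one
            _ ≤ _ := by rw [one_mul, mul_comm]; exact mul_le_mul_of_nonneg_left e2 (norm_nonneg _)
      _ ≤ _ := by rw [integral_const_mul]; exact mul_le_mul_of_nonneg_left hk (norm_nonneg _)
  have := norm_image_sub_le_of_norm_deriv_le_segment'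
    (fun t ht => (hderiv t ht).hasDerivWithinAt)
    (fun t ht => hbound t (Ico_subset_Icc_self ht)) 1 (right_mem_Icc.2 zero_le_one)
  simpa using this

/-- Interior oscillation estimate in terms of the Dirichlet energy. -/
lemma exists_abs_sub_le_energy (N : ℕ) {α : ℝ} (hα : α ∈ Set.Ioo (0 : ℝ) 1) :
    ∃ C > 0, ∀ v : Euc (N + 1) → ℝ, HarmExt α v → ∀ P : Euc (N + 1), 0 < yc P → ∀ E > 0,
      ∫ W in closedBall P (yc P / 2), eDen α v W ≤ E →
      ∀ X ∈ closedBall P (yc P / 4), ∀ X' ∈ closedBall P (yc P / 4),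
        |v X - v X'| ≤ C * yc P ^ (-(((N : ℝ) - 2 * α) / 2)) * √E := by
  set D := ∫ Z in closedBall (0 : Euc (N + 1)) 1, avgKer Z with hD
  have hD0 : 0 < D := integral_avgKer_pos
  set V := volume.real (closedBall (0 : Euc (N + 1)) 1) + 1 with hV
  have hV0 : 0 < V := by positivity
  set θ : ℝ := 1 / (32 * 2 ^ (N + 1)) with hθ
  have hθ0 : 0 < θ := by positivity
  have hθ1 : θ ≤ 1 / 2 := by
    rw [hθ]
    have : (1 : ℝ) ≤ 2 ^ (N + 1) := one_le_pow₀ (by norm_num)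
    exact one_div_le_one_div_of_le (by norm_num) (by linarith)
  set K := 8 / D ^ 2 * V ^ 2 * (θ ^ (N + 1))⁻¹ with hK
  have hK0 : 0 < K := by positivity
  refine ⟨√(K * 4 ^ (N + 1)), Real.sqrt_pos.2 (by positivity), ?_⟩
  intro v hv P hP E hE hEle
  set Y := yc P with hY
  set r := Y / 2 with hr
  have hr0 : 0 < r := by positivity
  set S := closedBall P r ×ˢ closedBall P r with hS
  set d : Euc (N + 1) × Euc (N + 1) → ℝ := fun q => min (r - ‖q.1 - P‖) (r - ‖q.2 - P‖) with hd
  have hd0 : ∀ q ∈ S, 0 ≤ d q := fun q hq => by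
    have h1 := hq.1; have h2 := hq.2
    rw [mem_closedBall, dist_eq_norm] at h1 h2
    exact le_min (by linarith) (by linarith)
  have hdr : ∀ q, d q ≤ r := fun q => (min_le_left _ _).trans (by linarith [norm_nonneg (q.1 - P)])
  have hcv : ContinuousOn v (closedBall P r) := fun W hW =>
    (hv.differentiableAt W (yc_pos_of_mem_closedBall hP hW)).continuousAt.continuousWithinAt
  have hcF : ContinuousOn (fun q => d q ^ (N + 1) * (v q.1 - v q.2) ^ 2) S := by
    refine ContinuousOn.mul (by fun_prop) (ContinuousOn.pow (ContinuousOn.sub ?_ ?_) _)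
    · exact hcv.comp continuousOn_fst fun q hq => hq.1
    · exact hcv.comp continuousOn_snd fun q hq => hq.2
  obtain ⟨⟨X, X'⟩, hq, hmax⟩ := ((isCompact_closedBall P r).prod
    (isCompact_closedBall P r)).exists_isMaxOn
    ⟨(P, P), mem_closedBall_self hr0.le, mem_closedBall_self hr0.le⟩ hcF
  set δ := d (X, X') with hδ
  have hδ0 : 0 ≤ δ := hd0 _ hq
  set w := |v X - v X'| with hw
  have hw0 : 0 ≤ w := abs_nonneg _
  have hmax' : ∀ q ∈ S, d q ^ (N + 1) * (v q.1 - v q.2) ^ 2 ≤ δ ^ (N + 1) * w ^ 2 := fun q hq => by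
    rw [hw, sq_abs]; exact hmax hq
  have hmain : δ ^ (N + 1) * w ^ 2 ≤ K * (Y ^ 2 * Y ^ (-(1 - 2 * α)) * E) := by
    have hYa : 0 < Y ^ (-(1 - 2 * α)) := Real.rpow_pos_of_pos hP _
    rcases hδ0.eq_or_lt with h0 | hδ0
    · rw [← h0, zero_pow (by omega), zero_mul]; positivity
    set ρ := θ * δ with hρ
    have hρ0 : 0 < ρ := by positivity
    have hρδ : ρ ≤ δ / 2 := by nlinarith
    have hδr : δ ≤ r := hdr _
    have hX1 : ‖X - P‖ ≤ r - δ := by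
      have : δ ≤ r - ‖X - P‖ := min_le_left _ _
      linarith
    have hX2 : ‖X' - P‖ ≤ r - δ := by
      have : δ ≤ r - ‖X' - P‖ := min_le_right _ _
      linarith
    have hyc : ∀ W, ‖W - P‖ ≤ r - δ → r ≤ yc W := fun W hW => by
      have := abs_le.1 ((abs_yc_le (W - P)).trans hW)
      rw [yc_sub] at this
      linarith [this.1]
    have hball : ∀ A, ‖A - P‖ ≤ r - δ → ∀ W ∈ closedBall A ρ, ‖W - P‖ ≤ r - δ / 2 :=
      fun A hA W hW => by
        rw [mem_closedBall, dist_eq_norm] at hW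
        have : W - P = (W - A) + (A - P) := by abel
        rw [this]
        linarith [norm_add_le (W - A) (A - P)]
    have hosc : ∀ q ∈ S, δ / 2 ≤ d q → |v q.1 - v q.2| ≤ 2 ^ (N + 1) * w := fun q hq hdq => by
      have h1 := hmax' q hq
      have h2 : (δ / 2) ^ (N + 1) ≤ d q ^ (N + 1) := pow_le_pow_left₀ (by positivity) hdq _
      have h3 : (δ / 2) ^ (N + 1) * (v q.1 - v q.2) ^ 2 ≤ δ ^ (N + 1) * w ^ 2 :=
        (mul_le_mul_of_nonneg_right h2 (sq_nonneg _)).trans h1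
      have h4 : δ ^ (N + 1) = (δ / 2) ^ (N + 1) * 2 ^ (N + 1) := by rw [← mul_pow]; congr 1; ring
      rw [h4, mul_assoc] at h3
      have h5 := le_of_mul_le_mul_left h3 (by positivity)
      refine abs_le_of_sq_le_sq (h5.trans ?_) (by positivity)
      have : (1 : ℝ) ≤ 2 ^ (N + 1) := one_le_pow₀ (by norm_num)
      rw [mul_pow]
      exact mul_le_mul_of_nonneg_right (by nlinarith) (sq_nonneg w)
    have hmem : ∀ W, ‖W - P‖ ≤ r - δ / 2 → W ∈ closedBall P r := fun W hW => by
      rw [mem_closedBall, dist_eq_norm]; linarith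
    have hA : ∀ A c, ‖A - P‖ ≤ r - δ → (∀ W ∈ closedBall A ρ, |v W - c| ≤ 2 ^ (N + 1) * w) →
        |(∫ Z in closedBall (0 : Euc (N + 1)) 1, avgKer Z * v (A + ρ • Z)) - D * v A|
          ≤ D * w / 4 := fun A c hA hM => by
      have h1 := hyc A hA
      refine (hv.abs_avg_sub_le hα (hr0.trans_le h1) hρ0 (by linarith) hM).trans ?_
      have h2 : ρ / yc A ≤ θ := by
        rw [div_le_iff₀ (hr0.trans_le h1)]
        exact mul_le_mul_of_nonneg_left (hδr.trans h1) hθ0.le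
      calc 8 * D * (2 ^ (N + 1) * w) * (ρ / yc A) ≤ 8 * D * (2 ^ (N + 1) * w) * θ :=
            mul_le_mul_of_nonneg_left h2 (by positivity)
        _ = D * w / 4 := by rw [hθ]; field_simp; ring
    have hAX := hA X (v X') hX1 fun W hW => by
      have h1 := hball X hX1 W hW
      exact hosc (W, X') ⟨hmem W h1, hq.2⟩ (le_min (by simp only; linarith) (by simp only; linarith))
    have hAX' := hA X' (v X) hX2 fun W hW => by
      have h1 := hball X' hX2 W hW
      exact hosc (W, X) ⟨hmem W h1, hq.1⟩ (le_min (by simp only; linarith) (by simp only; linarith))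
    have hdiff := hv.abs_avg_sub_avg_le hα hP hρ0 (X := X) (X' := X') (E := E)
      (by linarith) (by linarith) hE hEle
    have hXX : ‖X' - X‖ ≤ Y := by
      have : X' - X = (X' - P) - (X - P) := by abel
      rw [this]
      have := norm_sub_le (X' - P) (X - P)
      linarith
    set J := 2 * Y ^ (-(1 - 2 * α)) * ((ρ ^ (N + 1))⁻¹ * E) with hJ
    have hJ0 : 0 ≤ J := by positivity
    have hdiff' := hdiff.trans (mul_le_mul_of_nonneg_right hXX (by positivity))
    have hDw : D * w ≤ 2 * (Y * (V * √J)) := by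
      have e1 : D * w = |D * v X' - D * v X| := by
        rw [← mul_sub, abs_mul, abs_of_pos hD0, hw, abs_sub_comm]
      have e2 := abs_sub_le_iff.1 hAX
      have e3 := abs_sub_le_iff.1 hAX'
      have e4 := abs_sub_le_iff.1 hdiff'
      have e5 : |D * v X' - D * v X| ≤ D * w / 2 + Y * (V * √J) :=
        abs_sub_le_iff.2 ⟨by linarith [e2.1, e3.2, e4.1], by linarith [e2.2, e3.1, e4.2]⟩
      linarith
    have hsq : D ^ 2 * w ^ 2 ≤ 4 * (Y ^ 2 * (V ^ 2 * J)) := by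
      have := pow_le_pow_left₀ (by positivity) hDw 2
      rw [mul_pow, mul_pow, mul_pow, mul_pow, Real.sq_sqrt hJ0] at this
      linarith
    have hw2 : w ^ 2 ≤ 4 / D ^ 2 * (Y ^ 2 * (V ^ 2 * J)) := by
      rw [div_mul_eq_mul_div, le_div_iff₀ (by positivity)]; linarith
    calc δ ^ (N + 1) * w ^ 2 ≤ δ ^ (N + 1) * (4 / D ^ 2 * (Y ^ 2 * (V ^ 2 * J))) := by gcongr
      _ = K * (Y ^ 2 * Y ^ (-(1 - 2 * α)) * E) := by
        rw [hK, hJ, hρ, mul_pow]; field_simp; ring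
  intro A hA A' hA'
  rw [mem_closedBall, dist_eq_norm] at hA hA'
  have h1 := (hmax' (A, A') ⟨by rw [mem_closedBall, dist_eq_norm]; linarith,
    by rw [mem_closedBall, dist_eq_norm]; linarith⟩).trans hmain
  have h2 : (Y / 4) ^ (N + 1) ≤ d (A, A') ^ (N + 1) :=
    pow_le_pow_left₀ (by positivity) (le_min (by simp only; linarith) (by simp only; linarith)) _
  have h3 := (mul_le_mul_of_nonneg_right h2 (sq_nonneg (v A - v A'))).trans h1
  have h4 : Y ^ 2 * Y ^ (-(1 - 2 * α)) = Y ^ (N + 1) * (Y ^ (-(((N : ℝ) - 2 * α) / 2))) ^ 2 := by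
    rw [← Real.rpow_natCast, ← Real.rpow_natCast, ← Real.rpow_natCast, ← Real.rpow_mul hP.le,
      ← Real.rpow_add hP, ← Real.rpow_add hP]
    congr 1; push_cast; ring
  rw [h4, div_pow, div_mul_eq_mul_div, div_le_iff₀ (by positivity)] at h3
  have h5 : (v A - v A') ^ 2
      ≤ K * 4 ^ (N + 1) * (Y ^ (-(((N : ℝ) - 2 * α) / 2))) ^ 2 * E :=
    le_of_mul_le_mul_left (by linarith) (by positivity : 0 < Y ^ (N + 1))
  have h6 := Real.abs_le_sqrt h5
  have hYb := Real.rpow_pos_of_pos hP (-(((N : ℝ) - 2 * α) / 2))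
  rwa [Real.sqrt_mul (by positivity), Real.sqrt_mul (by positivity), Real.sqrt_sq hYb.le] at h6

lemma exists_energy_closedBall_le {N : ℕ} {α : ℝ} {v : Euc (N + 1) → ℝ}
    (hen : IntegrableOn (eDen α v) (upperHalf N)) {E : ℝ} (hE : 0 < E) :
    ∃ R : ℝ, 0 < R ∧ ∀ P : Euc (N + 1), 0 < yc P → R ≤ ‖P‖ →
      ∫ W in closedBall P (yc P / 2), eDen α v W ≤ E := by
  set A : ℕ → Set (Euc (N + 1)) := fun n => upperHalf N ∩ {Z | (n : ℝ) ≤ ‖Z‖} with hA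
  have hAm : ∀ n, MeasurableSet (A n) := fun n => isOpen_upperHalf.measurableSet.inter
    (isClosed_le continuous_const continuous_norm).measurableSet
  have hanti : Antitone A := fun m n hmn Z hZ =>
    ⟨hZ.1, (Nat.cast_le.2 hmn).trans (show (n : ℝ) ≤ ‖Z‖ from hZ.2)⟩
  have h0 : ⋂ n, A n = ∅ := by
    refine eq_empty_of_forall_notMem fun Z hZ => ?_
    obtain ⟨n, hn⟩ := exists_nat_gt ‖Z‖
    exact absurd (mem_iInter.1 hZ n).2 (not_le.2 hn)
  have hlim := tendsto_setIntegral_of_antitone hAm hanti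
    ⟨0, hen.mono_set (inter_subset_left)⟩ (f := eDen α v)
  rw [h0, setIntegral_empty] at hlim
  obtain ⟨n, hn⟩ := (hlim.eventually (gt_mem_nhds hE)).exists
  refine ⟨2 * n + 1, by positivity, fun P hP hPn => ?_⟩
  refine (setIntegral_mono_set (hen.mono_set inter_subset_left) ?_
    (LE.le.eventuallyLE fun W hW => ?_)).trans hn.le
  · exact (ae_restrict_mem (hAm n)).mono fun W hW => eDen_nonneg α v (le_of_lt hW.1)
  · refine ⟨yc_pos_of_mem_closedBall hP hW, ?_⟩
    rw [mem_closedBall, dist_eq_norm] at hW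
    have h1 := (le_abs_self _).trans (abs_yc_le P)
    have h2 : ‖P‖ ≤ ‖W‖ + ‖W - P‖ := by
      have := norm_sub_le W (W - P)
      rwa [sub_sub_cancel] at this
    show (n : ℝ) ≤ ‖W‖
    linarith

lemma norm_pt_le_norm_pt {N : ℕ} (x : Euc N) {t s : ℝ} (ht : 0 ≤ t) (hts : t ≤ s) :
    ‖pt x t‖ ≤ ‖pt x s‖ := by
  refine abs_le_of_sq_le_sq' ?_ (norm_nonneg _) |>.2
  rw [norm_pt_sq, norm_pt_sq]
  nlinarith

lemma abs_sub_le_of_vertical_steps {N : ℕ} {v : Euc (N + 1) → ℝ} {x : Euc N} {R M β G : ℝ}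
    (hG : 1 + (5 / 4 : ℝ) ^ (-β) * G = G) (hG1 : 1 ≤ G) (hM : 0 ≤ M)
    (H : ∀ t s : ℝ, 0 < t → R ≤ ‖pt x t‖ → t ≤ s → s ≤ 5 / 4 * t →
      |v (pt x s) - v (pt x t)| ≤ M * t ^ (-β)) (k : ℕ) :
    ∀ t s : ℝ, 0 < t → R ≤ ‖pt x t‖ → t ≤ s → s ≤ (5 / 4) ^ k * t →
      |v (pt x s) - v (pt x t)| ≤ M * G * t ^ (-β) := by
  induction k with
  | zero =>
    intro t s ht _ hts hs
    have : s = t := le_antisymm (by simpa using hs) hts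
    rw [this, sub_self, abs_zero]
    have := Real.rpow_pos_of_pos ht (-β)
    positivity
  | succ k ih =>
    intro t s ht hR hts hs
    have hpos := Real.rpow_pos_of_pos ht (-β)
    rcases le_total s (5 / 4 * t) with h | h
    · refine (H t s ht hR hts h).trans ?_
      nlinarith [mul_nonneg hM hpos.le]
    · have h1 := ih (5 / 4 * t) s (by positivity)
        (hR.trans (norm_pt_le_norm_pt x ht.le (by linarith))) h (by rw [pow_succ] at hs; linarith)
      have h2 := H t (5 / 4 * t) ht hR (by linarith) le_rfl
      rw [Real.mul_rpow (by norm_num) ht.le] at h1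
      calc |v (pt x s) - v (pt x t)|
          ≤ |v (pt x s) - v (pt x (5 / 4 * t))| + |v (pt x (5 / 4 * t)) - v (pt x t)| :=
            abs_sub_le _ _ _
        _ ≤ M * G * ((5 / 4) ^ (-β) * t ^ (-β)) + M * t ^ (-β) := add_le_add h1 h2
        _ = M * (1 + (5 / 4) ^ (-β) * G) * t ^ (-β) := by ring
        _ = _ := by rw [hG]

lemma norm_pt_sub_pt_same {N : ℕ} (x : Euc N) (t s : ℝ) : ‖pt x s - pt x t‖ = |s - t| := by
  rw [← pt_sub, sub_self, ← abs_of_nonneg (norm_nonneg (pt (0 : Euc N) (s - t))), ← sq_eq_sq_iff_abs_eq_abs,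
    norm_pt_sq]
  simp

lemma norm_pt_sub_pt_zero {N : ℕ} (x : Euc N) (t : ℝ) : ‖pt x t - pt 0 t‖ = ‖x‖ := by
  rw [← pt_sub, sub_self, sub_zero, ← abs_of_nonneg (norm_nonneg (pt x 0)),
    ← abs_of_nonneg (norm_nonneg x), ← sq_eq_sq_iff_abs_eq_abs, norm_pt_sq]
  simp

/-- A finite-energy solution approaches a constant, with a scale-invariant rate. -/
lemma HarmExt.exists_limit {N : ℕ} {α : ℝ} (hα : α ∈ Set.Ioo (0 : ℝ) 1) (hN : 2 * α < (N : ℝ))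
    {v : Euc (N + 1) → ℝ} (hv : HarmExt α v) (hen : IntegrableOn (eDen α v) (upperHalf N)) :
    ∃ c : ℝ, ∀ ε > 0, ∃ R > 0, ∀ X : Euc (N + 1), 0 < yc X → R ≤ ‖X‖ →
      |v X - c| ≤ ε * yc X ^ (-(((N : ℝ) - 2 * α) / 2)) := by
  obtain ⟨C, hC, hosc⟩ := exists_abs_sub_le_energy N hα
  set β := ((N : ℝ) - 2 * α) / 2 with hβ
  have hβ0 : 0 < β := by rw [hβ]; linarith
  set q := (5 / 4 : ℝ) ^ (-β) with hq
  have hq0 : 0 < q := by positivity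
  have hq1 : q < 1 := Real.rpow_lt_one_of_one_lt_of_neg (by norm_num) (by linarith)
  set G := 1 / (1 - q) with hG
  have hG0 : 1 + q * G = G := by rw [hG]; have : 1 - q ≠ 0 := by linarith
                                 field_simp; ring
  have hG1 : 1 ≤ G := by rw [hG, le_div_iff₀ (by linarith)]; linarith
  have key : ∀ E > 0, ∃ R > 0, (∀ x : Euc N, ∀ t s : ℝ, 0 < t → R ≤ ‖pt x t‖ → t ≤ s →
      |v (pt x s) - v (pt x t)| ≤ C * √E * G * t ^ (-β)) ∧
      (∀ x : Euc N, ∀ t : ℝ, R ≤ t → 4 * ‖x‖ ≤ t →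
        |v (pt x t) - v (pt 0 t)| ≤ C * √E * t ^ (-β)) := by
    intro E hE
    obtain ⟨R, hR, hball⟩ := exists_energy_closedBall_le hen hE
    have hst : ∀ P : Euc (N + 1), 0 < yc P → R ≤ ‖P‖ → ∀ X : Euc (N + 1), ‖X - P‖ ≤ yc P / 4 →
        |v X - v P| ≤ C * √E * yc P ^ (-β) := fun P hP hPR X hX => by
      have := hosc v hv P hP E hE (hball P hP hPR) X
        (by rwa [mem_closedBall, dist_eq_norm]) P (mem_closedBall_self (by positivity))
      linarith
    refine ⟨R, hR, fun x t s ht hRt hts => ?_, fun x t hRt hxt => ?_⟩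
    · obtain ⟨k, hk⟩ := pow_unbounded_of_one_lt (s / t) (by norm_num : (1 : ℝ) < 5 / 4)
      refine abs_sub_le_of_vertical_steps hG0 hG1 (by positivity) ?_ k t s ht hRt hts
        ((div_le_iff₀ ht).1 hk.le)
      intro t s ht hRt hts hs
      have := hst (pt x t) (by rwa [yc_pt]) hRt (pt x s)
        (by rw [norm_pt_sub_pt_same, yc_pt, abs_of_nonneg (by linarith)]; linarith)
      rwa [yc_pt] at this
    · have := hst (pt 0 t) (by rw [yc_pt]; linarith)
        (hRt.trans (by simpa [yc_pt] using (le_abs_self _).trans (abs_yc_le (pt (0 : Euc N) t))))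
        (pt x t) (by rw [norm_pt_sub_pt_zero, yc_pt]; linarith)
      rwa [yc_pt] at this
  have hle : ∀ (x : Euc N) (t : ℝ), t ≤ ‖pt x t‖ := fun x t => by
    simpa [yc_pt] using (le_abs_self _).trans (abs_yc_le (pt x t))
  have hdecay : ∀ K : ℝ, Tendsto (fun t : ℝ => K * t ^ (-β)) atTop (𝓝 0) := fun K => by
    simpa using (tendsto_rpow_neg_atTop hβ0).const_mul K
  obtain ⟨R₁, hR₁, hvert, hhor⟩ := key 1 one_pos
  have hcau : CauchySeq fun t : ℝ => v (pt 0 t) := by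
    rw [Metric.cauchySeq_iff']
    intro ε hε
    obtain ⟨t, ht, hRt⟩ :=
      (((hdecay (C * √1 * G)).eventually (gt_mem_nhds hε)).and (eventually_ge_atTop R₁)).exists
    exact ⟨t, fun s hs => (hvert 0 t s (hR₁.trans_le hRt) (hRt.trans (hle _ _)) hs).trans_lt ht⟩
  obtain ⟨c, hc⟩ := cauchySeq_tendsto_of_complete hcau
  have hcx : ∀ x : Euc N, Tendsto (fun t : ℝ => v (pt x t)) atTop (𝓝 c) := fun x => by
    have : Tendsto (fun t : ℝ => v (pt x t) - v (pt 0 t)) atTop (𝓝 0) := by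
      refine squeeze_zero_norm' ?_ (hdecay (C * √1))
      filter_upwards [eventually_ge_atTop R₁, eventually_ge_atTop (4 * ‖x‖)] with t h1 h2
      exact hhor x t h1 h2
    simpa using this.add hc
  refine ⟨c, fun ε hε => ?_⟩
  obtain ⟨R, hR, hv', -⟩ := key ((ε / (C * G)) ^ 2) (by positivity)
  refine ⟨R, hR, fun X hX hXR => ?_⟩
  have h1 : ∀ᶠ s in atTop, |v (pt (xc X) s) - v X| ≤ ε * yc X ^ (-β) := by
    filter_upwards [eventually_ge_atTop (yc X)] with s hs
    have := hv' (xc X) (yc X) s hX (by rwa [pt_xc_yc]) hs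
    rw [pt_xc_yc, Real.sqrt_sq (by positivity)] at this
    refine this.trans (le_of_eq ?_)
    field_simp
  rw [abs_sub_comm]
  exact le_of_tendsto (((hcx (xc X)).sub_const (v X)).abs) h1

/-- A solution of the critical problem that tends to `c` away from the boundary, with the
scale-invariant rate. -/
structure CritSol (N : ℕ) (α : ℝ) (v : Euc (N + 1) → ℝ) (c : ℝ) : Prop
    extends HarmExt α v where
  neumann : ∀ x : Euc N,
    NeumannLim α v x (-(|v (pt x 0)| ^ (critExp N α - 2) * v (pt x 0)))
  far : ∀ ε > 0, ∃ R > 0, ∀ X : Euc (N + 1), 0 < yc X → R ≤ ‖X‖ →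
    |v X - c| ≤ ε * yc X ^ (-(((N : ℝ) - 2 * α) / 2))

lemma CritSol.neg {N : ℕ} {α : ℝ} {v : Euc (N + 1) → ℝ} {c : ℝ} (hv : CritSol N α v c) :
    CritSol N α (fun X => -v X) (-c) where
  toHarmExt := by simpa using hv.toHarmExt.const_mul (-1)
  neumann x := by
    have := (hv.neumann x).const_mul hv.differentiableAt (-1)
    simpa using this
  far ε hε := by
    obtain ⟨R, hR, h⟩ := hv.far ε hε
    refine ⟨R, hR, fun X hX hXR => ?_⟩
    rw [neg_sub_neg, abs_sub_comm]
    exact h X hX hXR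

lemma mul_critExp_sub_two {N : ℕ} {α : ℝ} (hN : 2 * α < (N : ℝ)) :
    ((N : ℝ) - 2 * α) / 2 * (critExp N α - 2) = 2 * α := by
  have : (N : ℝ) - 2 * α ≠ 0 := by linarith
  rw [critExp]; field_simp; ring

lemma critExp_sub_two_pos {N : ℕ} {α : ℝ} (hα : 0 < α) (hN : 2 * α < (N : ℝ)) :
    0 < critExp N α - 2 := by
  have h := mul_critExp_sub_two hN
  by_contra hc
  have : ((N : ℝ) - 2 * α) / 2 * (critExp N α - 2) ≤ 0 :=
    mul_nonpos_of_nonneg_of_nonpos (by linarith) (not_lt.1 hc)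
  linarith

/-- Two-sided version of the cylinder estimate. -/
lemma HarmExt.abs_sub_le_of_cylinder {N : ℕ} {α : ℝ} (hα : α ∈ Set.Ioo (0 : ℝ) 1) (hN : 0 < N)
    {v : Euc (N + 1) → ℝ} (hv : HarmExt α v) {x₀ : Euc N} {b σ G K τ c : ℝ}
    (hb : 0 < b) (hσ : 0 < σ) (hK : 0 < K) (hG : 0 < G)
    (htop : ∀ x, ‖x - x₀‖ ≤ b → |v (pt x σ) - c| ≤ τ)
    (hlat : ∀ x, ‖x - x₀‖ = b → ∀ y, 0 ≤ y → y ≤ σ → |v (pt x y) - c| ≤ τ + K * b ^ 2)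
    (hneu : ∀ x, ‖x - x₀‖ < b → ∃ L, |L| < G ∧ NeumannLim α v x L)
    {y : ℝ} (hy : 0 ≤ y) (hyσ : y ≤ σ) :
    |v (pt x₀ y) - c| ≤ τ + G * ((σ ^ (2 * α) - y ^ (2 * α)) / (2 * α))
      + K * (N / (1 - α)) * (σ ^ 2 - y ^ 2) := by
  have hmin : min G 0 = 0 := min_eq_right hG.le
  rw [abs_sub_le_iff]
  constructor
  · have := hv.le_of_cylinder hα hN (T := c + τ) (G := G) (K := K) hb hσ hK
      (fun x hx => by linarith [(abs_sub_le_iff.1 (htop x hx)).1])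
      (fun x hx y h0 h1 => by
        rw [hmin]; linarith [(abs_sub_le_iff.1 (hlat x hx y h0 h1)).1])
      (fun x hx => by
        obtain ⟨L, hL, h⟩ := hneu x hx
        exact ⟨L, (abs_lt.1 hL).1, h⟩) hy hyσ
    linarith
  · have := (hv.const_mul (-1)).le_of_cylinder hα hN (T := -c + τ) (G := G) (K := K) hb hσ hK
      (fun x hx => by linarith [(abs_sub_le_iff.1 (htop x hx)).2])
      (fun x hx y h0 h1 => by
        rw [hmin]; linarith [(abs_sub_le_iff.1 (hlat x hx y h0 h1)).2])
      (fun x hx => by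
        obtain ⟨L, hL, h⟩ := hneu x hx
        exact ⟨-1 * L, by linarith [(abs_lt.1 hL).2], h.const_mul hv.differentiableAt _⟩) hy hyσ
    linarith

lemma exists_small_pos {α : ℝ} (hα : 0 < α) (A B : ℝ) {η : ℝ} (hη : 0 < η) :
    ∃ s : ℝ, 0 < s ∧ s ≤ 1 ∧ A * s ^ (2 * α) ≤ η ∧ B * s ^ 2 ≤ η := by
  have h1 : Tendsto (fun s : ℝ => A * s ^ (2 * α)) (𝓝[>] 0) (𝓝 0) := by
    simpa using (tendsto_rpow_zero_right (by linarith : 0 < 2 * α)).const_mul A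
  have h2 : Tendsto (fun s : ℝ => B * s ^ 2) (𝓝[>] 0) (𝓝 0) := by
    have : Continuous fun s : ℝ => B * s ^ 2 := by fun_prop
    simpa using (this.tendsto 0).mono_left nhdsWithin_le_nhds
  have h3 : ∀ᶠ s : ℝ in 𝓝[>] 0, s ≤ 1 :=
    nhdsWithin_le_nhds (eventually_le_nhds (by norm_num))
  have h4 : ∀ᶠ s : ℝ in 𝓝[>] 0, 0 < s := self_mem_nhdsWithin
  obtain ⟨s, ⟨⟨h1, h2⟩, h3⟩, h4⟩ := (((h1.eventually (ge_mem_nhds hη)).and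
    (h2.eventually (ge_mem_nhds hη))).and (h3)).and h4 |>.exists
  exact ⟨s, h4, h3, h1, h2⟩

lemma isCompact_halfBall {N : ℕ} (P : Euc (N + 1)) (r : ℝ) :
    IsCompact (closedBall P r ∩ {X | 0 ≤ yc X}) :=
  (isCompact_closedBall P r).inter_right isClosed_closedHalf

set_option maxHeartbeats 1000000 in
/-- Scale-invariant local bound far away from the origin, by point picking. -/
lemma CritSol.exists_local_bound {N : ℕ} {α : ℝ} (hα : α ∈ Set.Ioo (0 : ℝ) 1)
    (hN : 2 * α < (N : ℝ)) {v : Euc (N + 1) → ℝ} {c : ℝ} (hv : CritSol N α v c) {δ : ℝ}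
    (hδ : 0 < δ) :
    ∃ R > 0, ∀ x : Euc N, R ≤ ‖x‖ → ∀ r : ℝ, 0 < r → r ≤ ‖x‖ / 2 →
      ∀ X : Euc (N + 1), 0 ≤ yc X → ‖X - pt x 0‖ ≤ r →
        (r - ‖X - pt x 0‖) ^ (((N : ℝ) - 2 * α) / 2) * |v X|
          ≤ δ + 4 * r ^ (((N : ℝ) - 2 * α) / 2) * |c| := by
  obtain ⟨hα0, hα1⟩ := id hα
  have hN0 : 0 < N := by
    have : (0 : ℝ) < N := by linarith
    exact_mod_cast this
  set β := ((N : ℝ) - 2 * α) / 2 with hβ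
  have hβ0 : 0 < β := by rw [hβ]; linarith
  set γ := critExp N α - 2 with hγ
  have hγ0 : 0 < γ := critExp_sub_two_pos hα0 hN
  have hβγ : β * γ = 2 * α := mul_critExp_sub_two hN
  set b : ℝ := 2 ^ β with hb
  have hb0 : 0 < b := by positivity
  have hb1 : 1 ≤ b := Real.one_le_rpow (by norm_num) hβ0.le
  set AN : ℝ := N / (1 - α) with hAN
  have hNR : (0 : ℝ) < N := by exact_mod_cast hN0
  have hAN0 : 0 < AN := div_pos hNR (by linarith)
  obtain ⟨s, hs0, hs1, hs2, hs3⟩ := exists_small_pos hα0 (b ^ γ * b / α) ((b + 1) * AN)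
    (by norm_num : (0 : ℝ) < 1 / 8)
  set Cδ : ℝ := max (4 ^ β / δ) 1 with hCδ
  have hCδ0 : 0 < Cδ := lt_of_lt_of_le one_pos (le_max_right _ _)
  set ε : ℝ := s ^ β / (8 * Cδ) with hε
  have hε0 : 0 < ε := by positivity
  obtain ⟨R, hR, hfar⟩ := hv.far ε hε0
  refine ⟨2 * R, by positivity, fun a ha r hr0 hr X hX hXr => ?_⟩
  set P : Euc (N + 1) := pt a 0 with hP
  have hPnorm : ‖P‖ = ‖a‖ := by
    rw [← abs_of_nonneg (norm_nonneg P), ← abs_of_nonneg (norm_nonneg a),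
      ← sq_eq_sq_iff_abs_eq_abs, hP, norm_pt_sq]
    simp
  set S := closedBall P r ∩ {X | 0 ≤ yc X} with hS
  have hfarS : ∀ Z, ‖Z - P‖ ≤ r → R ≤ ‖Z‖ := fun Z hZ => by
    have h2 : ‖P‖ ≤ ‖Z‖ + ‖Z - P‖ := by
      have := norm_sub_le Z (Z - P)
      rwa [sub_sub_cancel] at this
    rw [hPnorm] at h2
    linarith
  have hcF : ContinuousOn (fun X => (r - ‖X - P‖) ^ β * |v X|) S := by
    refine ContinuousOn.mul ?_ (hv.cont.mono inter_subset_right).abs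
    exact Continuous.continuousOn ((by fun_prop : Continuous fun X : Euc (N + 1) => r - ‖X - P‖).rpow_const
      fun _ => Or.inr hβ0.le)
  have hXS : X ∈ S := ⟨by rwa [mem_closedBall, dist_eq_norm], hX⟩
  obtain ⟨X₁, hX₁S, hmax⟩ := (isCompact_halfBall P r).exists_isMaxOn ⟨X, hXS⟩ hcF
  refine (hmax hXS).trans ?_
  by_contra! hlt
  have hX₁r : ‖X₁ - P‖ ≤ r := by
    have := hX₁S.1
    rwa [mem_closedBall, dist_eq_norm] at this
  have hX₁y : 0 ≤ yc X₁ := hX₁S.2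
  set d := r - ‖X₁ - P‖ with hd
  set A := |v X₁| with hA
  have hd0 : 0 < d := by
    rcases (sub_nonneg.2 hX₁r : 0 ≤ r - ‖X₁ - P‖).eq_or_lt with h | h
    · rw [hd, ← h, Real.zero_rpow hβ0.ne', zero_mul] at hlt
      have : 0 ≤ 4 * r ^ β * |c| := by positivity
      linarith
    · exact h
  have hdβ : 0 < d ^ β := Real.rpow_pos_of_pos hd0 _
  have hrβ : 0 < r ^ β := Real.rpow_pos_of_pos hr0 _
  have hdr : d ^ β ≤ r ^ β :=
    Real.rpow_le_rpow hd0.le (by linarith [norm_nonneg (X₁ - P)]) hβ0.le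
  have hA0 : 0 < A := by
    rcases (abs_nonneg (v X₁)).eq_or_lt with h | h
    · rw [hA, ← h, mul_zero] at hlt
      have : 0 ≤ 4 * r ^ β * |c| := by positivity
      linarith
    · exact h
  have hcA : |c| ≤ A / 4 := by
    have h1 : 4 * r ^ β * |c| ≤ r ^ β * A := by nlinarith
    have h2 : r ^ β * (4 * |c|) ≤ r ^ β * A := by linarith
    linarith [le_of_mul_le_mul_left h2 hrβ]
  have hAδ : δ / d ^ β ≤ A := by
    rw [div_le_iff₀ hdβ]
    have : 0 ≤ 4 * r ^ β * |c| := by positivity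
    linarith
  set lam := min (d / 4) (A ^ (-β⁻¹)) with hlam
  have hlam0 : 0 < lam := lt_min (by positivity) (Real.rpow_pos_of_pos hA0 _)
  have hlamd : lam ≤ d / 4 := min_le_left _ _
  have hAlam : A * lam ^ β ≤ 1 := by
    have : lam ^ β ≤ (A ^ (-β⁻¹)) ^ β := Real.rpow_le_rpow hlam0.le (min_le_right _ _) hβ0.le
    rw [← Real.rpow_mul hA0.le, neg_mul, inv_mul_cancel₀ hβ0.ne', Real.rpow_neg_one] at this
    calc A * lam ^ β ≤ A * A⁻¹ := mul_le_mul_of_nonneg_left this hA0.le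
      _ = 1 := mul_inv_cancel₀ hA0.ne'
  have hlaminv : lam ^ (-β) ≤ Cδ * A := by
    rcases min_choice (d / 4) (A ^ (-β⁻¹)) with h | h
    · rw [hlam, h, Real.rpow_neg (by positivity), Real.div_rpow hd0.le (by norm_num), inv_div]
      calc (4 : ℝ) ^ β / d ^ β = 4 ^ β / δ * (δ / d ^ β) := by field_simp
        _ ≤ Cδ * A := mul_le_mul (le_max_left _ _) hAδ (by positivity) hCδ0.le
    · rw [hlam, h, ← Real.rpow_mul hA0.le, neg_mul_neg, inv_mul_cancel₀ hβ0.ne', Real.rpow_one]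
      exact le_mul_of_one_le_left hA0.le (le_max_right _ _)
  have hAγ : A ^ γ * lam ^ (2 * α) ≤ 1 := by
    rw [← hβγ, Real.rpow_mul hlam0.le, ← Real.mul_rpow hA0.le (by positivity)]
    exact Real.rpow_le_one (by positivity) hAlam hγ0.le
  set σ := s * lam with hσ
  have hσ0 : 0 < σ := by positivity
  have hσlam : σ ≤ lam := by nlinarith
  have hεσ : ε * σ ^ (-β) ≤ A / 8 := by
    rw [hσ, Real.mul_rpow hs0.le hlam0.le, hε]
    calc s ^ β / (8 * Cδ) * (s ^ (-β) * lam ^ (-β))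
        = lam ^ (-β) / (8 * Cδ) := by
          rw [Real.rpow_neg hs0.le]
          have := (Real.rpow_pos_of_pos hs0 β).ne'
          field_simp
      _ ≤ Cδ * A / (8 * Cδ) := by gcongr
      _ = A / 8 := by field_simp
  have hhigh : ∀ Z, ‖Z - P‖ ≤ r → σ ≤ yc Z → |v Z - c| ≤ A / 8 := fun Z hZ hy => by
    refine ((hfar Z (hσ0.trans_le hy) (hfarS Z hZ)).trans ?_).trans hεσ
    exact mul_le_mul_of_nonneg_left
      (Real.rpow_le_rpow_of_nonpos hσ0 hy (by linarith)) hε0.le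
  have hnear : ∀ Z, ‖Z - X₁‖ ≤ d / 2 → ‖Z - P‖ ≤ r - d / 2 := fun Z hZ => by
    have : Z - P = (Z - X₁) + (X₁ - P) := by abel
    rw [this]
    linarith [norm_add_le (Z - X₁) (X₁ - P)]
  have hbd : ∀ Z, ‖Z - X₁‖ ≤ d / 2 → 0 ≤ yc Z → |v Z| ≤ b * A := fun Z hZ hy => by
    have h1 := hnear Z hZ
    have h2 : (r - ‖Z - P‖) ^ β * |v Z| ≤ d ^ β * A :=
      hmax (show Z ∈ S from ⟨by rw [mem_closedBall, dist_eq_norm]; linarith, hy⟩)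
    have h3 : (d / 2) ^ β ≤ (r - ‖Z - P‖) ^ β :=
      Real.rpow_le_rpow (by positivity) (by linarith) hβ0.le
    have h4 := (mul_le_mul_of_nonneg_right h3 (abs_nonneg (v Z))).trans h2
    rw [Real.div_rpow hd0.le (by norm_num), div_mul_eq_mul_div, div_le_iff₀ hb0] at h4
    exact le_of_mul_le_mul_left (by linarith) hdβ
  have hv1 : A ≤ |c| + |v X₁ - c| := by
    have := abs_add_le c (v X₁ - c)
    rwa [add_sub_cancel] at this
  rcases le_or_gt σ (yc X₁) with hcase | hcase
  · linarith [hhigh X₁ hX₁r hcase]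
  · have hcyl : ∀ x y, ‖x - xc X₁‖ ≤ lam → 0 ≤ y → y ≤ σ → ‖pt x y - X₁‖ ≤ d / 2 :=
      fun x y hx h0 h1 => by
        refine le_trans ?_ (by linarith : 2 * lam ≤ d / 2)
        have h2lam : 0 ≤ 2 * lam := by linarith
        rw [← sq_le_sq₀ (norm_nonneg _) h2lam, norm_sq_eq, xc_sub, yc_sub, xc_pt, yc_pt]
        have h2 : (y - yc X₁) ^ 2 ≤ lam ^ 2 := sq_le_sq' (by linarith) (by linarith)
        have h3 : ‖x - xc X₁‖ ^ 2 ≤ lam ^ 2 := pow_le_pow_left₀ (norm_nonneg _) hx 2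
        nlinarith
    set G := 2 * ((b * A) ^ γ * (b * A)) with hG
    set K := (b + 1) * A / lam ^ 2 with hK
    have hbAγ : 0 < (b * A) ^ γ := Real.rpow_pos_of_pos (by positivity) _
    have htop : ∀ x, ‖x - xc X₁‖ ≤ lam → |v (pt x σ) - c| ≤ A / 8 := fun x hx =>
      hhigh _ ((hnear _ (hcyl x σ hx hσ0.le le_rfl)).trans (by linarith)) (yc_pt x σ).ge
    have hlat : ∀ x, ‖x - xc X₁‖ = lam → ∀ y, 0 ≤ y → y ≤ σ →
        |v (pt x y) - c| ≤ A / 8 + K * lam ^ 2 := fun x hx y h0 h1 => by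
      have h2 := hbd _ (hcyl x y hx.le h0 h1) (h0.trans (yc_pt x y).ge)
      have h3 : K * lam ^ 2 = (b + 1) * A := by rw [hK]; field_simp
      have h4 := abs_sub (v (pt x y)) c
      rw [h3]
      linarith
    have hflux : ∀ x, ‖x - xc X₁‖ < lam → ∃ L, |L| < G ∧ NeumannLim α v x L := fun x hx => by
      refine ⟨_, ?_, hv.neumann x⟩
      have h2 := hbd _ (hcyl x 0 hx.le le_rfl hσ0.le) (yc_pt x 0).ge
      rw [abs_neg, abs_mul, abs_of_nonneg (Real.rpow_nonneg (abs_nonneg _) _)]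
      have h3 : |v (pt x 0)| ^ γ ≤ (b * A) ^ γ := Real.rpow_le_rpow (abs_nonneg _) h2 hγ0.le
      have h4 := mul_le_mul h3 h2 (abs_nonneg _) hbAγ.le
      have h5 : 0 < (b * A) ^ γ * (b * A) := by positivity
      linarith
    have hK0 : 0 < K := by positivity
    have hG0 : 0 < G := by positivity
    have hres := hv.toHarmExt.abs_sub_le_of_cylinder hα hN0 hlam0 hσ0 hK0 hG0 htop hlat hflux
      hX₁y hcase.le
    rw [pt_xc_yc] at hres
    have e1 : G * ((σ ^ (2 * α) - yc X₁ ^ (2 * α)) / (2 * α)) ≤ A / 8 := by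
      have h1 : σ ^ (2 * α) - yc X₁ ^ (2 * α) ≤ σ ^ (2 * α) := by
        linarith [Real.rpow_nonneg hX₁y (2 * α)]
      calc G * ((σ ^ (2 * α) - yc X₁ ^ (2 * α)) / (2 * α))
          ≤ G * (σ ^ (2 * α) / (2 * α)) := by gcongr
        _ = (b ^ γ * b / α * s ^ (2 * α)) * (A ^ γ * lam ^ (2 * α)) * A := by
            rw [hG, hσ, Real.mul_rpow hs0.le hlam0.le, Real.mul_rpow hb0.le hA0.le]
            field_simp
        _ ≤ 1 / 8 * 1 * A := by gcongr
        _ = A / 8 := by ring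
    have e2 : K * AN * (σ ^ 2 - yc X₁ ^ 2) ≤ A / 8 := by
      calc K * AN * (σ ^ 2 - yc X₁ ^ 2) ≤ K * AN * σ ^ 2 :=
            mul_le_mul_of_nonneg_left (by linarith [sq_nonneg (yc X₁)]) (by positivity)
        _ = ((b + 1) * AN * s ^ 2) * A := by rw [hK, hσ]; field_simp
        _ ≤ 1 / 8 * A := by gcongr
        _ = A / 8 := by ring
    linarith

lemma norm_pt_zero_right {N : ℕ} (x : Euc N) : ‖pt x 0‖ = ‖x‖ := by
  rw [← sq_eq_sq₀ (norm_nonneg _) (norm_nonneg _), norm_pt_sq]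
  simp

lemma norm_le_norm_pt {N : ℕ} (x : Euc N) (y : ℝ) : ‖x‖ ≤ ‖pt x y‖ := by
  simpa [xc_pt] using norm_xc_le (pt x y)

lemma norm_le_xc_add_yc {N : ℕ} {X : Euc (N + 1)} (hX : 0 ≤ yc X) : ‖X‖ ≤ ‖xc X‖ + yc X := by
  have h : 0 ≤ ‖xc X‖ + yc X := by positivity
  rw [← sq_le_sq₀ (norm_nonneg _) h, norm_sq_eq]
  nlinarith [norm_nonneg (xc X)]

lemma norm_pt_sub_pt_le {N : ℕ} (x a : Euc N) {y : ℝ} (hy : 0 ≤ y) :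
    ‖pt x y - pt a 0‖ ≤ ‖x - a‖ + y := by
  rw [← pt_sub, sub_zero]
  have := norm_le_xc_add_yc (X := pt (x - a) y) (by rwa [yc_pt])
  rwa [xc_pt, yc_pt] at this

/-- A critical solution approaches its limit uniformly in the height. -/
lemma CritSol.exists_abs_sub_le {N : ℕ} {α : ℝ} (hα : α ∈ Set.Ioo (0 : ℝ) 1)
    (hN : 2 * α < (N : ℝ)) {v : Euc (N + 1) → ℝ} {c : ℝ} (hv : CritSol N α v c) {η : ℝ}
    (hη : 0 < η) :
    ∃ R > 0, ∀ x : Euc N, R ≤ ‖x‖ → ∀ y, 0 ≤ y → |v (pt x y) - c| ≤ η := by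
  obtain ⟨hα0, hα1⟩ := id hα
  have hN0 : 0 < N := by
    have : (0 : ℝ) < N := by linarith
    exact_mod_cast this
  have hNR : (0 : ℝ) < N := by exact_mod_cast hN0
  set β := ((N : ℝ) - 2 * α) / 2 with hβ
  have hβ0 : 0 < β := by rw [hβ]; linarith
  set γ := critExp N α - 2 with hγ
  have hγ0 : 0 < γ := critExp_sub_two_pos hα0 hN
  obtain ⟨R₁, hR₁, hloc⟩ := hv.exists_local_bound hα hN one_pos
  set B : ℝ := 2 ^ β * (1 + 4 * |c|) with hB
  have hB0 : 0 < B := by positivity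
  have hbd : ∀ a : Euc N, max R₁ 2 ≤ ‖a‖ → ∀ x y, ‖x - a‖ ≤ 1 / 4 → 0 ≤ y → y ≤ 1 / 4 →
      |v (pt x y)| ≤ B := fun a ha x y hx h0 h1 => by
    have hd : ‖pt x y - pt a 0‖ ≤ 1 / 2 := (norm_pt_sub_pt_le x a h0).trans (by linarith)
    have h2 := hloc a ((le_max_left _ _).trans ha) 1 one_pos
      (by linarith [(le_max_right R₁ 2).trans ha]) (pt x y) (by rwa [yc_pt]) (by linarith)
    rw [Real.one_rpow, mul_one] at h2
    have h3 : (1 / 2 : ℝ) ^ β ≤ (1 - ‖pt x y - pt a 0‖) ^ β :=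
      Real.rpow_le_rpow (by norm_num) (by linarith) hβ0.le
    have h4 := (mul_le_mul_of_nonneg_right h3 (abs_nonneg (v (pt x y)))).trans h2
    rw [Real.div_rpow (by norm_num) (by norm_num), Real.one_rpow, div_mul_eq_mul_div, one_mul,
      div_le_iff₀ (by positivity)] at h4
    linarith
  set K : ℝ := (B + |c|) * 16 with hK
  have hK0 : 0 < K := by positivity
  set G : ℝ := 2 * (B ^ γ * B) with hG
  have hG0 : 0 < G := by positivity
  obtain ⟨s, hs0, hs1, hs2, hs3⟩ := exists_small_pos hα0 (G / (2 * α)) (K * (N / (1 - α)))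
    (by positivity : 0 < η / 4)
  set σ := s / 4 with hσ
  have hσ0 : 0 < σ := by positivity
  have hσs : σ ≤ s := by rw [hσ]; linarith
  obtain ⟨R₂, hR₂, hfar⟩ := hv.far (η / 2 * σ ^ β) (by positivity)
  have hhigh : ∀ x : Euc N, R₂ ≤ ‖x‖ → ∀ y, σ ≤ y → |v (pt x y) - c| ≤ η / 2 :=
    fun x hx y hy => by
      have h1 := hfar (pt x y) (by rw [yc_pt]; linarith) (hx.trans (norm_le_norm_pt x y))
      rw [yc_pt] at h1
      have h2 : y ^ (-β) ≤ σ ^ (-β) := Real.rpow_le_rpow_of_nonpos hσ0 hy (by linarith)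
      refine h1.trans ((mul_le_mul_of_nonneg_left h2 (by positivity)).trans (le_of_eq ?_))
      rw [Real.rpow_neg hσ0.le]
      have := (Real.rpow_pos_of_pos hσ0 β).ne'
      field_simp
  refine ⟨max R₁ 2 + (R₂ + 1), by positivity, fun a ha y hy => ?_⟩
  have ha1 : max R₁ 2 ≤ ‖a‖ := by linarith
  have hm : 0 ≤ max R₁ 2 := (by norm_num : (0 : ℝ) ≤ 2).trans (le_max_right _ _)
  rcases le_total σ y with hσy | hyσ
  · linarith [hhigh a (by linarith) y hσy]
  have hnorm : ∀ x : Euc N, ‖x - a‖ ≤ 1 / 4 → R₂ ≤ ‖x‖ := fun x hx => by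
    have := norm_sub_le x (x - a)
    rw [sub_sub_cancel] at this
    linarith
  have hres := hv.toHarmExt.abs_sub_le_of_cylinder hα hN0 (x₀ := a) (b := 1 / 4) (τ := η / 2)
    (c := c) (by norm_num) hσ0 hK0 hG0 (fun x hx => hhigh x (hnorm x hx) σ le_rfl)
    (fun x hx y h0 h1 => by
      have h2 := hbd a ha1 x y hx.le h0 (by linarith)
      have h3 := abs_sub (v (pt x y)) c
      have h4 : K * (1 / 4) ^ 2 = B + |c| := by rw [hK]; ring
      rw [h4]
      linarith)
    (fun x hx => by
      refine ⟨_, ?_, hv.neumann x⟩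
      have h2 := hbd a ha1 x 0 hx.le le_rfl (by norm_num)
      rw [abs_neg, abs_mul, abs_of_nonneg (Real.rpow_nonneg (abs_nonneg _) _)]
      have h3 : |v (pt x 0)| ^ γ ≤ B ^ γ := Real.rpow_le_rpow (abs_nonneg _) h2 hγ0.le
      have h4 := mul_le_mul h3 h2 (abs_nonneg _) (by positivity)
      have h5 : 0 < B ^ γ * B := by positivity
      linarith) hy hyσ
  have e1 : G * ((σ ^ (2 * α) - y ^ (2 * α)) / (2 * α)) ≤ η / 4 := by
    have h1 : σ ^ (2 * α) - y ^ (2 * α) ≤ s ^ (2 * α) := by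
      linarith [Real.rpow_nonneg hy (2 * α),
        Real.rpow_le_rpow hσ0.le hσs (by linarith : 0 ≤ 2 * α)]
    calc G * ((σ ^ (2 * α) - y ^ (2 * α)) / (2 * α))
        ≤ G * (s ^ (2 * α) / (2 * α)) := by gcongr
      _ = G / (2 * α) * s ^ (2 * α) := by ring
      _ ≤ η / 4 := hs2
  have e2 : K * (N / (1 - α)) * (σ ^ 2 - y ^ 2) ≤ η / 4 := by
    refine le_trans (mul_le_mul_of_nonneg_left ?_ ?_) hs3
    · nlinarith [sq_nonneg y]
    · exact mul_nonneg hK0.le (div_nonneg hNR.le (by linarith))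
  linarith

lemma CritSol.limit_nonpos {N : ℕ} {α : ℝ} (hα : α ∈ Set.Ioo (0 : ℝ) 1)
    (hN : 2 * α < (N : ℝ)) {v : Euc (N + 1) → ℝ} {c : ℝ} (hv : CritSol N α v c) : c ≤ 0 := by
  by_contra! hc
  obtain ⟨hα0, hα1⟩ := id hα
  have hN0 : 0 < N := by
    have : (0 : ℝ) < N := by linarith
    exact_mod_cast this
  have hNR : (0 : ℝ) < N := by exact_mod_cast hN0
  set γ := critExp N α - 2 with hγ
  have hγ0 : 0 < γ := critExp_sub_two_pos hα0 hN
  set A : ℝ := N / (1 - α) with hA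
  have hA0 : 0 < A := div_pos hNR (by linarith)
  obtain ⟨h, hh0, hh1, -, hh2⟩ := exists_small_pos hα0 0 A (by norm_num : (0 : ℝ) < 1 / 2)
  set g : ℝ := (c / 2) ^ γ * (c / 2) / 2 with hg
  have hcγ : 0 < (c / 2) ^ γ := by positivity
  have hg0 : 0 < g := by positivity
  set H : ℝ := h ^ (2 * α) / (2 * α) with hH
  have hH0 : 0 < H := div_pos (Real.rpow_pos_of_pos hh0 _) (by linarith)
  set ε : ℝ := min (c / 2) (g * H / 8) with hε
  have hε0 : 0 < ε := lt_min (by linarith) (by positivity)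
  have hε1 : ε ≤ c / 2 := min_le_left _ _
  have hε2 : ε ≤ g * H / 8 := min_le_right _ _
  obtain ⟨R, hR, hlim⟩ := hv.exists_abs_sub_le hα hN hε0
  have : Nonempty (Fin N) := ⟨⟨0, hN0⟩⟩
  obtain ⟨a, ha⟩ := NormedSpace.exists_lt_norm ℝ (Euc N) (R + 1)
  have hclose : ∀ x : Euc N, ‖x - a‖ ≤ 1 → ∀ y, 0 ≤ y → |v (pt x y) - c| ≤ ε :=
    fun x hx y hy => by
      refine hlim x ?_ y hy
      have := norm_sub_le x (x - a)
      rw [sub_sub_cancel] at this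
      linarith
  have hres := hv.neg.toHarmExt.le_of_cylinder hα hN0 (x₀ := a) (b := 1) (σ := h) (G := -g)
    (K := g * H) (T := -c + ε) one_pos hh0 (by positivity)
    (fun x hx => by linarith [(abs_sub_le_iff.1 (hclose x hx h hh0.le)).2])
    (fun x hx y h0 h1 => by
      rw [min_eq_left (by linarith)]
      linarith [(abs_sub_le_iff.1 (hclose x hx.le y h0)).2])
    (fun x hx => by
      refine ⟨_, ?_, hv.neg.neumann x⟩
      have h1 : c / 2 ≤ v (pt x 0) := by
        linarith [(abs_sub_le_iff.1 (hclose x hx.le 0 le_rfl)).2]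
      have h2 : (c / 2) ^ γ ≤ |v (pt x 0)| ^ γ :=
        Real.rpow_le_rpow (by linarith) (h1.trans (le_abs_self _)) hγ0.le
      have h3 := mul_le_mul h2 h1 (by linarith) (Real.rpow_nonneg (abs_nonneg _) _)
      have h4 : 0 < (c / 2) ^ γ * (c / 2) := by positivity
      rw [abs_neg, neg_neg, mul_neg, neg_neg]
      linarith) le_rfl hh0.le
  rw [Real.zero_rpow (by linarith), sub_zero, zero_pow two_ne_zero, sub_zero] at hres
  have h1 := (abs_sub_le_iff.1 (hclose a (by simp) 0 le_rfl)).1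
  have h2 : g * H * A * h ^ 2 ≤ g * H / 2 := by
    have := mul_le_mul_of_nonneg_left hh2 (by positivity : 0 ≤ g * H)
    linarith
  have h3 : 0 < g * H := by positivity
  linarith

lemma CritSol.limit_eq_zero {N : ℕ} {α : ℝ} (hα : α ∈ Set.Ioo (0 : ℝ) 1)
    (hN : 2 * α < (N : ℝ)) {v : Euc (N + 1) → ℝ} {c : ℝ} (hv : CritSol N α v c) : c = 0 :=
  le_antisymm (hv.limit_nonpos hα hN) (by linarith [hv.neg.limit_nonpos hα hN])

/-- Decay at the scale-invariant rate, with arbitrarily small constant. -/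
lemma CritSol.exists_slow_decay {N : ℕ} {α : ℝ} (hα : α ∈ Set.Ioo (0 : ℝ) 1)
    (hN : 2 * α < (N : ℝ)) {v : Euc (N + 1) → ℝ} (hv : CritSol N α v 0) {δ : ℝ} (hδ : 0 < δ) :
    ∃ R > 0, ∀ X : Euc (N + 1), 0 ≤ yc X → R ≤ ‖X‖ →
      ‖X‖ ^ (((N : ℝ) - 2 * α) / 2) * |v X| ≤ δ := by
  set β := ((N : ℝ) - 2 * α) / 2 with hβ
  have hβ0 : 0 < β := by rw [hβ]; linarith
  have hδ5 : 0 < δ / 5 ^ β := by positivity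
  obtain ⟨R₁, hR₁, hloc⟩ := hv.exists_local_bound hα hN hδ5
  obtain ⟨R₂, hR₂, hfar⟩ := hv.far (δ / 5 ^ β) hδ5
  refine ⟨2 * R₁ + R₂, by positivity, fun X hX hXR => ?_⟩
  have hX0 : 0 < ‖X‖ := by linarith
  suffices h : (‖X‖ / 5) ^ β * |v X| ≤ δ / 5 ^ β by
    rw [Real.div_rpow hX0.le (by norm_num), div_mul_eq_mul_div] at h
    exact (div_le_div_iff_of_pos_right (by positivity)).1 h
  have hsum := norm_le_xc_add_yc hX
  rcases le_total (yc X) (‖xc X‖ / 4) with h | h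
  · have hx0 : 0 < ‖xc X‖ := by linarith
    have hdist : ‖X - pt (xc X) 0‖ ≤ yc X := by
      have := norm_pt_sub_pt_le (xc X) (xc X) hX
      rwa [pt_xc_yc, sub_self, norm_zero, zero_add] at this
    have h1 := hloc (xc X) (by linarith) (‖xc X‖ / 2) (by linarith) le_rfl X hX (by linarith)
    rw [abs_zero, mul_zero, add_zero] at h1
    refine le_trans (mul_le_mul_of_nonneg_right ?_ (abs_nonneg _)) h1
    exact Real.rpow_le_rpow (by positivity) (by linarith) hβ0.le
  · have hy0 : 0 < yc X := by
      rcases hX.eq_or_lt with h0 | h0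
      · have := norm_nonneg (xc X)
        linarith
      · exact h0
    have h1 := hfar X hy0 (by linarith)
    rw [sub_zero] at h1
    calc (‖X‖ / 5) ^ β * |v X| ≤ yc X ^ β * (δ / 5 ^ β * yc X ^ (-β)) := by
          refine mul_le_mul (Real.rpow_le_rpow (by positivity) (by linarith) hβ0.le) h1
            (abs_nonneg _) (by positivity)
      _ = δ / 5 ^ β := by
          rw [Real.rpow_neg hy0.le]
          have := (Real.rpow_pos_of_pos hy0 β).ne'
          field_simp

/-- A strict positive supersolution outside the ball of radius `R`, for the potential `w` on the
boundary. -/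
structure Barrier (N : ℕ) (α R : ℝ) (w : Euc N → ℝ) (φ : Euc (N + 1) → ℝ) : Prop where
  smooth : ∀ X, 0 < yc X → ContDiffAt ℝ 2 φ X
  cont : ∀ X, X ≠ 0 → ContinuousAt φ X
  pos : ∀ X, 0 ≤ yc X → R ≤ ‖X‖ → 0 < φ X
  super : ∀ X, 0 < yc X → R ≤ ‖X‖ → extOp α φ X < 0
  flux : ∀ x, R ≤ ‖x‖ → ∃ ψ, NeumannLim α φ x (-ψ) ∧ w x * φ (pt x 0) < ψ

lemma Barrier.differentiableAt {N : ℕ} {α R : ℝ} {w : Euc N → ℝ} {φ : Euc (N + 1) → ℝ}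
    (h : Barrier N α R w φ) (X : Euc (N + 1)) (hX : 0 < yc X) : DifferentiableAt ℝ φ X :=
  (h.smooth X hX).differentiableAt (by norm_num)

lemma Barrier.add {N : ℕ} {α R : ℝ} {w : Euc N → ℝ} {φ ψ : Euc (N + 1) → ℝ}
    (h : Barrier N α R w φ) (k : Barrier N α R w ψ) : Barrier N α R w (fun X => φ X + ψ X) where
  smooth X hX := (h.smooth X hX).add (k.smooth X hX)
  cont X hX := (h.cont X hX).add (k.cont X hX)
  pos X hX hR := add_pos (h.pos X hX hR) (k.pos X hX hR)
  super X hX hR := by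
    rw [extOp_add (h.smooth X hX) (k.smooth X hX)]
    exact add_neg (h.super X hX hR) (k.super X hX hR)
  flux x hx := by
    obtain ⟨a, ha, ha'⟩ := h.flux x hx
    obtain ⟨b, hb, hb'⟩ := k.flux x hx
    refine ⟨a + b, ?_, by linarith⟩
    rw [neg_add]
    exact ha.add hb h.differentiableAt k.differentiableAt

lemma Barrier.const_mul {N : ℕ} {α R : ℝ} {w : Euc N → ℝ} {φ : Euc (N + 1) → ℝ}
    (h : Barrier N α R w φ) {c : ℝ} (hc : 0 < c) : Barrier N α R w (fun X => c * φ X) where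
  smooth X hX := contDiffAt_const.mul (h.smooth X hX)
  cont X hX := continuousAt_const.mul (h.cont X hX)
  pos X hX hR := mul_pos hc (h.pos X hX hR)
  super X hX hR := by
    rw [extOp_const_mul (h.smooth X hX)]
    exact mul_neg_of_pos_of_neg hc (h.super X hX hR)
  flux x hx := by
    obtain ⟨a, ha, ha'⟩ := h.flux x hx
    refine ⟨c * a, ?_, by nlinarith⟩
    rw [← mul_neg]
    exact ha.const_mul h.differentiableAt c

/-- Comparison of a critical solution with a barrier. -/
lemma CritSol.le_barrier {N : ℕ} {α : ℝ} {v φ : Euc (N + 1) → ℝ} {c R : ℝ} (hR : 0 < R)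
    (hv : CritSol N α v c)
    (hφ : Barrier N α R (fun x => |v (pt x 0)| ^ (critExp N α - 2)) φ)
    (hbdry : ∀ X, 0 ≤ yc X → ‖X‖ = R → v X ≤ φ X)
    (hfar : ∃ M, ∀ X, 0 ≤ yc X → M ≤ ‖X‖ → v X ≤ φ X)
    {X : Euc (N + 1)} (hX : 0 ≤ yc X) (hXR : R ≤ ‖X‖) : v X ≤ φ X := by
  by_contra! hlt
  obtain ⟨M, hM⟩ := hfar
  have hφX := hφ.pos X hX hXR
  have hXM : ‖X‖ < M := by
    by_contra! h
    linarith [hM X hX h]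
  set S : Set (Euc (N + 1)) := (closedBall 0 M ∩ {X | 0 ≤ yc X}) ∩ {X | R ≤ ‖X‖} with hS
  have hSc : IsCompact S :=
    (isCompact_halfBall 0 M).inter_right (isClosed_le continuous_const continuous_norm)
  have hXS : X ∈ S := ⟨⟨by simpa using hXM.le, hX⟩, hXR⟩
  have hne : ∀ Z : Euc (N + 1), R ≤ ‖Z‖ → Z ≠ 0 := fun Z hZ => norm_pos_iff.1 (hR.trans_le hZ)
  have hcont : ContinuousOn (fun Z => v Z / φ Z) S := by
    refine ContinuousOn.div (hv.cont.mono fun Z hZ => hZ.1.2)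
      (fun Z hZ => (hφ.cont Z (hne Z hZ.2)).continuousWithinAt)
      fun Z hZ => (hφ.pos Z hZ.1.2 hZ.2).ne'
  obtain ⟨Y, hYS, hmax⟩ := hSc.exists_isMaxOn ⟨X, hXS⟩ hcont
  have hY : 0 ≤ yc Y := hYS.1.2
  have hYR : R ≤ ‖Y‖ := hYS.2
  have hφY := hφ.pos Y hY hYR
  set t := v Y / φ Y with ht
  have hvY : v Y = t * φ Y := by rw [ht]; field_simp
  have ht1 : 1 < t := ((one_lt_div hφX).2 hlt).trans_le (hmax hXS)
  have hYR' : R < ‖Y‖ := by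
    refine hYR.lt_of_ne fun h => ?_
    have := hbdry Y hY h.symm
    nlinarith
  set D : Set (Euc (N + 1)) := {Z | 0 ≤ yc Z ∧ R ≤ ‖Z‖} with hD
  set z : Euc (N + 1) → ℝ := fun Z => t * φ Z + (-1) * v Z with hz
  have hmin : IsMinOn z D Y := by
    intro Z hZ
    have hφZ := hφ.pos Z hZ.1 hZ.2
    have hzY : z Y = 0 := by simp only [hz]; rw [hvY]; ring
    show z Y ≤ z Z
    rw [hzY]
    suffices h : v Z ≤ t * φ Z by simp only [hz]; linarith
    rcases le_total M ‖Z‖ with h | h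
    · nlinarith [hM Z hZ.1 h]
    · exact (div_le_iff₀ hφZ).1 (hmax (show Z ∈ S from ⟨⟨by simpa using h, hZ.1⟩, hZ.2⟩))
  have hs1 : ∀ Z, 0 < yc Z → ContDiffAt ℝ 2 (fun Z => t * φ Z) Z := fun Z hZ =>
    contDiffAt_const.mul (hφ.smooth Z hZ)
  have hs2 : ∀ Z, 0 < yc Z → ContDiffAt ℝ 2 (fun Z => (-1) * v Z) Z := fun Z hZ =>
    contDiffAt_const.mul (hv.smooth Z hZ)
  have hsz : ∀ Z, 0 < yc Z → ContDiffAt ℝ 2 z Z := fun Z hZ => (hs1 Z hZ).add (hs2 Z hZ)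
  have hev : ∀ᶠ Z in 𝓝 Y, R < ‖Z‖ := continuous_norm.continuousAt.eventually_const_lt hYR'
  refine false_of_isMinOn (α := α) hY hmin (fun hpos => ⟨?_, hsz Y hpos, ?_⟩) fun h0 =>
    ⟨?_, ?_, fun Z hZ => (hsz Z hZ).differentiableAt (by norm_num), ?_⟩
  · filter_upwards [hev, continuous_yc.continuousAt.eventually_const_lt hpos] with Z h1 h2
    exact ⟨h2.le, h1.le⟩
  · rw [hz, extOp_add (hs1 Y hpos) (hs2 Y hpos), extOp_const_mul (hφ.smooth Y hpos),
      extOp_const_mul (hv.smooth Y hpos), hv.eq_zero Y hpos]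
    nlinarith [hφ.super Y hpos hYR]
  · have hYp : pt (xc Y) 0 = Y := by rw [← h0, pt_xc_yc]
    filter_upwards [self_mem_nhdsWithin] with y (hy : 0 < y)
    refine ⟨by rw [yc_pt]; exact hy.le, hYR.trans ?_⟩
    have hYn : ‖Y‖ = ‖xc Y‖ := by rw [← norm_pt_zero_right (xc Y), hYp]
    rw [hYn]
    exact norm_le_norm_pt _ _
  · exact (continuousWithinAt_const.mul (hφ.cont Y (hne Y hYR)).continuousWithinAt).add
      (continuousWithinAt_const.mul (hv.cont Y hY))
  · have hYp : pt (xc Y) 0 = Y := by rw [← h0, pt_xc_yc]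
    obtain ⟨ψ, hψ, hlt⟩ := hφ.flux (xc Y) (by rwa [← norm_pt_zero_right, hYp])
    have hd1 : ∀ Z, 0 < yc Z → DifferentiableAt ℝ (fun Z => t * φ Z) Z := fun Z hZ =>
      (hs1 Z hZ).differentiableAt (by norm_num)
    have hd2 : ∀ Z, 0 < yc Z → DifferentiableAt ℝ (fun Z => (-1) * v Z) Z := fun Z hZ =>
      (hs2 Z hZ).differentiableAt (by norm_num)
    have hn1 := hψ.const_mul hφ.differentiableAt t
    have hn2 := (hv.neumann (xc Y)).const_mul hv.differentiableAt (-1)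
    refine ⟨_, ?_, hn1.add hn2 hd1 hd2⟩
    simp only [hYp, hvY] at hlt ⊢
    nlinarith

lemma tendsto_normSq_rpow_neg {s : ℝ} (hs : 0 < s) {η : ℝ} (hη : 0 < η) :
    ∃ M > 0, ∀ r : ℝ, M ≤ r → (r ^ 2) ^ (-s) ≤ η := by
  have h1 : Tendsto (fun r : ℝ => (r ^ 2) ^ (-s)) atTop (𝓝 0) :=
    (tendsto_rpow_neg_atTop hs).comp (tendsto_pow_atTop two_ne_zero)
  obtain ⟨M, hM⟩ := eventually_atTop.1 (h1.eventually (ge_mem_nhds hη))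
  exact ⟨max M 1, by positivity, fun r hr => hM r ((le_max_left _ _).trans hr)⟩

/-- Improvement of the slow decay by means of a barrier; the barrier `ψ` only serves at
infinity. -/
lemma CritSol.le_of_barriers {N : ℕ} {α : ℝ} {v φ ψ : Euc (N + 1) → ℝ} {c R s b : ℝ} (hR : 0 < R)
    (hb : 0 < b) (hv : CritSol N α v c)
    (hslow : ∀ X, 0 ≤ yc X → R ≤ ‖X‖ → |v X| ≤ (‖X‖ ^ 2) ^ (-(2 * b)))
    (hφ : Barrier N α R (fun x => |v (pt x 0)| ^ (critExp N α - 2)) φ)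
    (hψ : Barrier N α R (fun x => |v (pt x 0)| ^ (critExp N α - 2)) ψ)
    (hφ1 : ∀ X, 0 ≤ yc X → R ≤ ‖X‖ → (‖X‖ ^ 2) ^ (-s) / 2 ≤ φ X)
    (hφ2 : ∀ X, 0 ≤ yc X → R ≤ ‖X‖ → φ X ≤ (‖X‖ ^ 2) ^ (-s))
    (hψ1 : ∀ X, 0 ≤ yc X → R ≤ ‖X‖ → (‖X‖ ^ 2) ^ (-b) / 2 ≤ ψ X)
    {X : Euc (N + 1)} (hX : 0 ≤ yc X) (hXR : R ≤ ‖X‖) :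
    v X ≤ 2 * (R ^ 2) ^ (s - 2 * b) * (‖X‖ ^ 2) ^ (-s) := by
  set A := 2 * (R ^ 2) ^ (s - 2 * b) with hA
  have hA0 : 0 < A := by positivity
  suffices h : ∀ ε > 0, v X ≤ A * φ X + ε * ψ X by
    have h1 : v X ≤ A * φ X := by
      refine le_of_forall_pos_le_add fun ε hε => ?_
      have h2 := hψ.pos X hX hXR
      have h3 := h (ε / ψ X) (div_pos hε h2)
      rwa [div_mul_cancel₀ _ h2.ne'] at h3
    exact h1.trans (mul_le_mul_of_nonneg_left (hφ2 X hX hXR) hA0.le)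
  intro ε hε
  refine hv.le_barrier hR ((hφ.const_mul hA0).add (hψ.const_mul hε)) (fun Z hZ hZR => ?_) ?_
    hX hXR
  · have h1 := hφ1 Z hZ hZR.ge
    have h2 := (le_abs_self _).trans (hslow Z hZ hZR.ge)
    have h3 := mul_pos hε (hψ.pos Z hZ hZR.ge)
    have h4 := mul_le_mul_of_nonneg_left h1 hA0.le
    rw [hZR] at h2 h4
    have h5 : A * ((R ^ 2) ^ (-s) / 2) = (R ^ 2) ^ (-(2 * b)) := by
      rw [show -(2 * b) = (s - 2 * b) + (-s) by ring, Real.rpow_add (by positivity), hA]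
      ring
    linarith
  · obtain ⟨M, hM, h⟩ := tendsto_normSq_rpow_neg hb (half_pos hε)
    refine ⟨max M R, fun Z hZ hZM => ?_⟩
    have hZR := (le_max_right _ _).trans hZM
    have hZ0 : 0 < ‖Z‖ := hR.trans_le hZR
    have h1 := h ‖Z‖ ((le_max_left _ _).trans hZM)
    have h2 := (le_abs_self _).trans (hslow Z hZ hZR)
    have h3 := mul_pos hA0 (hφ.pos Z hZ hZR)
    have h4 := mul_le_mul_of_nonneg_left (hψ1 Z hZ hZR) hε.le
    have h5 : 0 < (‖Z‖ ^ 2) ^ (-b) := by positivity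
    rw [show -(2 * b) = -b + -b by ring, Real.rpow_add (by positivity)] at h2
    nlinarith

lemma ycRpow_le_normSqRpow {N : ℕ} {α : ℝ} (hα : 0 ≤ α) {X : Euc (N + 1)} (hX : 0 ≤ yc X) :
    yc X ^ (2 * α) ≤ (‖X‖ ^ 2) ^ α := by
  rw [Real.rpow_mul hX, Real.rpow_two]
  exact Real.rpow_le_rpow (by positivity) (by rw [norm_sq_eq]; nlinarith [sq_nonneg ‖xc X‖]) hα

lemma ycRpow_mul_normSqRpow_le {N : ℕ} {α : ℝ} (hα : 0 ≤ α) {X : Euc (N + 1)} (hX : 0 ≤ yc X)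
    (hX0 : X ≠ 0) (s : ℝ) : yc X ^ (2 * α) * (‖X‖ ^ 2) ^ (-(s + α)) ≤ (‖X‖ ^ 2) ^ (-s) := by
  have hq : 0 < ‖X‖ ^ 2 := by positivity
  calc yc X ^ (2 * α) * (‖X‖ ^ 2) ^ (-(s + α)) ≤ (‖X‖ ^ 2) ^ α * (‖X‖ ^ 2) ^ (-(s + α)) :=
        mul_le_mul_of_nonneg_right (ycRpow_le_normSqRpow hα hX) (by positivity)
    _ = (‖X‖ ^ 2) ^ (-s) := by rw [← Real.rpow_add hq]; ring_nf

lemma continuousAt_normSqRpow {N : ℕ} {X : Euc (N + 1)} (hX : X ≠ 0) (s : ℝ) :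
    ContinuousAt (fun Z : Euc (N + 1) => (‖Z‖ ^ 2) ^ s) X :=
  (by fun_prop : ContinuousAt (fun Z : Euc (N + 1) => ‖Z‖ ^ 2) X).rpow_const
    (Or.inl (by positivity))

lemma contDiffAt_ycRpow_mul_normSqRpow {N : ℕ} {α : ℝ} {X : Euc (N + 1)} (hX : 0 < yc X) (s : ℝ) :
    ContDiffAt ℝ 2 (fun Z : Euc (N + 1) => yc Z ^ (2 * α) * (‖Z‖ ^ 2) ^ s) X :=
  (contDiffAt_ycRpow hX _).mul (pureJet_normSqRpow hX s).contDiffAt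

/-- Barriers decaying more slowly than the fundamental solution. -/
lemma exists_barrier {N : ℕ} {α : ℝ} (hα : α ∈ Set.Ioo (0 : ℝ) 1) {s : ℝ} (hs : 0 < s)
    (hsβ : s < ((N : ℝ) - 2 * α) / 2) :
    ∃ κ > 0, ∀ R > 0, ∀ w : Euc N → ℝ, (∀ x, R ≤ ‖x‖ → w x * (‖x‖ ^ 2) ^ α ≤ κ) →
      ∃ φ, Barrier N α R w φ ∧
        (∀ X, 0 ≤ yc X → R ≤ ‖X‖ → (‖X‖ ^ 2) ^ (-s) / 2 ≤ φ X) ∧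
        ∀ X, 0 ≤ yc X → R ≤ ‖X‖ → φ X ≤ (‖X‖ ^ 2) ^ (-s) := by
  obtain ⟨hα0, hα1⟩ := id hα
  set β := ((N : ℝ) - 2 * α) / 2 with hβ
  set Q := (s + α) * (β + α - s) with hQ
  have hQ0 : 0 < Q := mul_pos (by linarith) (by linarith)
  set P := s * (β - s) with hP
  have hP0 : 0 < P := mul_pos hs (by linarith)
  set κ : ℝ := min (1 / 2) (P / (2 * Q)) with hκ
  have hκ0 : 0 < κ := lt_min (by norm_num) (by positivity)
  have hκ1 : κ ≤ 1 / 2 := min_le_left _ _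
  have hκ2 : κ * Q < P := by
    have := (le_div_iff₀ (by positivity)).1 (min_le_right (1 / 2) (P / (2 * Q)))
    linarith
  refine ⟨α * κ, by positivity, fun R hR w hw => ?_⟩
  have hne : ∀ Z : Euc (N + 1), R ≤ ‖Z‖ → Z ≠ 0 := fun Z hZ => norm_pos_iff.1 (hR.trans_le hZ)
  have hs1 : ∀ Z : Euc (N + 1), 0 < yc Z → ContDiffAt ℝ 2 (fun Z => (‖Z‖ ^ 2) ^ (-s)) Z :=
    fun Z hZ => (pureJet_normSqRpow hZ _).contDiffAt
  have hs2 : ∀ Z : Euc (N + 1), 0 < yc Z →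
      ContDiffAt ℝ 2 (fun Z => yc Z ^ (2 * α) * (‖Z‖ ^ 2) ^ (-(s + α))) Z :=
    fun Z hZ => contDiffAt_ycRpow_mul_normSqRpow hZ _
  have hs3 : ∀ Z : Euc (N + 1), 0 < yc Z →
      ContDiffAt ℝ 2 (fun Z => (-κ) * (yc Z ^ (2 * α) * (‖Z‖ ^ 2) ^ (-(s + α)))) Z :=
    fun Z hZ => contDiffAt_const.mul (hs2 Z hZ)
  have hlow : ∀ X : Euc (N + 1), 0 ≤ yc X → R ≤ ‖X‖ → (‖X‖ ^ 2) ^ (-s) / 2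
      ≤ (‖X‖ ^ 2) ^ (-s) + (-κ) * (yc X ^ (2 * α) * (‖X‖ ^ 2) ^ (-(s + α))) := fun X hX hXR => by
    have h1 := ycRpow_mul_normSqRpow_le hα0.le hX (hne X hXR) s
    have h2 : 0 ≤ yc X ^ (2 * α) * (‖X‖ ^ 2) ^ (-(s + α)) := by positivity
    nlinarith
  refine ⟨fun X => (‖X‖ ^ 2) ^ (-s) + (-κ) * (yc X ^ (2 * α) * (‖X‖ ^ 2) ^ (-(s + α))),
    ⟨fun X hX => (hs1 X hX).add (hs3 X hX), fun X hX => ?_, fun X hX hXR => ?_,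
      fun X hX hXR => ?_, fun x hx => ?_⟩, hlow, fun X hX hXR => ?_⟩
  · exact (continuousAt_normSqRpow hX _).add (continuousAt_const.mul
      ((continuous_ycRpow (by positivity)).continuousAt.mul (continuousAt_normSqRpow hX _)))
  · have := hne X hXR
    exact lt_of_lt_of_le (by positivity) (hlow X hX hXR)
  · rw [extOp_add (hs1 X hX) (hs3 X hX), extOp_const_mul (hs2 X hX), extOp_normSqRpow hX,
      extOp_ycRpow_mul_normSqRpow hX]
    have h1 := ycRpow_mul_normSqRpow_le hα0.le hX.le (hne X hXR) (s + 1)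
    rw [show -(s + 1 + α) = -(s + α) - 1 by ring, show -(s + 1) = -s - 1 by ring] at h1
    have h2 : 0 < (‖X‖ ^ 2) ^ (-s - 1) := Real.rpow_pos_of_pos (normSq_pos_of_yc_pos hX) _
    set a := (‖X‖ ^ 2) ^ (-s - 1)
    set u := yc X ^ (2 * α) * (‖X‖ ^ 2) ^ (-(s + α) - 1)
    have h3 : κ * Q * u ≤ κ * Q * a := mul_le_mul_of_nonneg_left h1 (by positivity)
    have h4 : κ * Q * a < P * a := mul_lt_mul_of_pos_right hκ2 h2
    have h5 : 4 * s * (s - β) * a + -κ * (4 * (s + α) * (s + α - β - 2 * α) * u)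
        = 4 * (κ * Q * u - P * a) := by rw [hQ, hP]; ring
    rw [h5]
    linarith
  · have hx0 : x ≠ 0 := norm_pos_iff.1 (hR.trans_le hx)
    have hq : 0 < ‖x‖ ^ 2 := by positivity
    refine ⟨κ * (2 * α * (‖x‖ ^ 2) ^ (-(s + α))), ?_, ?_⟩
    · have h := (neumannLim_normSqRpow hα1 hx0 (-s)).add
        ((neumannLim_ycRpow_mul_normSqRpow hα hx0 (-(s + α))).const_mul
          (fun Z hZ => (hs2 Z hZ).differentiableAt (by norm_num)) (-κ))
        (fun Z hZ => (hs1 Z hZ).differentiableAt (by norm_num))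
        (fun Z hZ => (hs3 Z hZ).differentiableAt (by norm_num))
      rwa [zero_add, neg_mul] at h
    · have h1 := hw x hx
      have h2 : (‖x‖ ^ 2) ^ (-s) = (‖x‖ ^ 2) ^ α * (‖x‖ ^ 2) ^ (-(s + α)) := by
        rw [← Real.rpow_add hq]; ring_nf
      have h3 : 0 < (‖x‖ ^ 2) ^ (-(s + α)) := by positivity
      rw [yc_pt, norm_pt_zero_right, Real.zero_rpow (by positivity), zero_mul, mul_zero, add_zero,
        h2, ← mul_assoc]
      have h4 : 0 < α * κ := by positivity
      nlinarith
  · have h2 : 0 ≤ κ * (yc X ^ (2 * α) * (‖X‖ ^ 2) ^ (-(s + α))) := by positivity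
    linarith

/-- Barriers with the decay of the fundamental solution. -/
lemma exists_sharp_barrier {N : ℕ} {α : ℝ} (hα : α ∈ Set.Ioo (0 : ℝ) 1) (hN : 2 * α < (N : ℝ)) :
    ∃ κ > 0, ∃ R₀ > 0, ∀ R ≥ R₀, ∀ w : Euc N → ℝ, (∀ x, 0 ≤ w x) →
      (∀ x, R ≤ ‖x‖ → w x * (‖x‖ ^ 2) ^ (5 / 4 * α) ≤ κ) →
      ∃ φ, Barrier N α R w φ ∧
        (∀ X, 0 ≤ yc X → R ≤ ‖X‖ → (‖X‖ ^ 2) ^ (-(((N : ℝ) - 2 * α) / 2)) / 2 ≤ φ X) ∧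
        ∀ X, 0 ≤ yc X → R ≤ ‖X‖ → φ X ≤ (‖X‖ ^ 2) ^ (-(((N : ℝ) - 2 * α) / 2)) := by
  obtain ⟨hα0, hα1⟩ := id hα
  set β := ((N : ℝ) - 2 * α) / 2 with hβ
  have hβ0 : 0 < β := by rw [hβ]; linarith
  set s := β + α / 4 with hs
  have hs0 : 0 < s := by positivity
  set κ : ℝ := s / (4 * (s + α)) with hκ
  have hκ0 : 0 < κ := by positivity
  have hκ2 : κ * (4 * (s + α)) = s := by rw [hκ]; field_simp
  have hκ1 : κ ≤ 1 := by rw [hκ, div_le_one (by positivity)]; linarith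
  obtain ⟨R₀, hR₀, hlarge⟩ := tendsto_normSq_rpow_neg (s := α / 4) (by positivity)
    (by norm_num : (0 : ℝ) < 1 / 4)
  refine ⟨α * κ, by positivity, R₀, hR₀, fun R hRR w hw0 hw => ?_⟩
  have hR : 0 < R := hR₀.trans_le hRR
  have hne : ∀ Z : Euc (N + 1), R ≤ ‖Z‖ → Z ≠ 0 := fun Z hZ => norm_pos_iff.1 (hR.trans_le hZ)
  have hs1 : ∀ t : ℝ, ∀ Z : Euc (N + 1), 0 < yc Z → ContDiffAt ℝ 2 (fun Z => (‖Z‖ ^ 2) ^ (-t)) Z :=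
    fun t Z hZ => (pureJet_normSqRpow hZ _).contDiffAt
  have hs1' : ∀ Z : Euc (N + 1), 0 < yc Z →
      ContDiffAt ℝ 2 (fun Z => (-1) * (‖Z‖ ^ 2) ^ (-s)) Z :=
    fun Z hZ => contDiffAt_const.mul (hs1 s Z hZ)
  have hs2 : ∀ Z : Euc (N + 1), 0 < yc Z →
      ContDiffAt ℝ 2 (fun Z => yc Z ^ (2 * α) * (‖Z‖ ^ 2) ^ (-(s + α))) Z :=
    fun Z hZ => contDiffAt_ycRpow_mul_normSqRpow hZ _
  have hs3 : ∀ Z : Euc (N + 1), 0 < yc Z →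
      ContDiffAt ℝ 2 (fun Z => (-κ) * (yc Z ^ (2 * α) * (‖Z‖ ^ 2) ^ (-(s + α)))) Z :=
    fun Z hZ => contDiffAt_const.mul (hs2 Z hZ)
  have hs4 : ∀ Z : Euc (N + 1), 0 < yc Z →
      ContDiffAt ℝ 2 (fun Z => (‖Z‖ ^ 2) ^ (-β) + (-1) * (‖Z‖ ^ 2) ^ (-s)) Z :=
    fun Z hZ => (hs1 β Z hZ).add (hs1' Z hZ)
  have hlow : ∀ X : Euc (N + 1), 0 ≤ yc X → R ≤ ‖X‖ → (‖X‖ ^ 2) ^ (-β) / 2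
      ≤ ((‖X‖ ^ 2) ^ (-β) + (-1) * (‖X‖ ^ 2) ^ (-s))
        + (-κ) * (yc X ^ (2 * α) * (‖X‖ ^ 2) ^ (-(s + α))) := fun X hX hXR => by
    have h0 := hne X hXR
    have h1 := ycRpow_mul_normSqRpow_le hα0.le hX h0 s
    have h2 : 0 ≤ yc X ^ (2 * α) * (‖X‖ ^ 2) ^ (-(s + α)) := by positivity
    have h3 := hlarge ‖X‖ (hRR.trans hXR)
    have h4 : (‖X‖ ^ 2) ^ (-s) = (‖X‖ ^ 2) ^ (-β) * (‖X‖ ^ 2) ^ (-(α / 4)) := by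
      rw [← Real.rpow_add (by positivity), hs]; ring_nf
    have h5 : 0 < (‖X‖ ^ 2) ^ (-β) := by positivity
    have h6 : (‖X‖ ^ 2) ^ (-s) ≤ (‖X‖ ^ 2) ^ (-β) * (1 / 4) := by
      rw [h4]; exact mul_le_mul_of_nonneg_left h3 h5.le
    have h7 : κ * (yc X ^ (2 * α) * (‖X‖ ^ 2) ^ (-(s + α)))
        ≤ yc X ^ (2 * α) * (‖X‖ ^ 2) ^ (-(s + α)) := mul_le_of_le_one_left h2 hκ1
    linarith
  have hup : ∀ X : Euc (N + 1), 0 ≤ yc X → R ≤ ‖X‖ →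
      ((‖X‖ ^ 2) ^ (-β) + (-1) * (‖X‖ ^ 2) ^ (-s))
        + (-κ) * (yc X ^ (2 * α) * (‖X‖ ^ 2) ^ (-(s + α))) ≤ (‖X‖ ^ 2) ^ (-β) := fun X hX hXR => by
    have h2 : 0 ≤ κ * (yc X ^ (2 * α) * (‖X‖ ^ 2) ^ (-(s + α))) := by positivity
    have h3 : 0 ≤ (‖X‖ ^ 2) ^ (-s) := by positivity
    linarith
  refine ⟨fun X => ((‖X‖ ^ 2) ^ (-β) + (-1) * (‖X‖ ^ 2) ^ (-s))
      + (-κ) * (yc X ^ (2 * α) * (‖X‖ ^ 2) ^ (-(s + α))),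
    ⟨fun X hX => (hs4 X hX).add (hs3 X hX), fun X hX => ?_, fun X hX hXR => ?_,
      fun X hX hXR => ?_, fun x hx => ?_⟩, hlow, hup⟩
  · exact ((continuousAt_normSqRpow hX _).add (continuousAt_const.mul
      (continuousAt_normSqRpow hX _))).add (continuousAt_const.mul
      ((continuous_ycRpow (by positivity)).continuousAt.mul (continuousAt_normSqRpow hX _)))
  · have := hne X hXR
    exact lt_of_lt_of_le (by positivity) (hlow X hX hXR)
  · rw [extOp_add (hs4 X hX) (hs3 X hX), extOp_add (hs1 β X hX) (hs1' X hX),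
      extOp_const_mul (hs1 s X hX), extOp_const_mul (hs2 X hX), extOp_normSqRpow hX,
      extOp_normSqRpow hX, extOp_ycRpow_mul_normSqRpow hX]
    have h1 := ycRpow_mul_normSqRpow_le hα0.le hX.le (hne X hXR) (s + 1)
    rw [show -(s + 1 + α) = -(s + α) - 1 by ring, show -(s + 1) = -s - 1 by ring] at h1
    have h2 : 0 < (‖X‖ ^ 2) ^ (-s - 1) := Real.rpow_pos_of_pos (normSq_pos_of_yc_pos hX) _
    set a := (‖X‖ ^ 2) ^ (-s - 1)
    set u := yc X ^ (2 * α) * (‖X‖ ^ 2) ^ (-(s + α) - 1)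
    have h3 : s * u ≤ s * a := mul_le_mul_of_nonneg_left h1 hs0.le
    have h5 : 4 * β * (β - β) * (‖X‖ ^ 2) ^ (-β - 1) + -1 * (4 * s * (s - β) * a)
        + -κ * (4 * (s + α) * (s + α - β - 2 * α) * u) = α * (3 / 4 * (s * u) - s * a) := by
      rw [show s - β = α / 4 by rw [hs]; ring, show s + α - β - 2 * α = -(3 / 4 * α) by rw [hs]; ring]
      linear_combination (3 / 4 * α * u) * hκ2
    rw [h5]
    have h6 : 0 < s * a := by positivity
    exact mul_neg_of_pos_of_neg hα0 (by linarith)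
  · have hx0 : x ≠ 0 := norm_pos_iff.1 (hR.trans_le hx)
    have hq : 0 < ‖x‖ ^ 2 := by positivity
    refine ⟨κ * (2 * α * (‖x‖ ^ 2) ^ (-(s + α))), ?_, ?_⟩
    · have h := ((neumannLim_normSqRpow hα1 hx0 (-β)).add
        ((neumannLim_normSqRpow hα1 hx0 (-s)).const_mul
          (fun Z hZ => (hs1 s Z hZ).differentiableAt (by norm_num)) (-1))
        (fun Z hZ => (hs1 β Z hZ).differentiableAt (by norm_num))
        (fun Z hZ => (hs1' Z hZ).differentiableAt (by norm_num))).add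
        ((neumannLim_ycRpow_mul_normSqRpow hα hx0 (-(s + α))).const_mul
          (fun Z hZ => (hs2 Z hZ).differentiableAt (by norm_num)) (-κ))
        (fun Z hZ => (hs4 Z hZ).differentiableAt (by norm_num))
        (fun Z hZ => (hs3 Z hZ).differentiableAt (by norm_num))
      rwa [mul_zero, zero_add, zero_add, neg_mul] at h
    · have h0 := hup (pt x 0) (yc_pt x 0).ge (by rwa [norm_pt_zero_right])
      have h1 := hw x hx
      have h2 : (‖x‖ ^ 2) ^ (-β) = (‖x‖ ^ 2) ^ (5 / 4 * α) * (‖x‖ ^ 2) ^ (-(s + α)) := by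
        rw [← Real.rpow_add hq, hs]; ring_nf
      have h3 : 0 < (‖x‖ ^ 2) ^ (-(s + α)) := by positivity
      refine (mul_le_mul_of_nonneg_left h0 (hw0 x)).trans_lt ?_
      rw [norm_pt_zero_right, h2, ← mul_assoc]
      have h4 : 0 < α * κ := by positivity
      nlinarith

lemma CritSol.abs_le_of_barriers {N : ℕ} {α : ℝ} {v φ ψ : Euc (N + 1) → ℝ} {R s b : ℝ}
    (hR : 0 < R) (hb : 0 < b) (hv : CritSol N α v 0)
    (hslow : ∀ X, 0 ≤ yc X → R ≤ ‖X‖ → |v X| ≤ (‖X‖ ^ 2) ^ (-(2 * b)))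
    (hφ : Barrier N α R (fun x => |v (pt x 0)| ^ (critExp N α - 2)) φ)
    (hψ : Barrier N α R (fun x => |v (pt x 0)| ^ (critExp N α - 2)) ψ)
    (hφ1 : ∀ X, 0 ≤ yc X → R ≤ ‖X‖ → (‖X‖ ^ 2) ^ (-s) / 2 ≤ φ X)
    (hφ2 : ∀ X, 0 ≤ yc X → R ≤ ‖X‖ → φ X ≤ (‖X‖ ^ 2) ^ (-s))
    (hψ1 : ∀ X, 0 ≤ yc X → R ≤ ‖X‖ → (‖X‖ ^ 2) ^ (-b) / 2 ≤ ψ X)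
    {X : Euc (N + 1)} (hX : 0 ≤ yc X) (hXR : R ≤ ‖X‖) :
    |v X| ≤ 2 * (R ^ 2) ^ (s - 2 * b) * (‖X‖ ^ 2) ^ (-s) := by
  refine abs_le'.2 ⟨hv.le_of_barriers hR hb hslow hφ hψ hφ1 hφ2 hψ1 hX hXR, ?_⟩
  have hslow' : ∀ X, 0 ≤ yc X → R ≤ ‖X‖ → |-v X| ≤ (‖X‖ ^ 2) ^ (-(2 * b)) := fun X hX hXR => by
    rw [abs_neg]; exact hslow X hX hXR
  have hw : (fun x : Euc N => |v (pt x 0)| ^ (critExp N α - 2))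
      = fun x => |-v (pt x 0)| ^ (critExp N α - 2) := by simp only [abs_neg]
  rw [hw] at hφ hψ
  exact hv.neg.le_of_barriers hR hb hslow' hφ hψ hφ1 hφ2 hψ1 hX hXR

lemma rpow_critExp_le {N : ℕ} {α : ℝ} (hα : 0 < α) (hN : 2 * α < (N : ℝ)) {a A q t : ℝ}
    (ha : 0 ≤ a) (hA : 0 ≤ A) (hq : 0 < q)
    (h : a ≤ A * q ^ (-(t * (((N : ℝ) - 2 * α) / 2)))) :
    a ^ (critExp N α - 2) ≤ A ^ (critExp N α - 2) * q ^ (-(2 * t * α)) := by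
  have hγ := critExp_sub_two_pos hα hN
  refine (Real.rpow_le_rpow ha h hγ.le).trans (le_of_eq ?_)
  rw [Real.mul_rpow hA (by positivity), ← Real.rpow_mul hq.le]
  congr 2
  linear_combination (-t) * mul_critExp_sub_two hN

/-- Decay at the rate of the fundamental solution. -/
lemma CritSol.exists_fast_decay {N : ℕ} {α : ℝ} (hα : α ∈ Set.Ioo (0 : ℝ) 1)
    (hN : 2 * α < (N : ℝ)) {v : Euc (N + 1) → ℝ} (hv : CritSol N α v 0) :
    ∃ R > 0, ∃ A > 0, ∀ X : Euc (N + 1), 0 ≤ yc X → R ≤ ‖X‖ →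
      |v X| ≤ A * (‖X‖ ^ 2) ^ (-(((N : ℝ) - 2 * α) / 2)) := by
  obtain ⟨hα0, hα1⟩ := id hα
  set β := ((N : ℝ) - 2 * α) / 2 with hβ
  have hβ0 : 0 < β := by rw [hβ]; linarith
  set γ := critExp N α - 2 with hγ
  have hγ0 : 0 < γ := critExp_sub_two_pos hα0 hN
  obtain ⟨κ₁, hκ₁, hb1⟩ := exists_barrier (N := N) hα (s := 3 / 4 * β) (by positivity)
    (by linarith)
  obtain ⟨κ₂, hκ₂, hb2⟩ := exists_barrier (N := N) hα (s := β / 4) (by positivity) (by linarith)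
  obtain ⟨κ₃, hκ₃, R₀, hR₀, hb3⟩ := exists_sharp_barrier hα hN
  set κ := min κ₁ κ₂ with hκ
  have hκ0 : 0 < κ := lt_min hκ₁ hκ₂
  set δ := min 1 (κ ^ γ⁻¹) with hδ
  have hδ0 : 0 < δ := lt_min one_pos (by positivity)
  have hδκ : δ ^ γ ≤ κ := by
    refine (Real.rpow_le_rpow hδ0.le (min_le_right _ _) hγ0.le).trans (le_of_eq ?_)
    rw [← Real.rpow_mul hκ0.le, inv_mul_cancel₀ hγ0.ne', Real.rpow_one]
  obtain ⟨R₁, hR₁, hdec⟩ := hv.exists_slow_decay hα hN hδ0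
  have hδv : ∀ X : Euc (N + 1), 0 ≤ yc X → R₁ ≤ ‖X‖ →
      |v X| ≤ δ * (‖X‖ ^ 2) ^ (-(1 / 2 * β)) := fun X hX hXR => by
    have hX0 : 0 < ‖X‖ := hR₁.trans_le hXR
    have h1 : (‖X‖ ^ 2) ^ (-(1 / 2 * β)) = (‖X‖ ^ β)⁻¹ := by
      rw [← Real.rpow_neg hX0.le, ← Real.rpow_two, ← Real.rpow_mul hX0.le]
      ring_nf
    rw [h1, ← div_eq_mul_inv, le_div_iff₀ (by positivity), mul_comm]
    exact hdec X hX hXR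
  have hslow : ∀ X : Euc (N + 1), 0 ≤ yc X → R₁ ≤ ‖X‖ →
      |v X| ≤ (‖X‖ ^ 2) ^ (-(2 * (β / 4))) := fun X hX hXR => by
    have h1 := hδv X hX hXR
    rw [show 1 / 2 * β = 2 * (β / 4) by ring] at h1
    exact h1.trans (mul_le_of_le_one_left (by positivity) (min_le_left _ _))
  have hw : ∀ x : Euc N, R₁ ≤ ‖x‖ → |v (pt x 0)| ^ γ * (‖x‖ ^ 2) ^ α ≤ κ := fun x hx => by
    have hq : 0 < ‖x‖ ^ 2 := by have := hR₁.trans_le hx; positivity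
    have h1 := hδv (pt x 0) (yc_pt x 0).ge (by rwa [norm_pt_zero_right])
    rw [norm_pt_zero_right] at h1
    have h2 := rpow_critExp_le hα0 hN (abs_nonneg _) hδ0.le hq h1
    calc |v (pt x 0)| ^ γ * (‖x‖ ^ 2) ^ α
        ≤ δ ^ γ * (‖x‖ ^ 2) ^ (-(2 * (1 / 2) * α)) * (‖x‖ ^ 2) ^ α :=
          mul_le_mul_of_nonneg_right h2 (by positivity)
      _ = δ ^ γ := by
          rw [mul_assoc, ← Real.rpow_add hq, show -(2 * (1 / 2) * α) + α = 0 by ring,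
            Real.rpow_zero, mul_one]
      _ ≤ κ := hδκ
  obtain ⟨φ₁, hφ₁, hφ₁l, hφ₁u⟩ := hb1 R₁ hR₁ _ fun x hx => (hw x hx).trans (min_le_left _ _)
  obtain ⟨ψ₁, hψ₁, hψ₁l, -⟩ := hb2 R₁ hR₁ _ fun x hx => (hw x hx).trans (min_le_right _ _)
  set A₁ := 2 * (R₁ ^ 2) ^ (3 / 4 * β - 2 * (β / 4)) with hA₁
  have hA₁0 : 0 < A₁ := by positivity
  have hmid : ∀ X : Euc (N + 1), 0 ≤ yc X → R₁ ≤ ‖X‖ →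
      |v X| ≤ A₁ * (‖X‖ ^ 2) ^ (-(3 / 4 * β)) := fun X hX hXR =>
    hv.abs_le_of_barriers hR₁ (by positivity) hslow hφ₁ hψ₁ hφ₁l hφ₁u hψ₁l hX hXR
  obtain ⟨M, hM, hlarge⟩ := tendsto_normSq_rpow_neg (s := α / 4) (by positivity)
    (by positivity : 0 < κ₃ / A₁ ^ γ)
  set R := R₁ + R₀ + M with hR
  have hR0 : 0 < R := by positivity
  have hR1 : R₁ ≤ R := by linarith
  have hw2 : ∀ x : Euc N, R ≤ ‖x‖ → |v (pt x 0)| ^ γ * (‖x‖ ^ 2) ^ (5 / 4 * α) ≤ κ₃ :=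
    fun x hx => by
      have hq : 0 < ‖x‖ ^ 2 := by have := hR0.trans_le hx; positivity
      have h1 := hmid (pt x 0) (yc_pt x 0).ge (by rw [norm_pt_zero_right]; linarith)
      rw [norm_pt_zero_right] at h1
      have h2 := rpow_critExp_le hα0 hN (abs_nonneg _) hA₁0.le hq h1
      calc |v (pt x 0)| ^ γ * (‖x‖ ^ 2) ^ (5 / 4 * α)
          ≤ A₁ ^ γ * (‖x‖ ^ 2) ^ (-(2 * (3 / 4) * α)) * (‖x‖ ^ 2) ^ (5 / 4 * α) :=
            mul_le_mul_of_nonneg_right h2 (by positivity)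
        _ = A₁ ^ γ * (‖x‖ ^ 2) ^ (-(α / 4)) := by
            rw [mul_assoc, ← Real.rpow_add hq]
            ring_nf
        _ ≤ A₁ ^ γ * (κ₃ / A₁ ^ γ) :=
            mul_le_mul_of_nonneg_left (hlarge _ (by linarith)) (by positivity)
        _ = κ₃ := by field_simp
  obtain ⟨φ₂, hφ₂, hφ₂l, hφ₂u⟩ := hb3 R (by linarith) _ (fun x => by positivity) hw2
  obtain ⟨ψ₂, hψ₂, hψ₂l, -⟩ := hb2 R hR0 _ fun x hx =>
    (hw x (hR1.trans hx)).trans (min_le_right _ _)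
  refine ⟨R, hR0, 2 * (R ^ 2) ^ (β - 2 * (β / 4)), by positivity, fun X hX hXR => ?_⟩
  exact hv.abs_le_of_barriers hR0 (by positivity) (fun X hX hXR => hslow X hX (hR1.trans hXR))
    hφ₂ hψ₂ hφ₂l hφ₂u hψ₂l hX hXR

/-- Proposition B.1, decay estimate: a finite-energy solution of the
critical problem on the half-space decays like `(1 + |X|²)^{-(N-2α)/2}`. -/
theorem decay_estimate
    (N : ℕ) (α : ℝ) (hα : α ∈ Set.Ioo (0 : ℝ) 1) (hN : 2 * α < (N : ℝ))
    (v : Euc (N + 1) → ℝ)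
    (hc : ContinuousOn v {X | 0 ≤ yc X})
    (hsm : ContDiffOn ℝ 2 v (upperHalf N))
    (hen : IntegrableOn (eDen α v) (upperHalf N))
    (hpde : ∀ X ∈ upperHalf N, dvg (wgrad α v) X = 0)
    (hneu : ∀ x : Euc N,
      NeumannLim α v x (-(|v (pt x 0)| ^ (critExp N α - 2) * v (pt x 0)))) :
    ∃ C > 0, ∀ X : Euc (N + 1), 0 ≤ yc X →
      |v X| ≤ C * (1 + ‖X‖ ^ 2) ^ (-(((N : ℝ) - 2 * α) / 2)) := by
  obtain ⟨hα0, hα1⟩ := id hα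
  set β := ((N : ℝ) - 2 * α) / 2 with hβ
  have hβ0 : 0 < β := by rw [hβ]; linarith
  have hsmooth : ∀ X, 0 < yc X → ContDiffAt ℝ 2 v X := fun X hX =>
    hsm.contDiffAt (isOpen_upperHalf.mem_nhds hX)
  have hharm : HarmExt α v := ⟨hc, hsmooth, fun X hX => by
    have h := hpde X hX
    rw [dvg_wgrad (hsmooth X hX) hX] at h
    exact (mul_eq_zero.1 h).resolve_left (Real.rpow_pos_of_pos hX _).ne'⟩
  obtain ⟨c, hlim⟩ := hharm.exists_limit hα hN hen
  have hcrit : CritSol N α v c := ⟨hharm, hneu, hlim⟩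
  obtain rfl := hcrit.limit_eq_zero hα hN
  obtain ⟨R, hR, A, hA, hdec⟩ := hcrit.exists_fast_decay hα hN
  obtain ⟨B, hB⟩ := (isCompact_halfBall (0 : Euc (N + 1)) (max R 1)).exists_bound_of_continuousOn
    (hc.mono inter_subset_right)
  have hR1 : 1 ≤ max R 1 := le_max_right _ _
  set E := (1 + max R 1 ^ 2) ^ β with hE
  have hE0 : 0 < E := by positivity
  set D := max B 0 with hD
  have hD0 : 0 ≤ D := le_max_right _ _
  refine ⟨A * 2 ^ β + D * E, by positivity, fun X hX => ?_⟩
  have hX0 : 0 < (1 + ‖X‖ ^ 2) ^ (-β) := by positivity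
  rw [add_mul]
  rcases le_total ‖X‖ (max R 1) with h | h
  · have h1 : |v X| ≤ D := (hB X ⟨by simpa using h, hX⟩).trans (le_max_left _ _)
    have h2 : 1 ≤ E * (1 + ‖X‖ ^ 2) ^ (-β) := by
      rw [Real.rpow_neg (by positivity), ← div_eq_mul_inv, one_le_div (by positivity)]
      exact Real.rpow_le_rpow (by positivity) (by gcongr) hβ0.le
    have h3 : D ≤ D * E * (1 + ‖X‖ ^ 2) ^ (-β) := by
      rw [mul_assoc]; exact le_mul_of_one_le_right hD0 h2
    have h4 : 0 ≤ A * 2 ^ β * (1 + ‖X‖ ^ 2) ^ (-β) := by positivity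
    linarith
  · have hX1 : 1 ≤ ‖X‖ := hR1.trans h
    have h1 := hdec X hX ((le_max_left _ _).trans h)
    have h2 : (‖X‖ ^ 2) ^ (-β) ≤ 2 ^ β * (1 + ‖X‖ ^ 2) ^ (-β) := by
      have h3 : ((1 + ‖X‖ ^ 2) / 2) ^ (-β) = 2 ^ β * (1 + ‖X‖ ^ 2) ^ (-β) := by
        rw [Real.div_rpow (by positivity) (by norm_num), Real.rpow_neg (by norm_num : (0 : ℝ) ≤ 2)]
        field_simp
      rw [← h3]
      exact Real.rpow_le_rpow_of_nonpos (by positivity) (by nlinarith) (by linarith)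
    have h4 : A * (‖X‖ ^ 2) ^ (-β) ≤ A * 2 ^ β * (1 + ‖X‖ ^ 2) ^ (-β) := by
      rw [mul_assoc]; exact mul_le_mul_of_nonneg_left h2 hA.le
    have h5 : 0 ≤ D * E * (1 + ‖X‖ ^ 2) ^ (-β) := by positivity
    linarith

end
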